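/- Let ω^T ∈ A^{[AB]}(T) and let u_0^* be the backward-forward datum associated to ω^T. Then I_T^{[AB]}(ω^T) is an affine cone with vertex u_0^*: for every u_0 ∈ I_T^{[AB]}(ω^T) and every λ ≥ 0, the function u_0^* + λ(u_0 − u_0^*) belongs to I_T^{[AB]}(ω^T). -/

import Mathlib

open MeasureTheory Set Filter

noncomputable section

/-- The discontinuous flux `f(x,u) = f_l(u)` for `x < 0`, `f_r(u)` for `x > 0`
(the value at the interface is taken to be `f_r(u)`). -/
def dflux (fl fr : ℝ → ℝ) (x u : ℝ) : ℝ := if x < 0 then fl u else fr u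

/-- The connection function `c^{AB}`. -/
def cAB (A B : ℝ) (x : ℝ) : ℝ := if x ≤ 0 then A else B

/-- An `AB`-entropy solution of `u_t + f(x,u)_x = 0` on `ℝ × [0,∞)` with
initial datum `u0`, for the flux `f(x,·) = fl` on `x<0` and `fr` on `x>0`,
relative to the connection `(A,B)`.  The structure bundles the solution `u`
(as a function of `(x,t)`), its one-sided spatial limits `um x t = u(x-,t)` and
`up x t = u(x+,t)` (for `t > 0`), the weak (distributional) formulation, the
Kružkov entropy inequalities away from the interface, the `AB`-interface
entropy inequality, `L¹_loc`-continuity in time and the initial condition. -/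
structure ABSol (fl fr : ℝ → ℝ) (A B : ℝ) (u0 : ℝ → ℝ) where
  u : ℝ → ℝ → ℝ
  meas : Measurable (Function.uncurry u)
  bdd : ∃ M : ℝ, ∀ x t, |u x t| ≤ M
  um : ℝ → ℝ → ℝ
  up : ℝ → ℝ → ℝ
  um_spec : ∀ x t, 0 < t →
    Tendsto (fun y => u y t) (nhdsWithin x (Iio x)) (nhds (um x t))
  up_spec : ∀ x t, 0 < t →
    Tendsto (fun y => u y t) (nhdsWithin x (Ioi x)) (nhds (up x t))
  weak : ∀ φ : ℝ → ℝ → ℝ,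
    ContDiff ℝ 1 (fun p : ℝ × ℝ => φ p.1 p.2) →
    HasCompactSupport (fun p : ℝ × ℝ => φ p.1 p.2) →
    (∀ x t, t ≤ 0 → φ x t = 0) →
    (∫ p : ℝ × ℝ, (u p.1 p.2 * deriv (fun s => φ p.1 s) p.2 +
        dflux fl fr p.1 (u p.1 p.2) * deriv (fun y => φ y p.2) p.1)) = 0
  kruzkov_l : ∀ (k : ℝ) (φ : ℝ → ℝ → ℝ),
    ContDiff ℝ 1 (fun p : ℝ × ℝ => φ p.1 p.2) →
    HasCompactSupport (fun p : ℝ × ℝ => φ p.1 p.2) →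
    (∀ x t, 0 ≤ φ x t) →
    (∀ x t, 0 ≤ x ∨ t ≤ 0 → φ x t = 0) →
    0 ≤ ∫ p : ℝ × ℝ, (|u p.1 p.2 - k| * deriv (fun s => φ p.1 s) p.2 +
        Real.sign (u p.1 p.2 - k) * (fl (u p.1 p.2) - fl k) *
          deriv (fun y => φ y p.2) p.1)
  kruzkov_r : ∀ (k : ℝ) (φ : ℝ → ℝ → ℝ),
    ContDiff ℝ 1 (fun p : ℝ × ℝ => φ p.1 p.2) →
    HasCompactSupport (fun p : ℝ × ℝ => φ p.1 p.2) →
    (∀ x t, 0 ≤ φ x t) →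
    (∀ x t, x ≤ 0 ∨ t ≤ 0 → φ x t = 0) →
    0 ≤ ∫ p : ℝ × ℝ, (|u p.1 p.2 - k| * deriv (fun s => φ p.1 s) p.2 +
        Real.sign (u p.1 p.2 - k) * (fr (u p.1 p.2) - fr k) *
          deriv (fun y => φ y p.2) p.1)
  interfaceEntropy : ∀ φ : ℝ → ℝ → ℝ,
    ContDiff ℝ 1 (fun p : ℝ × ℝ => φ p.1 p.2) →
    HasCompactSupport (fun p : ℝ × ℝ => φ p.1 p.2) →
    (∀ x t, 0 ≤ φ x t) →
    (∀ x t, t ≤ 0 → φ x t = 0) →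
    0 ≤ ∫ p : ℝ × ℝ, (|u p.1 p.2 - cAB A B p.1| * deriv (fun s => φ p.1 s) p.2 +
        Real.sign (u p.1 p.2 - cAB A B p.1) *
          (dflux fl fr p.1 (u p.1 p.2) - dflux fl fr p.1 (cAB A B p.1)) *
          deriv (fun y => φ y p.2) p.1)
  timeCont : ∀ (r t₀ : ℝ), 0 ≤ t₀ →
    Tendsto (fun t => ∫ x in Icc (-r) r, |u x t - u x t₀|)
      (nhdsWithin t₀ (Ici 0)) (nhds 0)
  init : ∀ᵐ x : ℝ ∂volume, u x 0 = u0 x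

/-- `AB`-genuine/interface characteristic for the `AB`-entropy solution `sol`,
on the time interval `[0,T]`, where `γ = f_l(A) = f_r(B)`. -/
def IsABgic (T : ℝ) (fl fr : ℝ → ℝ) (γ : ℝ) {A B : ℝ} {u0 : ℝ → ℝ}
    (sol : ABSol fl fr A B u0) (ζ : ℝ → ℝ) : Prop :=
  (∃ K : NNReal, LipschitzOnWith K ζ (Icc 0 T)) ∧
  (∀ᵐ t ∂(volume.restrict (Icc 0 T)),
    (ζ t < 0 → HasDerivAt ζ (deriv fl (sol.um (ζ t) t)) t ∧
      deriv fl (sol.um (ζ t) t) = deriv fl (sol.up (ζ t) t)) ∧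
    (0 < ζ t → HasDerivAt ζ (deriv fr (sol.um (ζ t) t)) t ∧
      deriv fr (sol.um (ζ t) t) = deriv fr (sol.up (ζ t) t)) ∧
    (ζ t = 0 → fl (sol.um 0 t) = γ ∧ fr (sol.up 0 t) = γ))

/-- `C(u,x)`: the set of `AB`-genuine/interface characteristics of `sol`
reaching `x` at time `T`. -/
def charSet (T : ℝ) (fl fr : ℝ → ℝ) (γ : ℝ) {A B : ℝ} {u0 : ℝ → ℝ}
    (sol : ABSol fl fr A B u0) (x : ℝ) : Set (ℝ → ℝ) :=
  {ζ | IsABgic T fl fr γ sol ζ ∧ ζ T = x}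

/-- `C₀(u,x)`: the set of initial positions `ζ(0)` of characteristics in `C(u,x)`. -/
def charSet0 (T : ℝ) (fl fr : ℝ → ℝ) (γ : ℝ) {A B : ℝ} {u0 : ℝ → ℝ}
    (sol : ABSol fl fr A B u0) (x : ℝ) : Set ℝ :=
  (fun ζ : ℝ → ℝ => ζ 0) '' charSet T fl fr γ sol x

/-- Membership in `L^∞(ℝ)`: measurable and (essentially) bounded. -/
def IsLinf (g : ℝ → ℝ) : Prop :=
  Measurable g ∧ ∃ M : ℝ, ∀ᵐ x : ℝ ∂volume, |g x| ≤ M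

/-- `ω ∈ A^{[AB]}(T)`: the profile `ω` is attainable at time `T`. -/
def Attainable (T : ℝ) (fl fr : ℝ → ℝ) (A B : ℝ) (ω : ℝ → ℝ) : Prop :=
  ∃ u0 : ℝ → ℝ, IsLinf u0 ∧
    ∃ sol : ABSol fl fr A B u0, ∀ᵐ x : ℝ ∂volume, sol.u x T = ω x

/-- `I_T^{[AB]}(ω)`: the set of (bounded) initial data whose `AB`-entropy
solution coincides a.e. with `ω` at time `T`. -/
def InitialSet (T : ℝ) (fl fr : ℝ → ℝ) (A B : ℝ) (ω : ℝ → ℝ) : Set (ℝ → ℝ) :=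
  {u0 | IsLinf u0 ∧
    ∃ sol : ABSol fl fr A B u0, ∀ᵐ x : ℝ ∂volume, sol.u x T = ω x}

/-- `x` is a point of continuity of `ω`: the one-sided limits exist and coincide. -/
def ContinuityPt (ω : ℝ → ℝ) (x : ℝ) : Prop :=
  ∃ l : ℝ, Tendsto ω (nhdsWithin x (Iio x)) (nhds l) ∧
    Tendsto ω (nhdsWithin x (Ioi x)) (nhds l)

section
open scoped Topology NNReal ContDiff

abbrev Pl := ℝ × ℝ

def bmp (n : ℕ) : ContDiffBump (0 : Pl) where
  rIn := 1 / (2 * ((n : ℝ) + 1))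
  rOut := 1 / ((n : ℝ) + 1)
  rIn_pos := by positivity
  rIn_lt_rOut := by
    apply one_div_lt_one_div_of_lt <;> nlinarith [Nat.cast_nonneg (α := ℝ) n]

def rho (n : ℕ) : Pl → ℝ := (bmp n).normed volume

def avg (n : ℕ) (F : Pl → ℝ) : ℝ := ∫ y, rho n y * F y

def mol (n : ℕ) (g : Pl → ℝ) (p : Pl) : ℝ := avg n fun y => g (p - y)

def dX (g : Pl → ℝ) (p : Pl) : ℝ := fderiv ℝ g p (1, 0)
def dT (g : Pl → ℝ) (p : Pl) : ℝ := fderiv ℝ g p (0, 1)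

lemma rho_nonneg (n : ℕ) (y : Pl) : 0 ≤ rho n y := (bmp n).nonneg_normed y
lemma rho_cont (n : ℕ) : Continuous (rho n) := (bmp n).continuous_normed
lemma rho_cpt (n : ℕ) : HasCompactSupport (rho n) := (bmp n).hasCompactSupport_normed
lemma rho_int (n : ℕ) : ∫ y, rho n y = 1 := (bmp n).integral_normed
lemma rho_integrable (n : ℕ) : Integrable (rho n) := (bmp n).integrable_normed
lemma rho_zero (n : ℕ) {y : Pl} (h : 1 / ((n : ℝ) + 1) ≤ ‖y‖) : rho n y = 0 := by
  have : y ∉ Function.support (rho n) := by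
    unfold rho
    rw [(bmp n).support_normed_eq]
    simpa [bmp] using h
  simpa using this

lemma rho_mul_integrable (n : ℕ) {F : Pl → ℝ} (hF : Continuous F) :
    Integrable fun y => rho n y * F y :=
  ((rho_cont n).mul hF).integrable_of_hasCompactSupport (rho_cpt n).mul_right

lemma avg_mono (n : ℕ) {F H : Pl → ℝ} (hF : Continuous F) (hH : Continuous H)
    (h : ∀ y, ‖y‖ < 1 / ((n : ℝ) + 1) → F y ≤ H y) : avg n F ≤ avg n H := by
  refine integral_mono (rho_mul_integrable n hF) (rho_mul_integrable n hH) fun y => ?_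
  rcases lt_or_ge ‖y‖ (1 / ((n : ℝ) + 1)) with hy | hy
  · exact mul_le_mul_of_nonneg_left (h y hy) (rho_nonneg n y)
  · simp [rho_zero n hy]

lemma avg_add (n : ℕ) {F H : Pl → ℝ} (hF : Continuous F) (hH : Continuous H) :
    avg n (fun y => F y + H y) = avg n F + avg n H := by
  unfold avg
  rw [← integral_add (rho_mul_integrable n hF) (rho_mul_integrable n hH)]
  simp [mul_add]

lemma avg_const (n : ℕ) (c : ℝ) : avg n (fun _ => c) = c := by
  simp [avg, integral_mul_const, rho_int]

lemma avg_smul (n : ℕ) (c : ℝ) (F : Pl → ℝ) : avg n (fun y => c * F y) = c * avg n F := by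
  unfold avg
  rw [← integral_const_mul]
  congr 1; ext y; ring

lemma mol_le_mol (n : ℕ) {g h : Pl → ℝ} (hg : Continuous g) (hh : Continuous h) {p q : Pl} {C : ℝ}
    (H : ∀ y, ‖y‖ < 1 / ((n : ℝ) + 1) → g (p - y) ≤ h (q - y) + C) :
    mol n g p ≤ mol n h q + C := by
  have := avg_mono n (F := fun y => g (p - y)) (H := fun y => h (q - y) + C)
    (by fun_prop) (by fun_prop) H
  rwa [avg_add n (by fun_prop) (by fun_prop), avg_const] at this

lemma mol_abs_sub_le (n : ℕ) {g : Pl → ℝ} {K : ℝ≥0} (hg : LipschitzWith K g) (p : Pl) :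
    |mol n g p - g p| ≤ K / ((n : ℝ) + 1) := by
  have hgc := hg.continuous
  have key : ∀ y : Pl, ‖y‖ < 1 / ((n : ℝ) + 1) → |g (p - y) - g p| ≤ K / ((n : ℝ) + 1) := by
    intro y hy
    have := hg.dist_le_mul (p - y) p
    rw [Real.dist_eq, dist_eq_norm] at this
    simp only [sub_sub_cancel_left, norm_neg] at this
    refine this.trans ?_
    rw [div_eq_mul_one_div]
    exact mul_le_mul_of_nonneg_left hy.le K.2
  have c1 := avg_mono n (F := fun y => g (p - y)) (H := fun _ => g p + K / ((n : ℝ) + 1))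
    (by fun_prop) (by fun_prop) fun y hy => by linarith [abs_le.1 (key y hy)]
  have c2 := avg_mono n (H := fun y => g (p - y)) (F := fun _ => g p - K / ((n : ℝ) + 1))
    (by fun_prop) (by fun_prop) fun y hy => by linarith [abs_le.1 (key y hy)]
  rw [avg_const] at c1 c2
  rw [abs_le]; unfold mol; constructor <;> linarith

lemma mol_lip (n : ℕ) {g : Pl → ℝ} {K : ℝ≥0} (hg : LipschitzWith K g) :
    LipschitzWith K (mol n g) := by
  refine LipschitzWith.of_le_add_mul K fun p q => ?_
  refine mol_le_mol n hg.continuous hg.continuous fun y _ => ?_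
  have := hg.le_add_mul (p - y) (q - y)
  simpa using this

lemma mol_smooth (n : ℕ) {g : Pl → ℝ} (hg : Continuous g) : ContDiff ℝ ∞ (mol n g) := by
  have := (rho_cpt n).contDiff_convolution_left (ContinuousLinearMap.lsmul ℝ ℝ)
    (μ := volume) (f := rho n) (g := g) (n := ⊤) ((bmp n).contDiff_normed) hg.locallyIntegrable
  exact this

lemma mol_zero (n : ℕ) {g : Pl → ℝ} {p : Pl}
    (h : ∀ q, ‖p - q‖ < 1 / ((n : ℝ) + 1) → g q = 0) : mol n g p = 0 := by
  unfold mol avg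
  rw [← integral_zero Pl ℝ (μ := volume)]
  congr 1; ext y
  rcases lt_or_ge ‖y‖ (1 / ((n : ℝ) + 1)) with hy | hy
  · simp [h (p - y) (by simpa using hy)]
  · simp [rho_zero n hy]

lemma mol_fderiv (n : ℕ) {g : Pl → ℝ} {K : ℝ≥0} (hg : LipschitzWith K g) (p v : Pl) :
    fderiv ℝ (mol n g) p v = avg n fun y => fderiv ℝ g (p - y) v := by
  have hgc := hg.continuous
  have hd : ∀ᵐ y : Pl, DifferentiableAt ℝ g (p - y) := by
    have := (Measure.measurePreserving_sub_left (volume : Measure Pl) p).quasiMeasurePreserving.ae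
      hg.ae_differentiableAt
    exact this
  have hm : Measurable fun y : Pl => fderiv ℝ g (p - y) :=
    (measurable_fderiv ℝ g).comp (measurable_const.sub measurable_id)
  have hb : ∀ᵐ y : Pl, ‖rho n y • fderiv ℝ g (p - y)‖ ≤ rho n y * K := by
    refine Eventually.of_forall fun y => ?_
    rw [norm_smul, Real.norm_of_nonneg (rho_nonneg n y)]
    exact mul_le_mul_of_nonneg_left (norm_fderiv_le_of_lipschitz ℝ hg) (rho_nonneg n y)
  have hmes : AEStronglyMeasurable (fun y : Pl => rho n y • fderiv ℝ g (p - y)) volume :=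
    ((rho_cont n).measurable.smul hm).aestronglyMeasurable
  have hI : Integrable (fun y : Pl => rho n y • fderiv ℝ g (p - y)) volume :=
    Integrable.mono' ((rho_integrable n).mul_const (K : ℝ)) hmes hb
  have key := hasFDerivAt_integral_of_dominated_loc_of_lip (𝕜 := ℝ) (μ := (volume : Measure Pl))
    (F := fun q y => rho n y * g (q - y)) (F' := fun y => rho n y • fderiv ℝ g (p - y))
    (x₀ := p) (s := Metric.ball p 1) (bound := fun y => rho n y * K) (Metric.ball_mem_nhds p one_pos)
    (Eventually.of_forall fun q => (rho_mul_integrable n (by fun_prop)).aestronglyMeasurable)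
    (rho_mul_integrable n (by fun_prop)) hmes
    (Eventually.of_forall fun y => by
      refine LipschitzWith.lipschitzOnWith ?_
      refine LipschitzWith.of_dist_le_mul fun q r => ?_
      have h1 := hg.dist_le_mul (q - y) (r - y)
      have h2 := rho_nonneg n y
      rw [Real.dist_eq] at *
      rw [← mul_sub, abs_mul, abs_of_nonneg h2, Real.coe_nnabs, abs_of_nonneg (mul_nonneg h2 K.coe_nonneg), mul_assoc]
      simpa using mul_le_mul_of_nonneg_left h1 h2)
    ((rho_integrable n).mul_const _)
    (hd.mono fun y hy => by
      have h1 : HasFDerivAt (fun q => g (q - y)) (fderiv ℝ g (p - y)) p := by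
        have := hy.hasFDerivAt.comp p ((hasFDerivAt_id p).sub_const y)
        simpa [Function.comp_def] using this
      exact h1.const_mul (rho n y))
  have e : HasFDerivAt (mol n g) (∫ y, rho n y • fderiv ℝ g (p - y)) p := key.2
  rw [e.fderiv, ContinuousLinearMap.integral_apply hI]
  rfl

lemma mol_tendsto (v : Pl) {g : Pl → ℝ} {K : ℝ≥0} (hg : LipschitzWith K g) :
    ∀ᵐ p : Pl, Tendsto (fun n => fderiv ℝ (mol n g) p v) atTop (𝓝 (fderiv ℝ g p v)) := by
  have hm : Measurable fun p : Pl => fderiv ℝ g p v := measurable_fderiv_apply_const ℝ g v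
  have hb : ∀ p : Pl, ‖fderiv ℝ g p v‖ ≤ K * ‖v‖ := fun p =>
    ((fderiv ℝ g p).le_opNorm v).trans
      (mul_le_mul_of_nonneg_right (norm_fderiv_le_of_lipschitz ℝ hg) (norm_nonneg v))
  have hl : LocallyIntegrable (fun p : Pl => fderiv ℝ g p v) volume := by
    refine (locallyIntegrable_const (K * ‖v‖)).mono hm.aestronglyMeasurable ?_
    refine Eventually.of_forall fun p => (hb p).trans (le_abs_self _)
  have hr : Tendsto (fun n : ℕ => (bmp n).rOut) atTop (𝓝 0) := tendsto_one_div_add_atTop_nhds_zero_nat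
  have := ContDiffBump.ae_convolution_tendsto_right_of_locallyIntegrable (K := 2) hr
    (Eventually.of_forall fun n => by
      simp only [bmp]; rw [mul_one_div, mul_comm 2, ← div_div]
      field_simp; norm_num) hl
  filter_upwards [this] with p hp
  refine hp.congr fun n => ?_
  rw [mol_fderiv n hg]
  rfl


lemma dX_le {g : Pl → ℝ} {K : ℝ≥0} (hg : LipschitzWith K g) (p : Pl) : |dX g p| ≤ K := by
  refine ((fderiv ℝ g p).le_opNorm _).trans ?_
  simpa using norm_fderiv_le_of_lipschitz ℝ hg

lemma dT_le {g : Pl → ℝ} {K : ℝ≥0} (hg : LipschitzWith K g) (p : Pl) : |dT g p| ≤ K := by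
  refine ((fderiv ℝ g p).le_opNorm _).trans ?_
  simpa using norm_fderiv_le_of_lipschitz ℝ hg

lemma dX_meas (g : Pl → ℝ) : Measurable (dX g) := measurable_fderiv_apply_const ℝ g _
lemma dT_meas (g : Pl → ℝ) : Measurable (dT g) := measurable_fderiv_apply_const ℝ g _

def EntOn (O : Set Pl) (g1 g2 : Pl → ℝ) : Prop :=
  ∀ φ : Pl → ℝ, ContDiff ℝ 1 φ → HasCompactSupport φ → (∀ p, 0 ≤ φ p) → tsupport φ ⊆ O →
    0 ≤ ∫ p, (g1 p * dT φ p + g2 p * dX φ p)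

lemma dX_zero {φ : Pl → ℝ} {p : Pl} (h : p ∉ tsupport φ) : dX φ p = 0 := by
  have : φ =ᶠ[𝓝 p] fun _ => 0 := notMem_tsupport_iff_eventuallyEq.1 h
  simp [dX, this.fderiv_eq]

lemma dT_zero {φ : Pl → ℝ} {p : Pl} (h : p ∉ tsupport φ) : dT φ p = 0 := by
  have : φ =ᶠ[𝓝 p] fun _ => 0 := notMem_tsupport_iff_eventuallyEq.1 h
  simp [dT, this.fderiv_eq]

lemma test_bound {g1 g2 : Pl → ℝ} {C : ℝ} (b1 : ∀ p, |g1 p| ≤ C) (b2 : ∀ p, |g2 p| ≤ C)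
    {φ : Pl → ℝ} {K : ℝ≥0} (hφ : LipschitzWith K φ) {S : Set Pl} (hS : tsupport φ ⊆ S) (p : Pl) :
    ‖g1 p * dT φ p + g2 p * dX φ p‖ ≤ S.indicator (fun _ => C * K + C * K) p := by
  have hC : 0 ≤ C := (abs_nonneg _).trans (b1 p)
  by_cases hp : p ∈ S
  · rw [indicator_of_mem hp]
    refine (norm_add_le _ _).trans (add_le_add ?_ ?_) <;> rw [norm_mul]
    · exact mul_le_mul (b1 p) (dT_le hφ p) (norm_nonneg _) hC
    · exact mul_le_mul (b2 p) (dX_le hφ p) (norm_nonneg _) hC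
  · have : p ∉ tsupport φ := fun h => hp (hS h)
    simp [dX_zero this, dT_zero this, indicator_of_notMem hp]

lemma cpt_ind {S : Set Pl} (hS : IsCompact S) (c : ℝ) :
    Integrable (S.indicator fun _ => c) (volume : Measure Pl) :=
  (integrable_indicator_iff hS.measurableSet).2 (integrableOn_const hS.measure_lt_top.ne)

lemma test_meas {g1 g2 : Pl → ℝ} (m1 : Measurable g1) (m2 : Measurable g2) (φ : Pl → ℝ) :
    Measurable fun p => g1 p * dT φ p + g2 p * dX φ p :=
  (m1.mul (dT_meas φ)).add (m2.mul (dX_meas φ))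

lemma test_int {g1 g2 : Pl → ℝ} (m1 : Measurable g1) (m2 : Measurable g2)
    {C : ℝ} (b1 : ∀ p, |g1 p| ≤ C) (b2 : ∀ p, |g2 p| ≤ C)
    {φ : Pl → ℝ} {K : ℝ≥0} (hφ : LipschitzWith K φ) (hc : HasCompactSupport φ) :
    Integrable fun p => g1 p * dT φ p + g2 p * dX φ p :=
  (cpt_ind hc _).mono' (test_meas m1 m2 φ).aestronglyMeasurable
    (Eventually.of_forall fun p => test_bound b1 b2 hφ subset_rfl p)

lemma test_lim {g1 g2 : Pl → ℝ} (m1 : Measurable g1) (m2 : Measurable g2)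
    {C : ℝ} (b1 : ∀ p, |g1 p| ≤ C) (b2 : ∀ p, |g2 p| ≤ C)
    {φ : ℕ → Pl → ℝ} {ψ : Pl → ℝ} {K : ℝ≥0} (hφ : ∀ n, LipschitzWith K (φ n))
    {S : Set Pl} (hS : IsCompact S) (hs : ∀ n, tsupport (φ n) ⊆ S)
    (lX : ∀ᵐ p, Tendsto (fun n => dX (φ n) p) atTop (𝓝 (dX ψ p)))
    (lT : ∀ᵐ p, Tendsto (fun n => dT (φ n) p) atTop (𝓝 (dT ψ p))) :
    Tendsto (fun n => ∫ p, (g1 p * dT (φ n) p + g2 p * dX (φ n) p)) atTop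
      (𝓝 (∫ p, (g1 p * dT ψ p + g2 p * dX ψ p))) := by
  refine tendsto_integral_of_dominated_convergence (S.indicator fun _ => C * K + C * K)
    (fun n => (test_meas m1 m2 _).aestronglyMeasurable) (cpt_ind hS _)
    (fun n => Eventually.of_forall fun p => test_bound b1 b2 (hφ n) (hs n) p) ?_
  filter_upwards [lX, lT] with p h1 h2
  exact (h2.const_mul _).add (h1.const_mul _)

lemma mol_tsupport {φ : Pl → ℝ} {n : ℕ} {δ : ℝ} (h : 1 / ((n : ℝ) + 1) ≤ δ) :
    tsupport (mol n φ) ⊆ Metric.cthickening δ (tsupport φ) := by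
  refine closure_minimal ?_ Metric.isClosed_cthickening
  intro p hp
  by_contra hc
  refine hp (mol_zero n fun q hq => ?_)
  by_contra hq0
  refine hc (Metric.mem_cthickening_of_dist_le p q δ _ (subset_tsupport _ hq0) ?_)
  rw [dist_eq_norm]; linarith

lemma ent_lip {O : Set Pl} (hO : IsOpen O) {g1 g2 : Pl → ℝ} (m1 : Measurable g1) (m2 : Measurable g2)
    {C : ℝ} (b1 : ∀ p, |g1 p| ≤ C) (b2 : ∀ p, |g2 p| ≤ C) (hE : EntOn O g1 g2)
    {φ : Pl → ℝ} {K : ℝ≥0} (hφ : LipschitzWith K φ) (hc : HasCompactSupport φ)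
    (h0 : ∀ p, 0 ≤ φ p) (hs : tsupport φ ⊆ O) :
    0 ≤ ∫ p, (g1 p * dT φ p + g2 p * dX φ p) := by
  obtain ⟨δ, hδ, hδO⟩ := IsCompact.exists_cthickening_subset_open hc hO hs
  obtain ⟨N, hN⟩ := exists_nat_one_div_lt hδ
  have hn : ∀ n : ℕ, 1 / (((n + N : ℕ) : ℝ) + 1) ≤ δ := fun n => by
    refine le_trans ?_ hN.le
    apply one_div_le_one_div_of_le <;> push_cast <;> nlinarith [Nat.cast_nonneg (α := ℝ) n, Nat.cast_nonneg (α := ℝ) N]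
  refine ge_of_tendsto (test_lim m1 m2 b1 b2 (φ := fun n => mol (n + N) φ) (ψ := φ) (fun n => mol_lip _ hφ)
    (S := Metric.cthickening δ (tsupport φ)) (IsCompact.cthickening hc) (fun n => mol_tsupport (hn n)) ?_ ?_) ?_
  · filter_upwards [mol_tendsto (1, 0) hφ] with p hp using (tendsto_add_atTop_iff_nat N).2 hp
  · filter_upwards [mol_tendsto (0, 1) hφ] with p hp using (tendsto_add_atTop_iff_nat N).2 hp
  · refine Eventually.of_forall fun n => hE _ ((mol_smooth _ hφ.continuous).of_le (by exact_mod_cast le_top)) ?_ ?_ ?_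
    · exact (IsCompact.cthickening hc).of_isClosed_subset (isClosed_tsupport _) (mol_tsupport (hn n))
    · exact fun p => integral_nonneg fun y => mul_nonneg (rho_nonneg _ _) (h0 _)
    · exact (mol_tsupport (hn n)).trans hδO

lemma weak_smooth {W φ : Pl → ℝ} (hW : ContDiff ℝ ∞ W) (hφ : ContDiff ℝ 1 φ)
    (hc : HasCompactSupport φ) : ∫ p, (dX W p * dT φ p + -dT W p * dX φ p) = 0 := by
  have hf : ContDiff ℝ ∞ (fderiv ℝ W) := hW.fderiv_right (by simp)
  have hX : ∀ v, ContDiff ℝ ∞ fun p => fderiv ℝ W p v := fun v => hf.clm_apply contDiff_const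
  have hd : ∀ v, Continuous fun p => fderiv ℝ φ p v := fun v =>
    (hφ.continuous_fderiv (by simp)).clm_apply continuous_const
  have hdd : ∀ v w, Continuous fun p => fderiv ℝ (fun p => fderiv ℝ W p v) p w := fun v w =>
    ((hX v).continuous_fderiv (by simp)).clm_apply continuous_const
  have I1 : ∀ v w, Integrable fun p => fderiv ℝ W p v * fderiv ℝ φ p w := fun v w =>
    ((hX v).continuous.mul (hd w)).integrable_of_hasCompactSupport ((hc.fderiv_apply ℝ w).mul_left)
  have key : ∀ v w, ∫ p, fderiv ℝ W p v * fderiv ℝ φ p w =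
      -∫ p, fderiv ℝ (fun p => fderiv ℝ W p v) p w * φ p := fun v w =>
    integral_mul_fderiv_eq_neg_fderiv_mul_of_integrable
      (((hdd v w).mul hφ.continuous).integrable_of_hasCompactSupport hc.mul_left)
      (I1 v w)
      (((hX v).continuous.mul hφ.continuous).integrable_of_hasCompactSupport hc.mul_left)
      (fun x _ => ((hX v).differentiable (by simp)) x)
      (fun x _ => (hφ.differentiable (by simp)) x)
  have sym : ∀ p, fderiv ℝ (fun p => fderiv ℝ W p (1, 0)) p (0, 1) =
      fderiv ℝ (fun p => fderiv ℝ W p (0, 1)) p (1, 0) := by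
    intro p
    have h1 : IsSymmSndFDerivAt ℝ W p := hW.contDiffAt.isSymmSndFDerivAt (by simpa using WithTop.coe_le_coe.2 (le_top : (2 : ℕ∞) ≤ ⊤))
    have h2 : ∀ v w, fderiv ℝ (fun p => fderiv ℝ W p v) p w = fderiv ℝ (fderiv ℝ W) p w v := by
      intro v w
      rw [fderiv_clm_apply ((hf.differentiable (by simp)) p) (differentiableAt_const v)]
      simp
    rw [h2, h2, h1.eq]
  have e : ∀ p, dX W p * dT φ p + -dT W p * dX φ p =
    fderiv ℝ W p (1, 0) * fderiv ℝ φ p (0, 1) - fderiv ℝ W p (0, 1) * fderiv ℝ φ p (1, 0) := by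
    intro p; simp only [dX, dT]; ring
  simp_rw [e]
  rw [integral_sub (I1 _ _) (I1 _ _), key, key]
  simp_rw [sym]; simp

lemma weak_lip {W φ : Pl → ℝ} {K : ℝ≥0} (hW : LipschitzWith K W) (hφ : ContDiff ℝ 1 φ)
    (hc : HasCompactSupport φ) : ∫ p, (dX W p * dT φ p + -dT W p * dX φ p) = 0 := by
  obtain ⟨L, hL⟩ := hφ.lipschitzWith_of_hasCompactSupport hc (by simp)
  have : Tendsto (fun n => ∫ p, (dX (mol n W) p * dT φ p + -dT (mol n W) p * dX φ p)) atTop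
      (𝓝 (∫ p, (dX W p * dT φ p + -dT W p * dX φ p))) := by
    refine tendsto_integral_of_dominated_convergence ((tsupport φ).indicator fun _ => K * L + K * L)
      (fun n => (test_meas (dX_meas _) (dT_meas _).neg _).aestronglyMeasurable) (cpt_ind hc _)
      (fun n => Eventually.of_forall fun p => test_bound (dX_le (mol_lip n hW))
        (fun p => (abs_neg _).trans_le (dT_le (mol_lip n hW) p)) hL subset_rfl p) ?_
    filter_upwards [mol_tendsto (1, 0) hW, mol_tendsto (0, 1) hW] with p h1 h2
    exact (h1.mul_const _).add (h2.neg.mul_const _)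
  refine tendsto_nhds_unique this ?_
  simp_rw [weak_smooth (mol_smooth _ hW.continuous) hφ hc]
  exact tendsto_const_nhds

lemma lemE {g : Pl → ℝ} {K : ℝ≥0} (hg : LipschitzWith K g) {O : Set Pl} (hO : IsOpen O) {v p : Pl}
    {c r : ℝ} (h : ∀ᵐ q, q ∈ O → fderiv ℝ g q v ≤ c) (hr : 0 ≤ r)
    (hs : ∀ s ∈ Icc 0 r, p + s • v ∈ O) : g (p + r • v) - g p ≤ c * r := by
  have hcpt : IsCompact ((fun s : ℝ => p + s • v) '' Icc 0 r) := isCompact_Icc.image (by fun_prop)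
  obtain ⟨δ, hδ, hδO⟩ := hcpt.exists_cthickening_subset_open hO (by rintro _ ⟨s, hs', rfl⟩; exact hs s hs')
  have lim : ∀ q, Tendsto (fun n => mol n g q) atTop (𝓝 (g q)) := by
    intro q
    rw [tendsto_iff_dist_tendsto_zero]
    refine squeeze_zero (fun _ => dist_nonneg) (fun n => mol_abs_sub_le n hg q) ?_
    have := (tendsto_one_div_add_atTop_nhds_zero_nat (𝕜 := ℝ)).const_mul (K : ℝ)
    simpa [div_eq_mul_inv] using this
  refine le_of_tendsto ((lim _).sub (lim p)) ?_
  filter_upwards [(tendsto_one_div_add_atTop_nhds_zero_nat (𝕜 := ℝ)).eventually_lt_const hδ] with n hn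
  have hsm : Differentiable ℝ (mol n g) := (mol_smooth n hg.continuous).differentiable (by simp)
  have hder : ∀ s : ℝ, HasDerivAt (fun s : ℝ => mol n g (p + s • v)) (fderiv ℝ (mol n g) (p + s • v) v) s := by
    intro s
    have h1 : HasDerivAt (fun s : ℝ => p + s • v) v s := by
      simpa using ((hasDerivAt_id s).smul_const v).const_add p
    exact (hsm _).hasFDerivAt.comp_hasDerivAt s h1
  have := (convex_Icc (0 : ℝ) r).image_sub_le_mul_sub_of_deriv_le
    (f := fun s : ℝ => mol n g (p + s • v)) (C := c)
    (fun s _ => (hder s).continuousAt.continuousWithinAt)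
    (fun s _ => (hder s).differentiableAt.differentiableWithinAt)
    (fun s hs => by
      rw [(hder s).deriv, mol_fderiv n hg]
      rw [interior_Icc] at hs
      have hae : ∀ᵐ y : Pl, p + s • v - y ∈ O → fderiv ℝ g (p + s • v - y) v ≤ c :=
        (Measure.measurePreserving_sub_left (volume : Measure Pl) (p + s • v)).quasiMeasurePreserving.ae h
      rw [← avg_const n c]
      have hmi : Integrable fun y => rho n y * fderiv ℝ g (p + s • v - y) v := by
        refine ((rho_integrable n).mul_const (K * ‖v‖)).mono' ?_ ?_
        · exact ((rho_cont n).measurable.mul ((measurable_fderiv_apply_const ℝ g v).comp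
            (measurable_const.sub measurable_id))).aestronglyMeasurable
        · refine Eventually.of_forall fun y => ?_
          rw [norm_mul, Real.norm_of_nonneg (rho_nonneg n y)]
          exact mul_le_mul_of_nonneg_left (((fderiv ℝ g _).le_opNorm v).trans
            (mul_le_mul_of_nonneg_right (norm_fderiv_le_of_lipschitz ℝ hg) (norm_nonneg v))) (rho_nonneg n y)
      refine integral_mono_ae hmi (rho_mul_integrable n continuous_const) ?_
      filter_upwards [hae] with y hy
      rcases lt_or_ge ‖y‖ (1 / ((n : ℝ) + 1)) with hy' | hy'
      · refine mul_le_mul_of_nonneg_left (hy (hδO ?_)) (rho_nonneg n y)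
        refine Metric.mem_cthickening_of_dist_le _ (p + s • v) δ _ ⟨s, ⟨hs.1.le, hs.2.le⟩, rfl⟩ ?_
        rw [dist_eq_norm]; simp; linarith
      · simp [rho_zero n hy'])
    0 ⟨le_rfl, hr⟩ r ⟨hr, le_rfl⟩ hr
  simpa using this


lemma lip_mul {f g : Pl → ℝ} {K L : ℝ≥0} {C D : ℝ} (hf : LipschitzWith K f) (hg : LipschitzWith L g)
    (bf : ∀ p, |f p| ≤ C) (bg : ∀ p, |g p| ≤ D) : ∃ M : ℝ≥0, LipschitzWith M fun p => f p * g p := by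
  have hC : 0 ≤ C := (abs_nonneg _).trans (bf 0)
  have hD : 0 ≤ D := (abs_nonneg _).trans (bg 0)
  refine ⟨Real.toNNReal (C * L + D * K), LipschitzWith.of_dist_le_mul fun p q => ?_⟩
  rw [Real.coe_toNNReal _ (by positivity), Real.dist_eq]
  have h1 := hf.dist_le_mul p q
  have h2 := hg.dist_le_mul p q
  rw [Real.dist_eq] at h1 h2
  have e : f p * g p - f q * g q = f p * (g p - g q) + g q * (f p - f q) := by ring
  rw [e]
  refine (abs_add_le _ _).trans ?_
  rw [abs_mul, abs_mul, add_mul, mul_assoc, mul_assoc]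
  exact add_le_add (mul_le_mul (bf p) h2 (abs_nonneg _) hC) (mul_le_mul (bg q) h1 (abs_nonneg _) hD)

def clamp (c z : ℝ) : ℝ := max 0 (min c z)
lemma clamp_lip {f : Pl → ℝ} {K : ℝ≥0} (hf : LipschitzWith K f) (c : ℝ) :
    LipschitzWith K fun p => clamp c (f p) := (hf.const_min c).const_max 0
lemma clamp_nonneg (c z : ℝ) : 0 ≤ clamp c z := le_max_left _ _
lemma clamp_abs {c : ℝ} (hc : 0 ≤ c) (z : ℝ) : |clamp c z| ≤ c := by
  rw [abs_of_nonneg (clamp_nonneg _ _)]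
  exact max_le hc (min_le_left _ _)
lemma clamp_pos {c z : ℝ} (h : 0 < clamp c z) : 0 < z := by
  by_contra hz
  have : clamp c z = 0 := max_eq_left ((min_le_right _ _).trans (not_lt.1 hz))
  linarith
lemma clamp_id {c z : ℝ} (h : 0 ≤ z) (h' : z ≤ c) : clamp c z = z := by simp [clamp, h, h']
lemma clamp_top {c z : ℝ} (h0 : 0 ≤ c) (h : c ≤ z) : clamp c z = c := by simp [clamp, h, h0]

lemma localLemma {p2 : Pl} {ρ κ δ C : ℝ} {D g1 g2 : Pl → ℝ} {K : ℝ≥0}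
    (hρ : 0 < ρ) (hκ : 0 < κ) (hδ : 0 < δ) (hD : LipschitzWith K D)
    (m1 : Measurable g1) (m2 : Measurable g2) (b1 : ∀ p, |g1 p| ≤ C) (b2 : ∀ p, |g2 p| ≤ C)
    (h1 : ∀ p, 0 ≤ g1 p) (hE : EntOn (Metric.ball p2 ρ) g1 g2)
    (hA : ∀ᵐ p, p ∈ Metric.ball p2 ρ → p.2 < p2.2 →
      κ * g1 p ≤ g1 p * dT D p + g2 p * dX D p ∧ (g1 p = 0 → κ ≤ dT D p))
    (hmin : ∀ p ∈ Metric.ball p2 ρ, p.2 ≤ p2.2 → D p2 ≤ D p)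
    (hmin2 : ∀ p ∈ Metric.ball p2 ρ, p.2 ≤ p2.2 → ρ / 2 ≤ dist p p2 → D p2 + δ ≤ D p) : False := by
  set m := D p2 with hm
  have lA : LipschitzWith K fun p => m + δ - D p := by
    have := (LipschitzWith.const (α := Pl) (m + δ)).sub hD
    simpa using this
  have lZ : ∃ L : ℝ≥0, LipschitzWith L fun p : Pl => 3 - 4 / ρ * dist p p2 := by
    refine ⟨Real.toNNReal (4 / ρ), LipschitzWith.of_dist_le_mul fun p q => ?_⟩
    rw [Real.coe_toNNReal _ (by positivity), Real.dist_eq]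
    have e : 3 - 4 / ρ * dist p p2 - (3 - 4 / ρ * dist q p2) = 4 / ρ * (dist q p2 - dist p p2) := by ring
    rw [e, abs_mul, abs_of_pos (by positivity : 0 < 4 / ρ), dist_comm p q]
    exact mul_le_mul_of_nonneg_left (abs_dist_sub_le _ _ _) (by positivity)
  have lT : LipschitzWith 1 fun p : Pl => p2.2 - p.2 := by
    have := (LipschitzWith.const (α := Pl) p2.2).sub LipschitzWith.prod_snd
    simpa using this
  obtain ⟨L, lZ⟩ := lZ
  obtain ⟨L1, l1⟩ := lip_mul (clamp_lip lA (2 * δ)) (clamp_lip lZ 1) (fun p => clamp_abs (by positivity) _)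
    (fun p => clamp_abs zero_le_one _)
  obtain ⟨L2, l2⟩ := lip_mul l1 (clamp_lip lT (2 * ρ)) (C := 2 * δ * 1) (D := 2 * ρ)
    (fun p => by
      rw [abs_mul]
      exact mul_le_mul (clamp_abs (by positivity) _) (clamp_abs zero_le_one _) (abs_nonneg _) (by positivity))
    (fun p => clamp_abs (by positivity) _)
  set ψ : Pl → ℝ := fun p => clamp (2 * δ) (m + δ - D p) * clamp 1 (3 - 4 / ρ * dist p p2) *
    clamp (2 * ρ) (p2.2 - p.2) with hψ
  have ψ0 : ∀ p, 0 ≤ ψ p := fun p =>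
    mul_nonneg (mul_nonneg (clamp_nonneg _ _) (clamp_nonneg _ _)) (clamp_nonneg _ _)
  have sup : tsupport ψ ⊆ Metric.closedBall p2 (3 * ρ / 4) := by
    refine closure_minimal (fun p hp => ?_) Metric.isClosed_closedBall
    have : clamp 1 (3 - 4 / ρ * dist p p2) ≠ 0 := fun h => hp (by simp [hψ, h])
    have := clamp_pos (lt_of_le_of_ne (clamp_nonneg _ _) this.symm)
    rw [Metric.mem_closedBall]
    field_simp at this
    linarith
  have cpt : HasCompactSupport ψ :=
    (isCompact_closedBall p2 (3 * ρ / 4)).of_isClosed_subset (isClosed_tsupport _) sup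
  have supb : tsupport ψ ⊆ Metric.ball p2 ρ := sup.trans (Metric.closedBall_subset_ball (by linarith))
  set O : Set Pl := {p | D p < m + δ} ∩ Metric.ball p2 (ρ / 2) ∩ {p | p.2 < p2.2} with hO
  have Oo : IsOpen O := ((isOpen_lt hD.continuous continuous_const).inter Metric.isOpen_ball).inter
    (isOpen_lt continuous_snd continuous_const)
  have ball2 : Metric.ball p2 (ρ / 2) ⊆ Metric.ball p2 ρ := Metric.ball_subset_ball (by linarith)
  have ψO : ∀ p ∈ O, ψ p = (m + δ - D p) * (p2.2 - p.2) := by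
    rintro p ⟨⟨q1, q2⟩, q3⟩
    simp only [mem_ofPred_eq] at q1 q3
    have := hmin p (ball2 q2) q3.le
    rw [Metric.mem_ball] at q2
    have q4 : p2.2 - p.2 ≤ dist p p2 := by
      rw [Prod.dist_eq]; refine le_trans ?_ (le_max_right _ _)
      rw [Real.dist_eq, abs_sub_comm]; exact le_abs_self _
    have q5 : 1 ≤ 3 - 4 / ρ * dist p p2 := by
      have : 4 / ρ * dist p p2 ≤ 4 / ρ * (ρ / 2) := mul_le_mul_of_nonneg_left q2.le (by positivity)
      have e : 4 / ρ * (ρ / 2) = 2 := by field_simp; norm_num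
      linarith
    simp only [hψ]
    rw [clamp_id (by linarith) (by linarith), clamp_top zero_le_one q5, clamp_id (by linarith) (by linarith), mul_one]
  have ψn : ∀ p, p ∉ O → ψ p = 0 := by
    intro p hp
    by_contra h0
    have hne := h0
    simp only [hψ, mul_eq_zero, not_or] at h0
    have z1 := clamp_pos (lt_of_le_of_ne (clamp_nonneg _ _) (Ne.symm h0.1.1))
    have z3 := clamp_pos (lt_of_le_of_ne (clamp_nonneg _ _) (Ne.symm h0.2))
    have pb := supb (subset_tsupport _ hne)
    refine hp ⟨⟨by simp only [mem_ofPred_eq]; linarith, ?_⟩, by simp only [mem_ofPred_eq]; linarith⟩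
    by_contra hb
    rw [Metric.mem_ball, not_lt] at hb
    have := hmin2 p pb (by linarith) hb
    linarith
  have I := ent_lip Metric.isOpen_ball m1 m2 b1 b2 hE l2 cpt ψ0 supb
  have bd : ∀ᵐ p, g1 p * dT ψ p + g2 p * dX ψ p ≤ 0 ∧ (p ∈ O → g1 p * dT ψ p + g2 p * dX ψ p ≤ - (g1 p * (m + δ - D p))) := by
    filter_upwards [hA, hD.ae_differentiableAt] with p hp hd
    by_cases hpO : p ∈ O
    · obtain ⟨⟨q1, q2⟩, q3⟩ := id hpO
      simp only [mem_ofPred_eq] at q1 q3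
      have ee : ψ =ᶠ[𝓝 p] fun p => (m + δ - D p) * (p2.2 - p.2) := by
        filter_upwards [Oo.mem_nhds hpO] with q hq using ψO q hq
      have hf : HasFDerivAt (fun p : Pl => (m + δ - D p) * (p2.2 - p.2)) _ p :=
        (hd.hasFDerivAt.const_sub (m + δ)).mul ((hasFDerivAt_snd (p := p)).const_sub p2.2)
      have e1 : dT ψ p = -(m + δ - D p) - (p2.2 - p.2) * dT D p := by
        unfold dT; rw [ee.fderiv_eq, hf.fderiv]; simp; ring
      have e2 : dX ψ p = - (p2.2 - p.2) * dX D p := by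
        unfold dX; rw [ee.fderiv_eq, hf.fderiv]; simp; ring
      have := (hp (ball2 q2) q3).1
      have hg := h1 p
      have k2 : 0 ≤ (p2.2 - p.2) * (g1 p * dT D p + g2 p * dX D p) :=
        mul_nonneg (by linarith) (by nlinarith)
      have k3 : g1 p * dT ψ p + g2 p * dX ψ p ≤ - (g1 p * (m + δ - D p)) := by
        rw [e1, e2]; linarith
      exact ⟨k3.trans (by have := mul_nonneg hg (by linarith : 0 ≤ m + δ - D p); linarith), fun _ => k3⟩
    · have hl : IsLocalMin ψ p := Eventually.of_forall fun q => by rw [ψn p hpO]; exact ψ0 q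
      simp [dT, dX, hl.fderiv_eq_zero, hpO]
  have int := test_int m1 m2 b1 b2 l2 cpt
  have z : ∀ᵐ p, g1 p * dT ψ p + g2 p * dX ψ p = 0 := by
    have h0 : ∫ p, -(g1 p * dT ψ p + g2 p * dX ψ p) = 0 := by
      refine le_antisymm ?_ (integral_nonneg_of_ae (bd.mono fun p hp => neg_nonneg.2 hp.1))
      rw [integral_neg]; linarith
    have := (integral_eq_zero_iff_of_nonneg_ae (bd.mono fun p hp => neg_nonneg.2 hp.1) int.neg).1 h0
    exact this.mono fun p hp => neg_eq_zero.1 hp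
  have dd : ∀ᵐ p, p ∈ O → fderiv ℝ D p (0, -1) ≤ -κ := by
    filter_upwards [bd, z, hA] with p k1 k2 k3 hpO
    obtain ⟨⟨q1, q2⟩, q3⟩ := id hpO
    simp only [mem_ofPred_eq] at q1 q3
    have k4 := k1.2 hpO
    rw [k2] at k4
    have g0 : g1 p = 0 := by
      have hg := h1 p
      by_contra hne
      have : 0 < g1 p * (m + δ - D p) := mul_pos (lt_of_le_of_ne hg (Ne.symm hne)) (by linarith)
      linarith
    have := (k3 (ball2 q2) q3).2 g0
    have e : ((0 : ℝ), (-1 : ℝ)) = -((0 : ℝ), (1 : ℝ)) := by simp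
    rw [e, map_neg]
    unfold dT at this; linarith
  obtain ⟨s, hs, hsb⟩ : ∃ s : ℝ, 0 < s ∧ ∀ r : ℝ, 0 < r → r ≤ s → p2 + r • ((0 : ℝ), (-1 : ℝ)) ∈ O := by
    have hop : IsOpen ({p | D p < m + δ} ∩ Metric.ball p2 (ρ / 2)) :=
      (isOpen_lt hD.continuous continuous_const).inter Metric.isOpen_ball
    obtain ⟨ε, hε, hb⟩ := Metric.isOpen_iff.1 hop p2 ⟨by simp only [mem_ofPred_eq]; linarith, Metric.mem_ball_self (by positivity)⟩
    refine ⟨ε / 2, by positivity, fun r hr hr' => ⟨hb ?_, ?_⟩⟩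
    · rw [Metric.mem_ball, dist_eq_norm]; simp [abs_of_pos hr]; exact ⟨hε, by linarith⟩
    · simp [hr]
  have hK := K.coe_nonneg
  set ε : ℝ := κ * s / (K + κ + 1) with hε
  have hden : (0 : ℝ) < K + κ + 1 := by positivity
  have ε0 : 0 < ε := by positivity
  have hεe : ε * (K + κ + 1) = κ * s := by rw [hε]; field_simp
  have εs : ε < s := by nlinarith
  have E1 := lemE hD Oo (p := p2 + ε • ((0 : ℝ), (-1 : ℝ))) (r := s - ε) dd (by linarith) (by
    intro r hr
    rw [add_assoc, ← add_smul]
    exact hsb _ (by linarith [hr.1]) (by linarith [hr.2]))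
  rw [add_assoc, ← add_smul, add_sub_cancel] at E1
  have E2 := hD.dist_le_mul (p2 + ε • ((0 : ℝ), (-1 : ℝ))) p2
  rw [Real.dist_eq, dist_eq_norm] at E2
  simp [abs_of_pos ε0, max_eq_right ε0.le] at E2
  have E3 := hmin _ (ball2 (hsb s hs le_rfl).1.2) (hsb s hs le_rfl).2.le
  have E4 := (abs_le.1 E2).2
  simp at E1 E3
  nlinarith


structure UC (a : ℝ) (f : ℝ → ℝ) : Prop where
  pos : 0 < a
  smooth : ContDiff ℝ 2 f
  conv : ∀ w, a ≤ deriv (deriv f) w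

namespace UC
variable {a : ℝ} {f : ℝ → ℝ}

lemma diff (h : UC a f) : Differentiable ℝ f := h.smooth.differentiable (by norm_num)
lemma cont (h : UC a f) : Continuous f := h.smooth.continuous
lemma smooth' (h : UC a f) : ContDiff ℝ 1 (deriv f) :=
  (contDiff_succ_iff_deriv (n := 1).1 h.smooth).2.2

lemma neg (h : UC a f) : UC a fun p => f (-p) := by
  refine ⟨h.pos, h.smooth.comp contDiff_neg, fun w => ?_⟩
  have e : deriv (fun p => f (-p)) = fun p => -deriv f (-p) := by
    ext p; exact deriv_comp_neg f p
  rw [e, deriv.fun_neg, deriv_comp_neg, neg_neg]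
  exact h.conv _

lemma tangent (h : UC a f) (p q : ℝ) : f p + deriv f p * (q - p) + a / 2 * (q - p) ^ 2 ≤ f q := by
  set k : ℝ → ℝ := fun z => f z - a / 2 * z ^ 2 with hk
  have hd : ∀ z, HasDerivAt k (deriv f z - a * z) z := by
    intro z
    have := (h.diff z).hasDerivAt.sub (((hasDerivAt_id z).pow 2).const_mul (a / 2))
    refine this.congr_deriv ?_
    simp only [id]; ring
  have hd' : deriv k = fun z => deriv f z - a * z := by ext z; exact (hd z).deriv
  have mono : Monotone (deriv k) := by
    have hd2 : ∀ z, HasDerivAt (deriv k) (deriv (deriv f) z - a) z := by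
      intro z
      rw [hd']
      have := ((h.smooth'.differentiable (by simp)) z).hasDerivAt.sub ((hasDerivAt_id z).const_mul a)
      refine this.congr_deriv ?_
      ring
    refine monotone_of_deriv_nonneg (fun z => (hd2 z).differentiableAt) fun z => ?_
    rw [(hd2 z).deriv]; linarith [h.conv z]
  have cv : ConvexOn ℝ univ k := mono.convexOn_univ_of_deriv fun z => (hd z).differentiableAt
  have main : k p + (deriv f p - a * p) * (q - p) ≤ k q := by
    rcases lt_trichotomy p q with hpq | rfl | hpq
    · have := cv.le_slope_of_hasDerivAt (mem_univ p) (mem_univ q) hpq (hd p)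
      rw [slope_def_field, le_div_iff₀ (by linarith)] at this
      linarith
    · simp
    · have := cv.slope_le_of_hasDerivAt (mem_univ q) (mem_univ p) hpq (hd p)
      rw [slope_def_field, div_le_iff₀ (by linarith)] at this
      linarith
  simp only [hk] at main
  nlinarith

lemma lip (h : UC a f) (R : ℝ) : ∃ Λ : ℝ, 0 < Λ ∧ ∀ p q, |p| ≤ R → |q| ≤ R → |f p - f q| ≤ Λ * |p - q| := by
  obtain ⟨C, hC⟩ := (isCompact_Icc (a := -R) (b := R)).exists_bound_of_continuousOn
    (h.smooth'.continuous.continuousOn)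
  refine ⟨max C 1, by positivity, fun p q hp hq => ?_⟩
  have := (convex_Icc (-R) R).norm_image_sub_le_of_norm_deriv_le (f := f) (C := C)
    (fun x _ => h.diff x) (fun x hx => hC x hx) (abs_le.1 hq) (abs_le.1 hp)
  exact this.trans (mul_le_mul_of_nonneg_right (le_max_left _ _) (norm_nonneg _))
end UC

lemma localLemma' {p2 : Pl} {ρ κ Λ C : ℝ} {D g1 g2 : Pl → ℝ} {K : ℝ≥0}
    (hρ : 0 < ρ) (hκ : 0 < κ) (hΛ : 0 ≤ Λ) (hD : LipschitzWith K D)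
    (m1 : Measurable g1) (m2 : Measurable g2) (b1 : ∀ p, |g1 p| ≤ C)
    (h1 : ∀ p, 0 ≤ g1 p) (h2 : ∀ p, |g2 p| ≤ Λ * g1 p) (hE : EntOn (Metric.ball p2 ρ) g1 g2)
    (hA : ∀ᵐ p, p ∈ Metric.ball p2 ρ → p.2 < p2.2 →
      κ * g1 p ≤ g1 p * dT D p + g2 p * dX D p ∧ (g1 p = 0 → κ ≤ dT D p))
    (hmin : ∀ p ∈ Metric.ball p2 ρ, p.2 ≤ p2.2 → D p2 ≤ D p) : False := by
  set s : ℝ := κ / (2 * (1 + Λ)) with hs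
  have s0 : 0 < s := by positivity
  have se : s * (1 + Λ) = κ / 2 := by rw [hs]; field_simp
  have ld : LipschitzWith (Real.toNNReal s) fun p : Pl => s * dist p p2 := by
    refine LipschitzWith.of_dist_le_mul fun p q => ?_
    rw [Real.coe_toNNReal _ s0.le, Real.dist_eq, ← mul_sub, abs_mul, abs_of_pos s0]
    exact mul_le_mul_of_nonneg_left (abs_dist_sub_le _ _ _) s0.le
  have C0 : 0 ≤ C := (abs_nonneg _).trans (b1 0)
  refine localLemma (D := fun p => D p + s * dist p p2) (κ := κ / 2) (δ := s * (ρ / 2)) (C := (1 + Λ) * C) hρ (by positivity)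
    (by positivity) (hD.add ld) m1 m2
    (fun p => (b1 p).trans (by nlinarith))
    (fun p => (h2 p).trans (by have := b1 p; rw [abs_of_nonneg (h1 p)] at this; nlinarith)) h1 hE ?_ ?_ ?_
  · filter_upwards [hA, hD.ae_differentiableAt, ld.ae_differentiableAt] with p k1 k2 k3 hp hp'
    obtain ⟨j1, j2⟩ := k1 hp hp'
    have e : fderiv ℝ (fun p => D p + s * dist p p2) p = fderiv ℝ D p + fderiv ℝ (fun p => s * dist p p2) p :=
      fderiv_fun_add k2 k3
    have e1 : dT (fun p => D p + s * dist p p2) p = dT D p + dT (fun p => s * dist p p2) p := by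
      simp [dT, e]
    have e2 : dX (fun p => D p + s * dist p p2) p = dX D p + dX (fun p => s * dist p p2) p := by
      simp [dX, e]
    have n1 := dT_le ld p
    have n2 := dX_le ld p
    rw [Real.coe_toNNReal _ s0.le] at n1 n2
    rw [e1, e2]
    have hk : κ / 2 ≤ κ - s := by nlinarith
    constructor
    · have t1 : -(s * g1 p) ≤ g1 p * dT (fun p => s * dist p p2) p := by
        have := mul_le_mul_of_nonneg_left (abs_le.1 n1).1 (h1 p); linarith
      have t2 : -(Λ * g1 p * s) ≤ g2 p * dX (fun p => s * dist p p2) p := by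
        have : |g2 p * dX (fun p => s * dist p p2) p| ≤ Λ * g1 p * s := by
          rw [abs_mul]; exact mul_le_mul (h2 p) n2 (abs_nonneg _) (mul_nonneg hΛ (h1 p))
        exact (abs_le.1 this).1
      have : g1 p * (s * (1 + Λ)) = g1 p * (κ / 2) := by rw [se]
      linarith
    · intro h0
      have := j2 h0
      linarith [(abs_le.1 n1).1]
  · intro p hp hp'
    have := hmin p hp hp'
    simp only [dist_self, mul_zero, add_zero]; nlinarith [dist_nonneg (x := p) (y := p2)]
  · intro p hp hp' hd
    have := hmin p hp hp'
    simp only [dist_self, mul_zero, add_zero]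
    exact add_le_add this (mul_le_mul_of_nonneg_left hd s0.le)

def quad : Set Pl := {p | 0 < p.1 ∧ 0 < p.2}
lemma quad_open : IsOpen quad :=
  (isOpen_lt continuous_const continuous_fst).inter (isOpen_lt continuous_const continuous_snd)

structure HalfPot (g : ℝ → ℝ) (U u : Pl → ℝ) : Prop where
  lip : ∃ K, LipschitzWith K U
  meas : Measurable u
  bdd : ∃ M, ∀ p, |u p| ≤ M
  pde : ∀ᵐ p, p ∈ quad → dX U p = u p ∧ dT U p = -g (u p)
  kr : ∀ k, EntOn quad (fun p => |u p - k|) (fun p => Real.sign (u p - k) * (g (u p) - g k))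

def SubS (g : ℝ → ℝ) (P : Pl → ℝ) : Prop :=
  ∀ p x t r : ℝ, 0 ≤ r → 0 < x → 0 < x - deriv g p * r → 0 < t - r →
    P (x, t) ≤ P (x - deriv g p * r, t - r) + r * (p * deriv g p - g p)

lemma HalfPot.subS {a : ℝ} {g : ℝ → ℝ} {U u : Pl → ℝ} (hg : UC a g) (h : HalfPot g U u) : SubS g U := by
  intro p x t r hr hx hx' ht
  obtain ⟨K, hK⟩ := h.lip
  have := lemE hK quad_open (v := (deriv g p, 1)) (p := (x - deriv g p * r, t - r)) (r := r)
    (c := p * deriv g p - g p) (by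
      filter_upwards [h.pde] with q hq hqq
      obtain ⟨h1, h2⟩ := hq hqq
      have e : fderiv ℝ U q (deriv g p, 1) = deriv g p * dX U q + dT U q := by
        have : ((deriv g p, 1) : Pl) = deriv g p • ((1 : ℝ), (0 : ℝ)) + ((0 : ℝ), (1 : ℝ)) := by simp
        rw [this, map_add, map_smul]; rfl
      rw [e, h1, h2]
      have := hg.tangent p (u q)
      nlinarith [mul_nonneg hg.pos.le (sq_nonneg (u q - p))]) hr (by
      intro s hs
      constructor
      · simp only [Prod.smul_mk, smul_eq_mul, Prod.mk_add_mk]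
        rcases le_total 0 (deriv g p) with h0 | h0
        · nlinarith [hs.1]
        · nlinarith [hs.2]
      · simp only [Prod.smul_mk, smul_eq_mul, Prod.mk_add_mk]; linarith [hs.1])
  simp only [Prod.smul_mk, smul_eq_mul, Prod.mk_add_mk, mul_one, sub_add_cancel] at this
  rw [mul_comm r (deriv g p), sub_add_cancel] at this
  linarith

lemma mol_sub {g : ℝ → ℝ} {P : Pl → ℝ} {K : ℝ≥0} (hP : LipschitzWith K P)
    (hS : SubS g P) (n : ℕ) {q : Pl} (h1 : 1 / ((n : ℝ) + 1) < q.1) (h2 : 1 / ((n : ℝ) + 1) < q.2) :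
    dT (mol n P) q + g (dX (mol n P) q) ≤ 0 := by
  set k := dX (mol n P) q
  have hsm : Differentiable ℝ (mol n P) := (mol_smooth n hP.continuous).differentiable (by simp)
  have hl : HasDerivAt (fun r : ℝ => q - r • (deriv g k, (1 : ℝ))) (-(deriv g k, (1 : ℝ))) 0 := by
    simpa using ((hasDerivAt_id (0 : ℝ)).smul_const (deriv g k, (1 : ℝ))).const_sub q
  have hd : HasDerivAt (fun r : ℝ => mol n P (q - r • (deriv g k, (1 : ℝ))) + r * (k * deriv g k - g k))
      (fderiv ℝ (mol n P) q (-(deriv g k, (1 : ℝ))) + (k * deriv g k - g k)) 0 := by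
    have := (hsm (q - (0 : ℝ) • (deriv g k, (1 : ℝ)))).hasFDerivAt.comp_hasDerivAt (0 : ℝ) hl
    simp only [zero_smul, sub_zero] at this
    have t2 := this.add ((hasDerivAt_id (0 : ℝ)).mul_const (k * deriv g k - g k))
    rw [one_mul] at t2
    exact t2
  have ev : ∀ᶠ r in 𝓝[>] (0 : ℝ), mol n P q ≤ mol n P (q - r • (deriv g k, (1 : ℝ))) + r * (k * deriv g k - g k) := by
    have c1 : ∀ᶠ r in 𝓝 (0 : ℝ), 1 / ((n : ℝ) + 1) < q.1 - deriv g k * r := by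
      have : Tendsto (fun r : ℝ => q.1 - deriv g k * r) (𝓝 0) (𝓝 (q.1 - deriv g k * 0)) :=
        (by fun_prop : Continuous fun r : ℝ => q.1 - deriv g k * r).tendsto 0
      exact this.eventually_const_lt (by simpa using h1)
    have c2 : ∀ᶠ r in 𝓝 (0 : ℝ), 1 / ((n : ℝ) + 1) < q.2 - r := by
      have : Tendsto (fun r : ℝ => q.2 - r) (𝓝 0) (𝓝 (q.2 - 0)) :=
        (by fun_prop : Continuous fun r : ℝ => q.2 - r).tendsto 0
      exact this.eventually_const_lt (by simpa using h2)
    filter_upwards [mem_nhdsWithin_of_mem_nhds c1, mem_nhdsWithin_of_mem_nhds c2, self_mem_nhdsWithin] with r d1 d2 d3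
    refine mol_le_mol n hP.continuous hP.continuous fun y hy => ?_
    have y1 : |y.1| < 1 / ((n : ℝ) + 1) := (norm_fst_le y).trans_lt hy
    have y2 : |y.2| < 1 / ((n : ℝ) + 1) := (norm_snd_le y).trans_lt hy
    rw [abs_lt] at y1 y2
    have := hS k (q.1 - y.1) (q.2 - y.2) r (le_of_lt d3) (by linarith) (by linarith) (by linarith)
    have e : q - r • (deriv g k, (1 : ℝ)) - y = (q.1 - y.1 - deriv g k * r, q.2 - y.2 - r) := by
      refine Prod.ext ?_ ?_ <;> simp <;> ring
    rw [e]
    exact this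
  have h0 : 0 ≤ fderiv ℝ (mol n P) q (-(deriv g k, (1 : ℝ))) + (k * deriv g k - g k) := by
    have ht := hd.tendsto_slope_zero_right
    refine ge_of_tendsto ht ?_
    filter_upwards [ev, self_mem_nhdsWithin] with r hr hr0
    simp only [zero_add, zero_smul, sub_zero, zero_mul, add_zero, smul_eq_mul]
    exact mul_nonneg (inv_nonneg.2 (le_of_lt hr0)) (by linarith)
  have e : fderiv ℝ (mol n P) q (-(deriv g k, (1 : ℝ))) = -(deriv g k * k + dT (mol n P) q) := by
    have : ((deriv g k, 1) : Pl) = deriv g k • ((1 : ℝ), (0 : ℝ)) + ((0 : ℝ), (1 : ℝ)) := by simp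
    rw [map_neg, this, map_add, map_smul]; rfl
  rw [e] at h0
  linarith


lemma EntOn.mono {O O' : Set Pl} {g1 g2 : Pl → ℝ} (h : EntOn O g1 g2) (hs : O' ⊆ O) : EntOn O' g1 g2 :=
  fun φ h1 h2 h3 h4 => h φ h1 h2 h3 (h4.trans hs)

lemma sign_meas : Measurable Real.sign := by
  have : Real.sign = fun x : ℝ => if x < 0 then -1 else if 0 < x then 1 else 0 := by
    ext x; rfl
  rw [this]
  exact Measurable.ite (measurableSet_lt measurable_id measurable_const) measurable_const
    (Measurable.ite (measurableSet_lt measurable_const measurable_id) measurable_const measurable_const)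

lemma sign_abs_le (x : ℝ) : |Real.sign x| ≤ 1 := by
  rcases Real.sign_apply_eq x with h | h | h <;> simp [h]
lemma sign_mul_self' (x : ℝ) : Real.sign x * x = |x| := by
  rcases lt_trichotomy x 0 with h | rfl | h
  · rw [Real.sign_of_neg h, abs_of_neg h]; ring
  · simp
  · rw [Real.sign_of_pos h, abs_of_pos h]; ring

lemma lip_lin (η σ : ℝ) : ∃ L : ℝ≥0, LipschitzWith L fun p : Pl => η * p.1 + σ * p.2 := by
  refine ⟨Real.toNNReal (|η| + |σ|), LipschitzWith.of_dist_le_mul fun p q => ?_⟩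
  rw [Real.coe_toNNReal _ (by positivity), Real.dist_eq]
  have h1 : |p.1 - q.1| ≤ dist p q := by rw [← Real.dist_eq, Prod.dist_eq]; exact le_max_left _ _
  have h2 : |p.2 - q.2| ≤ dist p q := by rw [← Real.dist_eq, Prod.dist_eq]; exact le_max_right _ _
  have e : η * p.1 + σ * p.2 - (η * q.1 + σ * q.2) = η * (p.1 - q.1) + σ * (p.2 - q.2) := by ring
  rw [e, add_mul]
  refine (abs_add_le _ _).trans ?_
  rw [abs_mul, abs_mul]
  gcongr

lemma lin_fd (η σ : ℝ) (p : Pl) : HasFDerivAt (fun p : Pl => η * p.1 + σ * p.2)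
    (η • ContinuousLinearMap.fst ℝ ℝ ℝ + σ • ContinuousLinearMap.snd ℝ ℝ ℝ) p :=
  (hasFDerivAt_fst.const_mul η).add (hasFDerivAt_snd.const_mul σ)

lemma lip_t {U : Pl → ℝ} {K : ℝ≥0} (h : LipschitzWith K U) (x t s : ℝ) : |U (x, t) - U (x, s)| ≤ K * |t - s| := by
  have := h.dist_le_mul (x, t) (x, s)
  rwa [Real.dist_eq, Prod.dist_eq, dist_self, max_eq_right dist_nonneg, Real.dist_eq] at this
lemma lip_x {U : Pl → ℝ} {K : ℝ≥0} (h : LipschitzWith K U) (x y t : ℝ) : |U (x, t) - U (y, t)| ≤ K * |x - y| := by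
  have := h.dist_le_mul (x, t) (y, t)
  rwa [Real.dist_eq, Prod.dist_eq, dist_self, max_eq_left dist_nonneg, Real.dist_eq] at this

set_option maxHeartbeats 1000000 in
lemma quad_comp {a : ℝ} {g : ℝ → ℝ} {U u P : Pl → ℝ} {K : ℝ≥0} (hg : UC a g) (hU : HalfPot g U u)
    (hP : LipschitzWith K P) (hS : SubS g P) (h0 : ∀ x, 0 ≤ x → P (x, 0) ≤ U (x, 0))
    (hb : ∀ t, 0 ≤ t → P (0, t) ≤ U (0, t)) {x1 t1 : ℝ} (hx1 : 0 ≤ x1) (ht1 : 0 ≤ t1) :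
    P (x1, t1) ≤ U (x1, t1) := by
  by_contra hcon
  push Not at hcon
  obtain ⟨J, hJ⟩ := hU.lip
  obtain ⟨M, hM⟩ := hU.bdd
  have M0 : 0 ≤ M := (abs_nonneg _).trans (hM 0)
  have xp : 0 < x1 := lt_of_le_of_ne hx1 (by rintro rfl; linarith [hb t1 ht1])
  have tp : 0 < t1 := lt_of_le_of_ne ht1 (by rintro rfl; linarith [h0 x1 hx1])
  obtain ⟨Λ, hΛ, hlip⟩ := hg.lip (M + K + 1)
  have K0 : (0 : ℝ) ≤ K := K.2
  have J0 : (0 : ℝ) ≤ J := J.2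
  obtain ⟨d, hd⟩ : ∃ d, d = P (x1, t1) - U (x1, t1) := ⟨_, rfl⟩
  have dp : 0 < d := by linarith
  obtain ⟨σ, σ0, σ1, σ2⟩ : ∃ σ : ℝ, 0 < σ ∧ σ ≤ 4 * Λ ∧ σ * (t1 + x1 / (4 * Λ)) ≤ d / 4 := by
    refine ⟨min (4 * Λ) (d / 4 / (t1 + x1 / (4 * Λ))), lt_min (by positivity) (by positivity), min_le_left _ _, ?_⟩
    refine (mul_le_mul_of_nonneg_right (min_le_right _ _) (by positivity)).trans ?_
    rw [div_mul_cancel₀]; positivity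
  obtain ⟨η, hη⟩ : ∃ η, η = σ / (4 * Λ) := ⟨_, rfl⟩
  have η0 : 0 < η := by rw [hη]; positivity
  have η1 : η ≤ 1 := by rw [hη, div_le_one (by positivity)]; exact σ1
  have ηΛ : Λ * η = σ / 4 := by rw [hη]; field_simp
  have ησ : σ * t1 + η * x1 ≤ d / 4 := by
    have : η * x1 = σ * (x1 / (4 * Λ)) := by rw [hη]; field_simp
    rw [this]; linarith
  obtain ⟨n, hn⟩ : ∃ n : ℕ, 1 / ((n : ℝ) + 1) < min (min x1 t1) (d / (4 * (J + 2 * K + 1))) :=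
    exists_nat_one_div_lt (by positivity)
  obtain ⟨ε, hε⟩ : ∃ ε, ε = 1 / ((n : ℝ) + 1) := ⟨_, rfl⟩
  have ε0 : 0 < ε := by rw [hε]; positivity
  rw [← hε, lt_min_iff, lt_min_iff] at hn
  obtain ⟨⟨εx, εt⟩, εd⟩ := hn
  have εd' : (J + 2 * K + 1) * ε ≤ d / 4 := by
    have := mul_le_mul_of_nonneg_left εd.le (by positivity : 0 ≤ (J : ℝ) + 2 * K + 1)
    refine this.trans (le_of_eq ?_)
    field_simp
  have Jε : 0 ≤ J * ε := by positivity
  have Kε : 0 ≤ K * ε := by positivity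
  have pn : ∀ q, |mol n P q - P q| ≤ K * ε := by
    intro q
    have := mol_abs_sub_le n hP q
    rw [hε, mul_one_div]; exact this
  obtain ⟨X, hX1, hX2⟩ : ∃ X, x1 < X ∧ (J + K) * t1 ≤ η * X := by
    refine ⟨max (x1 + 1) ((J + K) * t1 / η), lt_of_lt_of_le (by linarith) (le_max_left _ _), ?_⟩
    have := mul_le_mul_of_nonneg_left (le_max_right (x1 + 1) ((J + K) * t1 / η)) η0.le
    refine le_trans (le_of_eq ?_) this
    field_simp
  set D : Pl → ℝ := fun p => (U p - mol n P p) + (η * p.1 + σ * p.2) with hD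
  obtain ⟨L, hL⟩ := lip_lin η σ
  have Dl : LipschitzWith (J + K + L) D := (hJ.sub (mol_lip n hP)).add hL
  obtain ⟨p2, hp2, hmin⟩ := ((isCompact_Icc (a := ε) (b := X)).prod (isCompact_Icc (a := ε) (b := t1))).exists_isMinOn
    ⟨(x1, t1), ⟨⟨εx.le, hX1.le⟩, ⟨εt.le, le_rfl⟩⟩⟩ Dl.continuous.continuousOn
  have hm : ∀ x t, ε ≤ x → x ≤ X → ε ≤ t → t ≤ t1 → D p2 ≤ D (x, t) := fun x t q1 q2 q3 q4 =>
    hmin (show (x, t) ∈ Icc ε X ×ˢ Icc ε t1 from ⟨⟨q1, q2⟩, ⟨q3, q4⟩⟩)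
  have Dp : D p2 ≤ -(d / 2) := by
    have := hm x1 t1 εx.le hX1.le εt.le le_rfl
    have h := (abs_le.1 (pn (x1, t1))).1
    simp only [hD] at this ⊢
    linarith
  obtain ⟨x2, t2⟩ := p2
  obtain ⟨⟨hx2, hx2'⟩, ⟨ht2, ht2'⟩⟩ := hp2
  simp only at hx2 hx2' ht2 ht2'
  have hηx : 0 ≤ η * x2 := mul_nonneg η0.le (by linarith)
  have hσt : 0 ≤ σ * t2 := mul_nonneg σ0.le (by linarith)
  have pp := (abs_le.1 (pn (x2, t2))).2
  simp only [hD] at Dp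
  have bx : ε < x2 := by
    refine lt_of_le_of_ne hx2 ?_
    rintro rfl
    have q1 := hb t2 (by linarith)
    have q2 := (abs_le.1 (lip_x hJ ε 0 t2)).1
    have q3 := (abs_le.1 (lip_x hP ε 0 t2)).2
    rw [sub_zero, abs_of_pos ε0] at q2 q3
    linarith
  have bt : ε < t2 := by
    refine lt_of_le_of_ne ht2 ?_
    rintro rfl
    have q1 := h0 x2 (by linarith)
    have q2 := (abs_le.1 (lip_t hJ x2 ε 0)).1
    have q3 := (abs_le.1 (lip_t hP x2 ε 0)).2
    rw [sub_zero, abs_of_pos ε0] at q2 q3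
    linarith
  have bX : x2 < X := by
    refine lt_of_le_of_ne hx2' ?_
    rintro rfl
    have q1 := h0 x2 (by linarith)
    have q2 := (abs_le.1 (lip_t hJ x2 t2 0)).1
    have q3 := (abs_le.1 (lip_t hP x2 t2 0)).2
    rw [sub_zero, abs_of_nonneg (by linarith)] at q2 q3
    have q4 : ((J : ℝ) + K) * t2 ≤ (J + K) * t1 := by gcongr
    linarith
  set Pn := mol n P with hPn
  have hsm : ContDiff ℝ ∞ Pn := mol_smooth n hP.continuous
  have cX : Continuous (dX Pn) := (hsm.continuous_fderiv (by simp)).clm_apply continuous_const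
  have cT : Continuous (dT Pn) := (hsm.continuous_fderiv (by simp)).clm_apply continuous_const
  obtain ⟨k, hk⟩ : ∃ k, k = dX Pn (x2, t2) - η := ⟨_, rfl⟩
  obtain ⟨ρ, ρ0, hρ⟩ : ∃ ρ > 0, ∀ p ∈ Metric.ball ((x2, t2) : Pl) ρ,
      |dX Pn p - dX Pn (x2, t2)| < η ∧ |dT Pn p - dT Pn (x2, t2)| < σ / 4 ∧ ε < p.1 ∧ p.1 < X ∧ ε < p.2 := by
    have e1 : ∀ᶠ p in 𝓝 ((x2, t2) : Pl), |dX Pn p - dX Pn (x2, t2)| < η :=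
      (cX.sub continuous_const).abs.tendsto' _ 0 (by simp) |>.eventually_lt_const η0
    have e2 : ∀ᶠ p in 𝓝 ((x2, t2) : Pl), |dT Pn p - dT Pn (x2, t2)| < σ / 4 :=
      (cT.sub continuous_const).abs.tendsto' _ 0 (by simp) |>.eventually_lt_const (by positivity)
    have e3 : ∀ᶠ p in 𝓝 ((x2, t2) : Pl), ε < p.1 := continuous_fst.tendsto (x2, t2) |>.eventually_const_lt bx
    have e4 : ∀ᶠ p in 𝓝 ((x2, t2) : Pl), p.1 < X := continuous_fst.tendsto (x2, t2) |>.eventually_lt_const bX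
    have e5 : ∀ᶠ p in 𝓝 ((x2, t2) : Pl), ε < p.2 := continuous_snd.tendsto (x2, t2) |>.eventually_const_lt bt
    obtain ⟨ρ, h, h'⟩ := Metric.eventually_nhds_iff_ball.1 (e1.and (e2.and (e3.and (e4.and e5))))
    exact ⟨ρ, h, h'⟩
  have kX : |dX Pn (x2, t2)| ≤ K := dX_le (mol_lip n hP) _
  have kb : |k| ≤ K + 1 := by
    rw [hk, abs_le]; rw [abs_le] at kX; constructor <;> linarith
  have gl : ∀ p, |g (u p) - g k| ≤ Λ * |u p - k| := fun p =>
    hlip _ _ ((hM p).trans (by linarith)) (kb.trans (by linarith))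
  refine localLemma' (p2 := (x2, t2)) (κ := σ / 4) (Λ := Λ) (C := M + K + 1) (D := D) (g1 := fun p => |u p - k|)
    (g2 := fun p => Real.sign (u p - k) * (g (u p) - g k)) ρ0 (by positivity) hΛ.le Dl
    (hU.meas.sub_const k).abs ((sign_meas.comp (hU.meas.sub_const k)).mul ((hg.cont.measurable.comp hU.meas).sub_const _))
    (fun p => ?_) (fun p => abs_nonneg _) (fun p => ?_)
    ((hU.kr k).mono fun p hp => ⟨ε0.trans (hρ p hp).2.2.1, ε0.trans (hρ p hp).2.2.2.2⟩) ?_ ?_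
  · rw [abs_abs]; refine (abs_sub _ _).trans ?_; linarith [hM p]
  · rw [abs_mul]
    have := sign_abs_le (u p - k)
    calc _ ≤ 1 * |g (u p) - g k| := by gcongr
      _ ≤ _ := by rw [one_mul]; exact gl p
  · filter_upwards [hU.pde, hJ.ae_differentiableAt] with p h1 h2 hp _
    obtain ⟨r1, r2, r3, r4, r5⟩ := hρ p hp
    obtain ⟨z1, z2⟩ := h1 ⟨ε0.trans r3, ε0.trans r5⟩
    have hf : HasFDerivAt D _ p := ((h2.hasFDerivAt.sub ((hsm.differentiable (by simp)) p).hasFDerivAt).add (lin_fd η σ p))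
    have f1 : dX D p = u p - dX Pn p + η := by
      unfold dX at z1 ⊢; rw [hf.fderiv]; simp [z1]
    have f2 : dT D p = - g (u p) - dT Pn p + σ := by
      unfold dT at z2 ⊢; rw [hf.fderiv]; simp [z2]
    have f3 := mol_sub hP hS n (q := (x2, t2)) (by rw [← hε]; exact bx) (by rw [← hε]; exact bt)
    rw [← hPn] at f3
    have f4 : |g (dX Pn (x2, t2)) - g k| ≤ σ / 4 := by
      have := hlip (dX Pn (x2, t2)) k (by linarith) (kb.trans (by linarith))
      rwa [hk, sub_sub_cancel, abs_of_pos η0, ηΛ, ← hk] at this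
    have f5 : -(g (u p) - g k) + σ / 2 ≤ dT D p := by
      rw [f2]; linarith [(abs_lt.1 r2).2, (abs_le.1 f4).1]
    refine ⟨?_, fun h => ?_⟩
    · have w1 : dX D p = (u p - k) + (dX Pn (x2, t2) - dX Pn p) := by rw [f1, hk]; ring
      have w2 : |Real.sign (u p - k) * (g (u p) - g k) * (dX Pn (x2, t2) - dX Pn p)| ≤ |u p - k| * (σ / 4) := by
        rw [abs_mul, abs_mul]
        have := sign_abs_le (u p - k)
        rw [abs_sub_comm] at r1
        calc _ ≤ 1 * (Λ * |u p - k|) * η := by gcongr; exact gl p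
          _ = _ := by rw [← ηΛ]; ring
      have w3 := (abs_le.1 w2).1
      have w4 := mul_le_mul_of_nonneg_left f5 (abs_nonneg (u p - k))
      rw [w1]
      have w5 : Real.sign (u p - k) * (g (u p) - g k) * (u p - k) = |u p - k| * (g (u p) - g k) := by
        rw [← sign_mul_self' (u p - k)]; ring
      rw [mul_add (Real.sign (u p - k) * (g (u p) - g k)), w5]
      linarith
    · have : u p = k := by linarith [abs_eq_zero.1 h]
      rw [this] at f5
      linarith
  · intro p hp hpt
    obtain ⟨r1, r2, r3, r4, r5⟩ := hρ p hp
    exact hm p.1 p.2 r3.le r4.le r5.le (le_trans hpt ht2')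


def rf : Pl ≃L[ℝ] Pl := (ContinuousLinearEquiv.neg ℝ).prodCongr (ContinuousLinearEquiv.refl ℝ ℝ)
lemma rf_apply (p : Pl) : rf p = (-p.1, p.2) := rfl
lemma rf_rf (p : Pl) : rf (rf p) = p := by simp [rf_apply]
lemma rf_mp : MeasurePreserving rf (volume : Measure Pl) volume :=
  (Measure.measurePreserving_neg (volume : Measure ℝ)).prod (MeasurePreserving.id _)
lemma dX_rf (φ : Pl → ℝ) (p : Pl) : dX (fun p => φ (rf p)) p = - dX φ (rf p) := by
  have : fderiv ℝ (φ ∘ rf) p = _ := rf.comp_right_fderiv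
  unfold dX
  change fderiv ℝ (φ ∘ rf) p (1, 0) = _
  rw [this, ← map_neg]
  simp [rf_apply]
lemma dT_rf (φ : Pl → ℝ) (p : Pl) : dT (fun p => φ (rf p)) p = dT φ (rf p) := by
  have : fderiv ℝ (φ ∘ rf) p = _ := rf.comp_right_fderiv
  unfold dT
  change fderiv ℝ (φ ∘ rf) p (0, 1) = _
  rw [this]
  simp [rf_apply]
lemma int_rf (F : Pl → ℝ) : ∫ p, F (rf p) = ∫ p, F p :=
  rf_mp.integral_comp rf.toHomeomorph.measurableEmbedding F

lemma ent_rf {O : Set Pl} {g1 g2 : Pl → ℝ} (h : EntOn O g1 g2) :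
    EntOn (rf ⁻¹' O) (fun p => g1 (rf p)) (fun p => -g2 (rf p)) := by
  intro φ h1 h2 h3 h4
  have := h (fun p => φ (rf p)) (h1.comp rf.contDiff) (h2.comp_homeomorph rf.toHomeomorph) (fun p => h3 _) ?_
  · rw [← int_rf] at this
    refine this.trans (le_of_eq (integral_congr_ae (Eventually.of_forall fun p => ?_)))
    simp only [dX_rf, dT_rf, rf_rf]
    ring
  · have : tsupport (φ ∘ rf) = rf ⁻¹' tsupport φ := tsupport_comp_eq_preimage φ rf.toHomeomorph
    change tsupport (φ ∘ rf) ⊆ O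
    rw [this]
    intro p hp
    have := h4 hp
    simpa [rf_rf] using this

lemma lip_rf {U : Pl → ℝ} {K : ℝ≥0} (h : LipschitzWith K U) : LipschitzWith K fun p => U (rf p) := by
  refine LipschitzWith.of_dist_le_mul fun p q => (h.dist_le_mul _ _).trans (le_of_eq ?_)
  congr 1
  simp [rf_apply, Prod.dist_eq]

lemma ae_rf {P : Pl → Prop} (h : ∀ᵐ p, P p) : ∀ᵐ p, P (rf p) := rf_mp.quasiMeasurePreserving.ae h

lemma ae_x_ne : ∀ᵐ p : Pl, p.1 ≠ 0 := by
  have : ∀ᵐ x : ℝ, x ≠ 0 := by simp [ae_iff]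
  exact (Measure.quasiMeasurePreserving_fst (μ := (volume : Measure ℝ)) (ν := (volume : Measure ℝ))).ae this

structure Pot (fl fr : ℝ → ℝ) (A B : ℝ) (U u : Pl → ℝ) : Prop where
  right : HalfPot fr U u
  left : HalfPot (fun p => fl (-p)) (fun p => U (rf p)) (fun p => -u (rf p))
  ie : EntOn {p | 0 < p.2} (fun p => |u p - cAB A B p.1|)
    (fun p => Real.sign (u p - cAB A B p.1) * (dflux fl fr p.1 (u p) - dflux fl fr p.1 (cAB A B p.1)))
  anti : ∀ s t, 0 ≤ s → s ≤ t → U (0, t) + fr B * t ≤ U (0, s) + fr B * s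

lemma Pot.pde {fl fr : ℝ → ℝ} {A B : ℝ} {U u : Pl → ℝ} (h : Pot fl fr A B U u) :
    ∀ᵐ p : Pl, 0 < p.2 → dX U p = u p ∧ dT U p = -dflux fl fr p.1 (u p) := by
  filter_upwards [h.right.pde, ae_rf h.left.pde, ae_x_ne] with p h1 h2 h3 hp
  rcases lt_or_gt_of_ne h3 with h4 | h4
  · have := h2 ⟨by simp [rf_apply, h4], by simpa [rf_apply] using hp⟩
    simp only [dX_rf, dT_rf, rf_rf, neg_neg] at this
    exact ⟨by linarith [this.1], by rw [this.2]; simp [dflux, h4]⟩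
  · have := h1 ⟨h4, hp⟩
    exact ⟨this.1, by rw [this.2]; simp [dflux, h4.le.not_gt]⟩

lemma half_min {a : ℝ} {g : ℝ → ℝ} {U1 u1 U2 u2 : Pl → ℝ} {B : ℝ} (hg : UC a g) (h1 : HalfPot g U1 u1)
    (h2 : HalfPot g U2 u2) (h0 : ∀ x, 0 ≤ x → U2 (x, 0) ≤ U1 (x, 0))
    (anti : ∀ s t, 0 ≤ s → s ≤ t → U1 (0, t) + g B * t ≤ U1 (0, s) + g B * s) {x t : ℝ} (hx : 0 ≤ x) (ht : 0 ≤ t) :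
    min (U2 (x, t)) (B * x + U1 (0, t)) ≤ U1 (x, t) := by
  obtain ⟨K1, l1⟩ := h1.lip
  obtain ⟨K2, l2⟩ := h2.lip
  obtain ⟨L, hL⟩ := lip_lin B 0
  have l3 : LipschitzWith K1 fun p : Pl => U1 (0, p.2) := by
    have := l1.comp ((LipschitzWith.const (α := Pl) (0 : ℝ)).prodMk LipschitzWith.prod_snd)
    simpa [Function.comp_def] using this
  refine quad_comp (P := fun p => min (U2 p) ((B * p.1 + 0 * p.2) + U1 (0, p.2))) hg h1 (l2.min (hL.add l3)) ?_ ?_ ?_ hx ht |>.trans' ?_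
  · intro p x t r hr hx hx' ht
    have k1 := h2.subS hg p x t r hr hx hx' ht
    have k2 := anti (t - r) t ht.le (by linarith)
    have k3 := hg.tangent p B
    have k4 : 0 ≤ r * (g B - (g p + deriv g p * (B - p))) :=
      mul_nonneg hr (by nlinarith [mul_nonneg hg.pos.le (sq_nonneg (B - p))])
    rw [← min_add_add_right]
    refine min_le_min k1 ?_
    simp only
    nlinarith
  · intro x hx
    exact (min_le_left _ _).trans (h0 x hx)
  · intro t ht
    refine (min_le_right _ _).trans ?_
    simp
  · simp

lemma lip_cx (A B : ℝ) : ∃ L : ℝ≥0, LipschitzWith L fun p : Pl => A * min p.1 0 + B * max p.1 0 := by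
  obtain ⟨L1, h1⟩ := lip_lin A 0
  obtain ⟨L2, h2⟩ := lip_lin B 0
  have a1 : LipschitzWith 1 fun p : Pl => ((min p.1 0, 0) : Pl) := by
    have := (LipschitzWith.prod_fst (α := ℝ) (β := ℝ)).min_const 0
    have := this.prodMk (LipschitzWith.const (α := Pl) (0 : ℝ))
    simpa using this
  have a2 : LipschitzWith 1 fun p : Pl => ((max p.1 0, 0) : Pl) := by
    have := (LipschitzWith.prod_fst (α := ℝ) (β := ℝ)).max_const 0
    have := this.prodMk (LipschitzWith.const (α := Pl) (0 : ℝ))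
    simpa using this
  have := (h1.comp a1).add (h2.comp a2)
  refine ⟨_, by simpa [Function.comp_def] using this⟩

lemma cx_fd (A B : ℝ) {p : Pl} (hp : p.1 ≠ 0) : HasFDerivAt (fun p : Pl => A * min p.1 0 + B * max p.1 0)
    (cAB A B p.1 • ContinuousLinearMap.fst ℝ ℝ ℝ) p := by
  rcases lt_or_gt_of_ne hp with h | h
  · have : (fun p : Pl => A * min p.1 0 + B * max p.1 0) =ᶠ[𝓝 p] fun p => A * p.1 := by
      filter_upwards [(isOpen_lt continuous_fst continuous_const).mem_nhds (show p.1 < 0 from h)] with q hq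
      have hq : q.1 < 0 := hq
      simp [hq.le]
    refine HasFDerivAt.congr_of_eventuallyEq ?_ this
    have e : cAB A B p.1 = A := by simp [cAB, h.le]
    rw [e]
    exact (hasFDerivAt_fst (p := p)).const_mul A
  · have : (fun p : Pl => A * min p.1 0 + B * max p.1 0) =ᶠ[𝓝 p] fun p => B * p.1 := by
      filter_upwards [(isOpen_lt continuous_const continuous_fst).mem_nhds (show 0 < p.1 from h)] with q hq
      have hq : 0 < q.1 := hq
      simp [hq.le]
    refine HasFDerivAt.congr_of_eventuallyEq ?_ this
    have e : cAB A B p.1 = B := by simp [cAB, not_le.2 h]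
    rw [e]
    exact (hasFDerivAt_fst (p := p)).const_mul B

lemma cAB_meas (A B : ℝ) : Measurable (cAB A B) :=
  Measurable.ite measurableSet_Iic measurable_const measurable_const
lemma dflux_meas {fl fr : ℝ → ℝ} (hl : Measurable fl) (hr : Measurable fr) :
    Measurable fun p : Pl => dflux fl fr p.1 p.2 :=
  Measurable.ite (measurableSet_lt measurable_fst measurable_const) (hl.comp measurable_snd) (hr.comp measurable_snd)
lemma dflux_cAB {fl fr : ℝ → ℝ} {A B x : ℝ} (hAB : fl A = fr B) (hx : x ≠ 0) :
    dflux fl fr x (cAB A B x) = fr B := by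
  rcases lt_or_gt_of_ne hx with h | h
  · simp [dflux, cAB, h, h.le, hAB]
  · simp [dflux, cAB, h.le.not_gt, not_le.2 h]

set_option maxHeartbeats 1000000 in
lemma Pot.iface {a : ℝ} {fl fr : ℝ → ℝ} {A B : ℝ} {U1 u1 U2 u2 : Pl → ℝ} (hl : UC a fl) (hr : UC a fr)
    (hAB : fl A = fr B) (h1 : Pot fl fr A B U1 u1) (h2 : Pot fl fr A B U2 u2)
    (h0 : ∀ x, U2 (x, 0) ≤ U1 (x, 0)) {t1 : ℝ} (ht1 : 0 ≤ t1) : U2 (0, t1) ≤ U1 (0, t1) := by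
  by_contra hcon
  push Not at hcon
  obtain ⟨K1, l1⟩ := h1.right.lip
  obtain ⟨K2, l2⟩ := h2.right.lip
  obtain ⟨M, hM⟩ := h1.right.bdd
  have M0 : 0 ≤ M := (abs_nonneg _).trans (hM 0)
  have c1 : Continuous fun t : ℝ => U1 (0, t) := l1.continuous.comp (by fun_prop)
  have c2 : Continuous fun t : ℝ => U2 (0, t) := l2.continuous.comp (by fun_prop)
  set S : Set ℝ := Icc 0 t1 ∩ {t | U2 (0, t) ≤ U1 (0, t)} with hS
  have Sc : IsCompact S := isCompact_Icc.inter_right (isClosed_le c2 c1)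
  have Sn : S.Nonempty := ⟨0, ⟨le_rfl, ht1⟩, h0 0⟩
  obtain ⟨t0, ht0, hmax⟩ := Sc.exists_isGreatest Sn
  obtain ⟨⟨t00, t01⟩, t02⟩ := ht0
  have lt01 : t0 < t1 := lt_of_le_of_ne t01 (by rintro rfl; exact absurd t02 (not_le.2 hcon))
  have neg : ∀ t, t0 < t → t ≤ t1 → U1 (0, t) < U2 (0, t) := by
    intro t q1 q2
    by_contra hq
    have := hmax ⟨⟨t00.trans q1.le, q2⟩, not_lt.1 hq⟩
    linarith
  have t02 : U2 (0, t0) ≤ U1 (0, t0) := t02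
  have klt : U1 (0, t1) + fr B * t1 < U1 (0, t0) + fr B * t0 := by
    have := h2.anti t0 t1 t00 t01
    linarith
  obtain ⟨t', q1, q2, q3⟩ : ∃ t', t0 < t' ∧ t' < t1 ∧ U1 (0, t1) + fr B * t1 < U1 (0, t') + fr B * t' := by
    have cc : Continuous fun t => U1 (0, t) + fr B * t := c1.add (by fun_prop)
    have e1 := (cc.tendsto t0).eventually_const_lt klt
    have e2 : ∀ᶠ t in 𝓝 t0, t < t1 := gt_mem_nhds lt01
    obtain ⟨t', h, h'⟩ := (((e1.and e2).filter_mono nhdsWithin_le_nhds).and (self_mem_nhdsWithin : ∀ᶠ t in 𝓝[>] t0, t ∈ Ioi t0)).exists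
    exact ⟨t', h', h.2, h.1⟩
  obtain ⟨m, m0, hm⟩ : ∃ m > 0, ∀ t, t' ≤ t → t ≤ t1 → U1 (0, t) + m ≤ U2 (0, t) := by
    obtain ⟨z, hz, hz'⟩ := (isCompact_Icc (a := t') (b := t1)).exists_isMinOn ⟨t1, q2.le, le_rfl⟩ (c2.sub c1).continuousOn
    refine ⟨U2 (0, z) - U1 (0, z), by linarith [neg z (q1.trans_le hz.1) hz.2], fun t j1 j2 => ?_⟩
    have : U2 (0, z) - U1 (0, z) ≤ U2 (0, t) - U1 (0, t) := hz' ⟨j1, j2⟩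
    linarith
  obtain ⟨δ, δ0, hδB, hδA⟩ : ∃ δ > 0, (K2 + |B|) * δ < m ∧ (K2 + |A|) * δ < m := by
    refine ⟨m / (2 * (K2 + |A| + |B| + 1)), by positivity, ?_, ?_⟩
    · rw [mul_div_assoc', div_lt_iff₀ (by positivity)]
      nlinarith [abs_nonneg A, abs_nonneg B, K2.2, mul_nonneg m0.le (abs_nonneg A), mul_nonneg m0.le (abs_nonneg B), mul_nonneg m0.le K2.2]
    · rw [mul_div_assoc', div_lt_iff₀ (by positivity)]
      nlinarith [abs_nonneg A, abs_nonneg B, K2.2, mul_nonneg m0.le (abs_nonneg A), mul_nonneg m0.le (abs_nonneg B), mul_nonneg m0.le K2.2]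
  have low : ∀ x t, |x| ≤ δ → t' ≤ t → t ≤ t1 → U1 (0, t) + (A * min x 0 + B * max x 0) ≤ U1 (x, t) := by
    intro x t hx j1 j2
    have h3 := hm t j1 j2
    have h4 := (abs_le.1 (lip_x l2 x 0 t)).1
    rw [sub_zero] at h4
    have h5 : K2 * |x| ≤ K2 * δ := by gcongr
    rcases le_total 0 x with h | h
    · rw [min_eq_right h, max_eq_left h]
      have := half_min hr h1.right h2.right (fun x _ => h0 x) h1.anti h (by linarith : 0 ≤ t)
      rcases min_le_iff.1 this with k | k
      · have h6 : B * x ≤ |B| * δ := by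
          rw [abs_of_nonneg h] at hx
          exact mul_le_mul (le_abs_self B) hx h (abs_nonneg B)
        nlinarith
      · linarith
    · rw [min_eq_left h, max_eq_right h]
      have := half_min (B := -A) hl.neg h1.left h2.left (fun x _ => by simpa [rf_apply] using h0 (-x)) (by
        intro s t q1 q2
        simpa [rf_apply, hAB] using h1.anti s t q1 q2) (x := -x) (t := t) (by linarith) (by linarith)
      simp only [rf_apply, neg_neg, neg_mul_neg, neg_zero] at this
      rcases min_le_iff.1 this with k | k
      · have h6 : A * x ≤ |A| * δ := by
          refine (le_abs_self _).trans ?_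
          rw [abs_mul]; gcongr
        nlinarith
      · linarith
  obtain ⟨σ, σ0, hσ⟩ : ∃ σ > 0, U1 (0, t1) + fr B * t1 + σ * t1 < U1 (0, t') + fr B * t' + σ * t' := by
    refine ⟨(U1 (0, t') + fr B * t' - (U1 (0, t1) + fr B * t1)) / (2 * (t1 - t')), div_pos (by linarith) (by linarith), ?_⟩
    obtain ⟨z, hz⟩ : ∃ z, z = (U1 (0, t') + fr B * t' - (U1 (0, t1) + fr B * t1)) / (2 * (t1 - t')) := ⟨_, rfl⟩
    rw [← hz]
    rw [eq_div_iff (by linarith)] at hz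
    linarith
  obtain ⟨t2, ⟨ht2, ht2'⟩, hmin⟩ := (isCompact_Icc (a := t') (b := t1)).exists_isMinOn ⟨t1, q2.le, le_rfl⟩
    (f := fun t => U1 (0, t) + fr B * t + σ * t) ((c1.add (by fun_prop)).add (by fun_prop)).continuousOn
  have hmin' : ∀ t, t' ≤ t → t ≤ t1 → U1 (0, t2) + fr B * t2 + σ * t2 ≤ U1 (0, t) + fr B * t + σ * t :=
    fun t j1 j2 => hmin ⟨j1, j2⟩
  have lt2 : t' < t2 := by
    refine lt_of_le_of_ne ht2 ?_
    rintro rfl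
    linarith [hmin' t1 q2.le le_rfl]
  obtain ⟨L, hL⟩ := lip_cx A B
  obtain ⟨L', hL'⟩ := lip_lin 0 (fr B + σ)
  obtain ⟨Λ1, hΛ1, hlip1⟩ := hl.lip (M + |A| + |B|)
  obtain ⟨Λ2, hΛ2, hlip2⟩ := hr.lip (M + |A| + |B|)
  have cb : ∀ x, |cAB A B x| ≤ |A| + |B| := by
    intro x; unfold cAB; split_ifs
    · linarith [abs_nonneg B]
    · linarith [abs_nonneg A]
  have gl : ∀ p, |dflux fl fr p.1 (u1 p) - dflux fl fr p.1 (cAB A B p.1)| ≤ (Λ1 + Λ2) * |u1 p - cAB A B p.1| := by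
    intro p
    have j1 : |u1 p| ≤ M + |A| + |B| := (hM p).trans (by linarith [abs_nonneg A, abs_nonneg B])
    have j2 : |cAB A B p.1| ≤ M + |A| + |B| := (cb _).trans (by linarith)
    have := abs_nonneg (u1 p - cAB A B p.1)
    unfold dflux; split_ifs
    · exact (hlip1 _ _ j1 j2).trans (by nlinarith)
    · exact (hlip2 _ _ j1 j2).trans (by nlinarith)
  have mu := h1.right.meas
  have mc : Measurable fun p : Pl => cAB A B p.1 := (cAB_meas A B).comp measurable_fst
  have md := dflux_meas hl.cont.measurable hr.cont.measurable
  have md1 : Measurable fun p : Pl => dflux fl fr p.1 (u1 p) := md.comp (measurable_fst.prodMk mu)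
  have md2 : Measurable fun p : Pl => dflux fl fr p.1 (cAB A B p.1) := md.comp (measurable_fst.prodMk mc)
  refine localLemma' (p2 := (0, t2)) (ρ := min δ (t2 - t')) (κ := σ) (Λ := Λ1 + Λ2) (C := M + (|A| + |B|))
    (g1 := fun p => |u1 p - cAB A B p.1|)
    (g2 := fun p => Real.sign (u1 p - cAB A B p.1) * (dflux fl fr p.1 (u1 p) - dflux fl fr p.1 (cAB A B p.1)))
    (D := fun p => (U1 p - (A * min p.1 0 + B * max p.1 0)) + (0 * p.1 + (fr B + σ) * p.2))
    (lt_min δ0 (by linarith)) σ0 (by positivity) ((l1.sub hL).add hL')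
    (mu.sub mc).abs ((sign_meas.comp (mu.sub mc)).mul (md1.sub md2)) (fun p => ?_) (fun p => abs_nonneg _) (fun p => ?_)
    (h1.ie.mono fun p hp => ?_) ?_ ?_
  · rw [abs_abs]; refine (abs_sub _ _).trans ?_; linarith [hM p, cb p.1]
  · rw [abs_mul]
    have := sign_abs_le (u1 p - cAB A B p.1)
    calc _ ≤ 1 * |dflux fl fr p.1 (u1 p) - dflux fl fr p.1 (cAB A B p.1)| := by gcongr
      _ ≤ _ := by rw [one_mul]; exact gl p
  · have : |p.2 - t2| < t2 - t' := by
      rw [Metric.mem_ball, Prod.dist_eq, max_lt_iff] at hp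
      exact hp.2.trans_le (min_le_right _ _)
    have := (abs_lt.1 this).1
    simp only [mem_ofPred_eq]; linarith
  · filter_upwards [h1.pde, l1.ae_differentiableAt, ae_x_ne] with p k1 k2 k3 hp _
    have hp2 : 0 < p.2 := by
      have : |p.2 - t2| < t2 - t' := by
        rw [Metric.mem_ball, Prod.dist_eq, max_lt_iff] at hp
        exact hp.2.trans_le (min_le_right _ _)
      have := (abs_lt.1 this).1
      linarith
    obtain ⟨z1, z2⟩ := k1 hp2
    have hf : HasFDerivAt (fun p : Pl => (U1 p - (A * min p.1 0 + B * max p.1 0)) + (0 * p.1 + (fr B + σ) * p.2)) _ p :=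
      (k2.hasFDerivAt.sub (cx_fd A B k3)).add (lin_fd 0 (fr B + σ) p)
    rw [dX, dT, hf.fderiv]
    unfold dX at z1
    unfold dT at z2
    simp only [ContinuousLinearMap.add_apply, ContinuousLinearMap.sub_apply, ContinuousLinearMap.smul_apply, z1, z2]
    simp only [ContinuousLinearMap.coe_fst', ContinuousLinearMap.coe_snd', smul_eq_mul, mul_one, mul_zero, add_zero, sub_zero, zero_add]
    rw [dflux_cAB hAB k3]
    refine ⟨le_of_eq ?_, fun h => ?_⟩
    · have w5 : Real.sign (u1 p - cAB A B p.1) * (dflux fl fr p.1 (u1 p) - fr B) * (u1 p - cAB A B p.1) = |u1 p - cAB A B p.1| * (dflux fl fr p.1 (u1 p) - fr B) := by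
        rw [← sign_mul_self' (u1 p - cAB A B p.1)]; ring
      rw [w5]; ring
    · have : u1 p = cAB A B p.1 := by linarith [abs_eq_zero.1 h]
      rw [this, dflux_cAB hAB k3]; linarith
  · intro p hp hpt
    rw [Metric.mem_ball, Prod.dist_eq, max_lt_iff, lt_min_iff, lt_min_iff, Real.dist_eq, Real.dist_eq] at hp
    obtain ⟨⟨j1, -⟩, -, j2⟩ := hp
    simp only [sub_zero] at j1
    have j3 := low p.1 p.2 j1.le (by linarith [(abs_lt.1 j2).1]) (le_trans hpt ht2')
    have j4 := hmin' p.2 (by linarith [(abs_lt.1 j2).1]) (le_trans hpt ht2')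
    simp only [min_self, max_self, mul_zero, add_zero, sub_zero, zero_mul, zero_add]
    linarith

theorem Pot.comp {a : ℝ} {fl fr : ℝ → ℝ} {A B : ℝ} {U1 u1 U2 u2 : Pl → ℝ} (hl : UC a fl) (hr : UC a fr)
    (hAB : fl A = fr B) (h1 : Pot fl fr A B U1 u1) (h2 : Pot fl fr A B U2 u2)
    (h0 : ∀ x, U2 (x, 0) ≤ U1 (x, 0)) {x t : ℝ} (ht : 0 ≤ t) : U2 (x, t) ≤ U1 (x, t) := by
  rcases le_total 0 x with h | h
  · obtain ⟨K2, l2⟩ := h2.right.lip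
    exact quad_comp hr h1.right l2 (h2.right.subS hr) (fun x _ => h0 x) (fun t ht => Pot.iface hl hr hAB h1 h2 h0 ht) h ht
  · obtain ⟨K2, l2⟩ := h2.left.lip
    have := quad_comp hl.neg h1.left l2 (h2.left.subS hl.neg) (fun x _ => by simpa [rf_apply] using h0 (-x))
      (fun t ht => by simpa [rf_apply] using Pot.iface hl hr hAB h1 h2 h0 ht) (x1 := -x) (t1 := t) (by linarith) ht
    simpa [rf_apply] using this


def sst : ℝ → ℝ := Real.smoothTransition
def dst : ℝ → ℝ := deriv sst
lemma sst_cd : ContDiff ℝ 1 sst := Real.smoothTransition.contDiff (n := 1)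
lemma sst_hd (x : ℝ) : HasDerivAt sst (dst x) x := (sst_cd.differentiable (by simp) x).hasDerivAt
lemma dst_cont : Continuous dst := sst_cd.continuous_deriv (by simp)
lemma dst_zero {s : ℝ} (h : s ∉ Icc (0 : ℝ) 1) : dst s = 0 := by
  rw [mem_Icc, not_and_or, not_le, not_le] at h
  rcases h with h | h
  · have : sst =ᶠ[𝓝 s] fun _ => 0 := by
      filter_upwards [gt_mem_nhds h] with y hy using Real.smoothTransition.zero_of_nonpos (le_of_lt hy)
    simp [dst, this.deriv_eq]
  · have : sst =ᶠ[𝓝 s] fun _ => 1 := by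
      filter_upwards [lt_mem_nhds h] with y hy using Real.smoothTransition.one_of_one_le (le_of_lt hy)
    simp [dst, this.deriv_eq]
lemma dst_int : ∫ s, dst s = 1 := by
  rw [← setIntegral_eq_integral_of_forall_compl_eq_zero (s := Icc 0 1) (fun x hx => dst_zero hx),
    integral_Icc_eq_integral_Ioc, ← intervalIntegral.integral_of_le zero_le_one]
  rw [intervalIntegral.integral_eq_sub_of_hasDerivAt (fun x _ => sst_hd x) (dst_cont.intervalIntegrable _ _)]
  simp [sst]
lemma dst_supp : HasCompactSupport dst := HasCompactSupport.intro isCompact_Icc fun x hx => dst_zero hx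
lemma dst_integrable : Integrable dst := dst_cont.integrable_of_hasCompactSupport dst_supp

def rr (n : ℕ) (z : ℝ) : ℝ := sst (((n : ℝ) + 1) * z - 1)
def drr (n : ℕ) (z : ℝ) : ℝ := ((n : ℝ) + 1) * dst (((n : ℝ) + 1) * z - 1)
lemma rr_hd (n : ℕ) (z : ℝ) : HasDerivAt (rr n) (drr n z) z := by
  have h : HasDerivAt (fun z : ℝ => ((n : ℝ) + 1) * z - 1) ((n : ℝ) + 1) z := by
    simpa using ((hasDerivAt_id z).const_mul ((n : ℝ) + 1)).sub_const 1
  have := (sst_hd (((n : ℝ) + 1) * z - 1)).comp z h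
  rwa [mul_comm] at this
lemma rr_cd (n : ℕ) : ContDiff ℝ 1 (rr n) := sst_cd.comp (by fun_prop)
lemma rr_nn (n : ℕ) (z : ℝ) : 0 ≤ rr n z := Real.smoothTransition.nonneg _
lemma rr_le (n : ℕ) (z : ℝ) : rr n z ≤ 1 := Real.smoothTransition.le_one _
lemma rr_zero (n : ℕ) {z : ℝ} (h : z ≤ 0) : rr n z = 0 :=
  Real.smoothTransition.zero_of_nonpos (by have := mul_nonneg (by positivity : (0:ℝ) ≤ (n : ℝ) + 1) (neg_nonneg.2 h); linarith)
lemma rr_one (n : ℕ) {z : ℝ} (h : 2 ≤ z) : rr n z = 1 :=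
  Real.smoothTransition.one_of_one_le (by nlinarith [(Nat.cast_nonneg n : (0:ℝ) ≤ n)])
lemma rr_lim (z : ℝ) : Tendsto (fun n => rr n z) atTop (𝓝 (if 0 < z then 1 else 0)) := by
  split_ifs with h
  · obtain ⟨N, hN⟩ := exists_nat_gt (2 / z)
    refine tendsto_const_nhds.congr' ?_
    filter_upwards [eventually_ge_atTop N] with n hn
    refine (Real.smoothTransition.one_of_one_le ?_).symm
    rw [div_lt_iff₀ h] at hN
    have : (N : ℝ) * z ≤ n * z := by gcongr
    linarith
  · exact tendsto_const_nhds.congr fun n => (rr_zero n (not_lt.1 h)).symm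
lemma drr_cont (n : ℕ) : Continuous (drr n) := continuous_const.mul (dst_cont.comp (by fun_prop))

lemma drr_lim {g : ℕ → ℝ → ℝ} (hg : ∀ n, Measurable (g n)) {C x L : ℝ} (hC : ∀ n y, |g n y| ≤ C)
    (hL : ∀ s ∈ Icc (0 : ℝ) 1, Tendsto (fun n : ℕ => g n (x + (s + 1) / ((n : ℝ) + 1))) atTop (𝓝 L)) :
    Tendsto (fun n => ∫ y, g n y * drr n (y - x)) atTop (𝓝 L) := by
  have e : ∀ n : ℕ, ∫ y, g n y * drr n (y - x) = ∫ s, g n (x + (s + 1) / ((n : ℝ) + 1)) * dst s := by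
    intro n
    have np : (0 : ℝ) < (n : ℝ) + 1 := by positivity
    set H : ℝ → ℝ := fun s => g n (x + (s + 1) / ((n : ℝ) + 1)) * dst s
    have h1 : ∀ y, g n y * drr n (y - x) = ((n : ℝ) + 1) * H (((n : ℝ) + 1) * (y - x) - 1) := by
      intro y
      have : x + (((n : ℝ) + 1) * (y - x) - 1 + 1) / ((n : ℝ) + 1) = y := by field_simp; ring
      simp only [H, this, drr]; ring
    simp_rw [h1]
    rw [integral_const_mul, integral_sub_right_eq_self (fun y => H (((n : ℝ) + 1) * y - 1)) x,
      Measure.integral_comp_mul_left (fun y => H (y - 1)) ((n : ℝ) + 1), integral_sub_right_eq_self H 1,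
      abs_of_pos (by positivity), smul_eq_mul]
    field_simp
  simp_rw [e]
  have : L = ∫ s, L * dst s := by rw [integral_const_mul, dst_int, mul_one]
  rw [this]
  refine tendsto_integral_of_dominated_convergence (fun s => C * |dst s|)
    (fun n => (((hg n).comp (by fun_prop)).mul dst_cont.measurable).aestronglyMeasurable)
    (dst_integrable.abs.const_mul C) (fun n => Eventually.of_forall fun s => ?_) (Eventually.of_forall fun s => ?_)
  · rw [Real.norm_eq_abs, abs_mul]; exact mul_le_mul_of_nonneg_right (hC _ _) (abs_nonneg _)
  · by_cases hs : s ∈ Icc (0 : ℝ) 1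
    · exact (hL s hs).mul_const _
    · simp [dst_zero hs]

lemma sarg {s : ℝ} (hs : s ∈ Icc (0 : ℝ) 1) (x : ℝ) :
    Tendsto (fun n : ℕ => x + (s + 1) / ((n : ℝ) + 1)) atTop (𝓝[>] x) := by
  refine tendsto_nhdsWithin_iff.2 ⟨?_, Eventually.of_forall fun n => ?_⟩
  · have := (tendsto_const_nhds (x := s + 1)).mul (tendsto_one_div_add_atTop_nhds_zero_nat (𝕜 := ℝ))
    simp only [mul_zero, mul_one_div] at this
    simpa using this.const_add x
  · have : 0 < (s + 1) / ((n : ℝ) + 1) := div_pos (by linarith [hs.1]) (by positivity)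
    simp only [mem_Ioi]; linarith

def chi (n : ℕ) (x y z : ℝ) : ℝ := rr n (z - x) - rr n (z - y)
def dchi (n : ℕ) (x y z : ℝ) : ℝ := drr n (z - x) - drr n (z - y)
lemma chi_hd (n : ℕ) (x y z : ℝ) : HasDerivAt (chi n x y) (dchi n x y z) z := by
  have h : ∀ x, HasDerivAt (fun z => rr n (z - x)) (drr n (z - x)) z := fun x => by
    have := (rr_hd n (z - x)).comp z ((hasDerivAt_id z).sub_const x)
    rwa [mul_one] at this
  exact (h x).sub (h y)
lemma chi_cd (n : ℕ) (x y : ℝ) : ContDiff ℝ 1 (chi n x y) :=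
  ((rr_cd n).comp (by fun_prop)).sub ((rr_cd n).comp (by fun_prop))
lemma chi_abs (n : ℕ) (x y z : ℝ) : |chi n x y z| ≤ 1 := by
  unfold chi; rw [abs_le]; constructor <;> linarith [rr_nn n (z - x), rr_nn n (z - y), rr_le n (z - x), rr_le n (z - y)]
lemma chi_zero (n : ℕ) {x y z : ℝ} (h : x ≤ y) (hz : z ∉ Icc x (y + 2)) : chi n x y z = 0 := by
  rw [mem_Icc, not_and_or, not_le, not_le] at hz
  unfold chi
  rcases hz with hz | hz
  · rw [rr_zero n (by linarith), rr_zero n (by linarith), sub_self]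
  · rw [rr_one n (by linarith), rr_one n (by linarith), sub_self]
lemma chi_lt (n : ℕ) {x y z : ℝ} (h : x ≤ y) (hz : z ≤ x) : chi n x y z = 0 := by
  unfold chi; rw [rr_zero n (by linarith), rr_zero n (by linarith), sub_self]
lemma chi_supp (n : ℕ) {x y : ℝ} (h : x ≤ y) : HasCompactSupport (chi n x y) :=
  HasCompactSupport.intro isCompact_Icc fun _ hz => chi_zero n h hz
lemma chi_lim {x y : ℝ} (h : x ≤ y) (z : ℝ) :
    Tendsto (fun n => chi n x y z) atTop (𝓝 ((Ioc x y).indicator (fun _ => (1 : ℝ)) z)) := by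
  have := (rr_lim (z - x)).sub (rr_lim (z - y))
  have e : (Ioc x y).indicator (fun _ => (1 : ℝ)) z = (if 0 < z - x then 1 else 0) - (if 0 < z - y then 1 else 0) := by
    by_cases h1 : x < z <;> by_cases h2 : z ≤ y
    · rw [indicator_of_mem (show z ∈ Ioc x y from ⟨h1, h2⟩), if_pos (by linarith), if_neg (by linarith)]; ring
    · rw [indicator_of_notMem (fun hh => h2 hh.2), if_pos (by linarith), if_pos (by linarith)]; ring
    · rw [indicator_of_notMem (fun hh => h1 hh.1), if_neg (by linarith), if_neg (by linarith)]; ring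
    · exfalso; push Not at *; linarith
  rw [e]; exact this
lemma dchi_cont (n : ℕ) (x y : ℝ) : Continuous (dchi n x y) :=
  ((drr_cont n).comp (by fun_prop)).sub ((drr_cont n).comp (by fun_prop))
lemma dchi_integrable (n : ℕ) {x y : ℝ} (h : x ≤ y) : Integrable (dchi n x y) := by
  have : dchi n x y = deriv (chi n x y) := by ext z; exact (chi_hd n x y z).deriv.symm
  rw [this]
  exact ((chi_cd n x y).continuous_deriv (by simp)).integrable_of_hasCompactSupport (chi_supp n h).deriv
lemma chi_integrable (n : ℕ) {x y : ℝ} (h : x ≤ y) : Integrable (chi n x y) :=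
  (chi_cd n x y).continuous.integrable_of_hasCompactSupport (chi_supp n h)

lemma drr_integrable (n : ℕ) (x : ℝ) : Integrable fun y => drr n (y - x) := by
  have h0 : Integrable fun z => dst (((n : ℝ) + 1) * z - 1) := by
    have := (dst_integrable.comp_sub_right 1).comp_mul_left' (R := (n : ℝ) + 1) (by positivity)
    exact this
  exact (h0.const_mul _).comp_sub_right x

lemma dchi_lim {g : ℕ → ℝ → ℝ} (hg : ∀ n, Measurable (g n)) {C x y L L' : ℝ} (hC : ∀ n y, |g n y| ≤ C)
    (hL : ∀ s ∈ Icc (0 : ℝ) 1, Tendsto (fun n : ℕ => g n (x + (s + 1) / ((n : ℝ) + 1))) atTop (𝓝 L))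
    (hL' : ∀ s ∈ Icc (0 : ℝ) 1, Tendsto (fun n : ℕ => g n (y + (s + 1) / ((n : ℝ) + 1))) atTop (𝓝 L')) :
    Tendsto (fun n => ∫ z, g n z * dchi n x y z) atTop (𝓝 (L - L')) := by
  refine ((drr_lim hg hC hL).sub (drr_lim hg hC hL')).congr fun n => ?_
  have ii : ∀ x, Integrable fun z => g n z * drr n (z - x) := fun x =>
    (drr_integrable n x).bdd_mul (c := C) (hg n).aestronglyMeasurable (Eventually.of_forall (hC n))
  rw [← integral_sub (ii x) (ii y)]
  refine integral_congr_ae (Eventually.of_forall fun z => ?_)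
  simp only [dchi]; ring

lemma dchi_bound {g : ℝ → ℝ} {C x y : ℝ} (hC : ∀ y, |g y| ≤ C) (n : ℕ) :
    |∫ z, g z * dchi n x y z| ≤ 2 * (C * ∫ s, |dst s|) := by
  have C0 : 0 ≤ C := (abs_nonneg _).trans (hC 0)
  have nn : ∀ x, ∫ z, |drr n (z - x)| = ∫ s, |dst s| := by
    intro x
    have np : (0 : ℝ) < (n : ℝ) + 1 := by positivity
    rw [integral_sub_right_eq_self (fun z => |drr n z|) x]
    simp only [drr, abs_mul, abs_of_pos np]
    rw [integral_const_mul, Measure.integral_comp_mul_left (fun y => |dst (y - 1)|) ((n : ℝ) + 1),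
      integral_sub_right_eq_self (fun s => |dst s|) 1, abs_of_pos (by positivity), smul_eq_mul]
    field_simp
  rw [← Real.norm_eq_abs]
  refine (norm_integral_le_of_norm_le (g := fun z => C * |drr n (z - x)| + C * |drr n (z - y)|)
    (((drr_integrable n x).abs.const_mul C).add ((drr_integrable n y).abs.const_mul C))
    (Eventually.of_forall fun z => ?_)).trans (le_of_eq ?_)
  · rw [Real.norm_eq_abs, abs_mul, ← mul_add]
    exact mul_le_mul (hC z) (abs_sub _ _) (abs_nonneg _) C0
  · rw [integral_add ((drr_integrable n x).abs.const_mul C) ((drr_integrable n y).abs.const_mul C),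
      integral_const_mul, integral_const_mul, nn, nn]; ring

lemma UC.bd {a : ℝ} {f : ℝ → ℝ} (h : UC a f) (R : ℝ) : ∃ C, ∀ p, |p| ≤ R → |f p| ≤ C := by
  obtain ⟨C, hC⟩ := (isCompact_Icc (a := -R) (b := R)).exists_bound_of_continuousOn h.cont.continuousOn
  exact ⟨C, fun p hp => hC p (abs_le.1 hp)⟩

lemma dflux_bd {a : ℝ} {fl fr : ℝ → ℝ} (hl : UC a fl) (hr : UC a fr) (R : ℝ) :
    ∃ C, 0 ≤ C ∧ ∀ x p, |p| ≤ R → |dflux fl fr x p| ≤ C := by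
  obtain ⟨C1, h1⟩ := hl.bd R
  obtain ⟨C2, h2⟩ := hr.bd R
  refine ⟨max (max C1 C2) 0, le_max_right _ _, fun x p hp => ?_⟩
  unfold dflux; split_ifs
  · exact (h1 p hp).trans ((le_max_left _ _).trans (le_max_left _ _))
  · exact (h2 p hp).trans ((le_max_right _ _).trans (le_max_left _ _))

section
variable {a A B : ℝ} {fl fr u0 : ℝ → ℝ}

lemma dflux_up (hl : UC a fl) (hr : UC a fr) {v : ℝ → ℝ} {x L : ℝ} (h : Tendsto v (𝓝[>] x) (𝓝 L)) :
    Tendsto (fun y => dflux fl fr y (v y)) (𝓝[>] x) (𝓝 (dflux fl fr x L)) := by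
  by_cases hx : x < 0
  · have e : (fun y => fl (v y)) =ᶠ[𝓝[>] x] fun y => dflux fl fr y (v y) := by
      filter_upwards [mem_nhdsWithin_of_mem_nhds (gt_mem_nhds hx)] with y hy
      have hy : y < 0 := hy
      simp [dflux, hy]
    simp only [dflux, hx, if_true]
    exact ((hl.cont.tendsto L).comp h).congr' e
  · have e : (fun y => fr (v y)) =ᶠ[𝓝[>] x] fun y => dflux fl fr y (v y) := by
      filter_upwards [self_mem_nhdsWithin] with y hy
      have hy : x < y := hy
      have : ¬ y < 0 := by linarith
      simp [dflux, this]
    simp only [dflux, hx, if_false]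
    exact ((hr.cont.tendsto L).comp h).congr' e

set_option maxHeartbeats 1000000 in
lemma bal_lim {e0 q qp : ℝ → ℝ → ℝ} {M C : ℝ} (mu : Measurable fun p : Pl => e0 p.1 p.2)
    (mq : Measurable fun p : Pl => q p.1 p.2) (hM : ∀ y t, |e0 y t| ≤ M) (hC : ∀ y t, |q y t| ≤ C)
    (hcont : ∀ r t₀ : ℝ, 0 ≤ t₀ → Tendsto (fun t => ∫ x in Icc (-r) r, |e0 x t - e0 x t₀|) (𝓝[Ici 0] t₀) (𝓝 0))
    (hq : ∀ x t, 0 < t → Tendsto (fun y => q y t) (𝓝[>] x) (𝓝 (qp x t))) {x1 x2 t1 t2 : ℝ}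
    (hx : x1 ≤ x2) (h1 : 0 ≤ t1) (ht : t1 ≤ t2) :
    Tendsto (fun n => ∫ p : Pl, (e0 p.1 p.2 * deriv (fun s => chi n x1 x2 p.1 * chi n t1 t2 s) p.2 +
        q p.1 p.2 * deriv (fun y => chi n x1 x2 y * chi n t1 t2 p.2) p.1)) atTop
      (𝓝 ((∫ y in x1..x2, e0 y t1) - (∫ y in x1..x2, e0 y t2) + ∫ t in t1..t2, (qp x1 t - qp x2 t))) := by
  have M0 : 0 ≤ M := (abs_nonneg _).trans (hM 0 0)
  have C0 : 0 ≤ C := (abs_nonneg _).trans (hC 0 0)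
  have i1 : ∀ n, Integrable fun p : Pl => e0 p.1 p.2 * (chi n x1 x2 p.1 * dchi n t1 t2 p.2) := fun n =>
    ((chi_integrable n hx).mul_prod (dchi_integrable n ht)).bdd_mul (c := M) mu.aestronglyMeasurable
      (Eventually.of_forall fun p => hM _ _)
  have i2 : ∀ n, Integrable fun p : Pl => q p.1 p.2 * (dchi n x1 x2 p.1 * chi n t1 t2 p.2) := fun n =>
    ((dchi_integrable n hx).mul_prod (chi_integrable n ht)).bdd_mul (c := C) mq.aestronglyMeasurable
      (Eventually.of_forall fun p => hC _ _)
  have key : ∀ n, (∫ t, (∫ y, e0 y t * chi n x1 x2 y) * dchi n t1 t2 t) +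
      ∫ t, (∫ y, q y t * dchi n x1 x2 y) * chi n t1 t2 t =
      ∫ p : Pl, (e0 p.1 p.2 * deriv (fun s => chi n x1 x2 p.1 * chi n t1 t2 s) p.2 +
        q p.1 p.2 * deriv (fun y => chi n x1 x2 y * chi n t1 t2 p.2) p.1) := by
    intro n
    have d1 : ∀ p : Pl, deriv (fun s => chi n x1 x2 p.1 * chi n t1 t2 s) p.2 = chi n x1 x2 p.1 * dchi n t1 t2 p.2 :=
      fun p => ((chi_hd n t1 t2 p.2).const_mul _).deriv
    have d2 : ∀ p : Pl, deriv (fun y => chi n x1 x2 y * chi n t1 t2 p.2) p.1 = dchi n x1 x2 p.1 * chi n t1 t2 p.2 :=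
      fun p => ((chi_hd n x1 x2 p.1).mul_const _).deriv
    simp only [d1, d2]
    rw [integral_add (i1 n) (i2 n)]
    have s1 := integral_prod_symm (μ := (volume : Measure ℝ)) (ν := (volume : Measure ℝ)) _ (i1 n)
    have s2 := integral_prod_symm (μ := (volume : Measure ℝ)) (ν := (volume : Measure ℝ)) _ (i2 n)
    rw [Measure.volume_eq_prod, s1, s2]
    congr 1
    · refine integral_congr_ae (Eventually.of_forall fun t => ?_)
      simp only [← integral_mul_const, mul_assoc]
    · refine integral_congr_ae (Eventually.of_forall fun t => ?_)
      simp only [← integral_mul_const, mul_assoc]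
  have bi : ∀ t, (∫ y in x1..x2, e0 y t) = ∫ y, e0 y t * (Ioc x1 x2).indicator (fun _ => (1 : ℝ)) y := by
    intro t
    rw [intervalIntegral.integral_of_le hx, ← integral_indicator measurableSet_Ioc]
    refine integral_congr_ae (Eventually.of_forall fun y => ?_)
    by_cases hy : y ∈ Ioc x1 x2 <;> simp [hy]
  have mt : ∀ t, Measurable fun y => e0 y t := fun t => mu.comp (measurable_id.prodMk measurable_const)
  have ib : ∀ n z, |chi n x1 x2 z| ≤ (Icc x1 (x2 + 2)).indicator (fun _ => (1 : ℝ)) z := by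
    intro n z
    by_cases hz : z ∈ Icc x1 (x2 + 2)
    · simp only [hz, indicator_of_mem]; exact chi_abs _ _ _ _
    · simp [hz, chi_zero n hx hz]
  have ibi : Integrable ((Icc x1 (x2 + 2)).indicator (fun _ => (1 : ℝ))) :=
    (integrable_indicator_iff measurableSet_Icc).2 (by simp)
  have L1 : ∀ t, 0 ≤ t → ∀ s ∈ Icc (0 : ℝ) 1, Tendsto (fun n : ℕ => ∫ y, e0 y (t + (s + 1) / ((n : ℝ) + 1)) * chi n x1 x2 y) atTop
      (𝓝 (∫ y in x1..x2, e0 y t)) := by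
    intro t h0 s hs
    have a1 : Tendsto (fun n : ℕ => ∫ y, e0 y t * chi n x1 x2 y) atTop (𝓝 (∫ y in x1..x2, e0 y t)) := by
      rw [bi]
      refine tendsto_integral_of_dominated_convergence (fun y => M * (Icc x1 (x2 + 2)).indicator (fun _ => (1 : ℝ)) y)
        (fun n => ((mt t).mul (chi_cd n x1 x2).continuous.measurable).aestronglyMeasurable) (ibi.const_mul M)
        (fun n => Eventually.of_forall fun y => ?_) (Eventually.of_forall fun y => (chi_lim hx y).const_mul _)
      rw [Real.norm_eq_abs, abs_mul]
      exact mul_le_mul (hM _ _) (ib n y) (abs_nonneg _) M0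
    set r := max |x1| |x2 + 2|
    have rs : Icc x1 (x2 + 2) ⊆ Icc (-r) r := Icc_subset_Icc
      (by linarith [neg_abs_le x1, le_max_left |x1| |x2 + 2|]) ((le_abs_self _).trans (le_max_right _ _))
    have tc := (hcont r t h0).comp ((sarg hs t).mono_right (nhdsWithin_mono t (fun z hz => h0.trans (le_of_lt hz))))
    have a2 : Tendsto (fun n : ℕ => (∫ y, e0 y (t + (s + 1) / ((n : ℝ) + 1)) * chi n x1 x2 y) - ∫ y, e0 y t * chi n x1 x2 y) atTop (𝓝 0) := by
      refine squeeze_zero_norm (fun n => ?_) tc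
      have ii : ∀ t, Integrable fun y => e0 y t * chi n x1 x2 y := fun t =>
        (chi_integrable n hx).bdd_mul (c := M) (mt t).aestronglyMeasurable (Eventually.of_forall fun y => hM y t)
      rw [← integral_sub (ii _) (ii _)]
      simp only [Function.comp_apply]
      rw [← integral_indicator measurableSet_Icc]
      have bi' : Integrable ((Icc (-r) r).indicator fun y => |e0 y (t + (s + 1) / ((n : ℝ) + 1)) - e0 y t|) := by
        rw [integrable_indicator_iff measurableSet_Icc]
        refine Measure.integrableOn_of_bounded (M := M + M) (by simp) ((mt _).sub (mt _)).abs.aestronglyMeasurable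
          (Eventually.of_forall fun y => ?_)
        rw [Real.norm_eq_abs, abs_abs]
        exact (abs_sub _ _).trans (add_le_add (hM _ _) (hM _ _))
      refine norm_integral_le_of_norm_le bi' (Eventually.of_forall fun y => ?_)
      rw [← sub_mul, Real.norm_eq_abs, abs_mul]
      by_cases hy : y ∈ Icc x1 (x2 + 2)
      · rw [indicator_of_mem (rs hy)]
        exact mul_le_of_le_one_right (abs_nonneg _) (chi_abs _ _ _ _)
      · rw [chi_zero n hx hy, abs_zero, mul_zero]
        exact indicator_nonneg (fun _ _ => abs_nonneg _) _
    simpa using a2.add a1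
  have R1 : Tendsto (fun n => ∫ t, (∫ y, e0 y t * chi n x1 x2 y) * dchi n t1 t2 t) atTop
      (𝓝 ((∫ y in x1..x2, e0 y t1) - (∫ y in x1..x2, e0 y t2))) := by
    refine dchi_lim (C := M * (x2 + 2 - x1)) (fun n => ?_) (fun n t => ?_) (L1 t1 h1) (L1 t2 (h1.trans ht))
    · have : StronglyMeasurable (fun p : ℝ × ℝ => e0 p.2 p.1 * chi n x1 x2 p.2) :=
        ((mu.comp measurable_swap).mul ((chi_cd n x1 x2).continuous.measurable.comp measurable_snd)).stronglyMeasurable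
      exact (this.integral_prod_right' (ν := (volume : Measure ℝ))).measurable
    · rw [← Real.norm_eq_abs]
      refine (norm_integral_le_of_norm_le (ibi.const_mul M) (Eventually.of_forall fun y => ?_)).trans (le_of_eq ?_)
      · rw [Real.norm_eq_abs, abs_mul]
        exact mul_le_mul (hM _ _) (ib n y) (abs_nonneg _) M0
      · rw [integral_const_mul, integral_indicator measurableSet_Icc]
        simp [show x1 ≤ x2 + 2 by linarith]
  have R2 : Tendsto (fun n => ∫ t, (∫ y, q y t * dchi n x1 x2 y) * chi n t1 t2 t) atTop
      (𝓝 (∫ t in t1..t2, (qp x1 t - qp x2 t))) := by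
    have e : (∫ t in t1..t2, (qp x1 t - qp x2 t)) =
        ∫ t, (qp x1 t - qp x2 t) * (Ioc t1 t2).indicator (fun _ => (1 : ℝ)) t := by
      rw [intervalIntegral.integral_of_le ht, ← integral_indicator measurableSet_Ioc]
      refine integral_congr_ae (Eventually.of_forall fun y => ?_)
      by_cases hy : y ∈ Ioc t1 t2 <;> simp [hy]
    rw [e]
    have ibt : Integrable ((Icc t1 (t2 + 2)).indicator (fun _ => (1 : ℝ))) :=
      (integrable_indicator_iff measurableSet_Icc).2 (by simp)
    have D0 : 0 ≤ 2 * (C * ∫ s, |dst s|) := by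
      have : 0 ≤ ∫ s, |dst s| := integral_nonneg fun _ => abs_nonneg _
      positivity
    refine tendsto_integral_of_dominated_convergence (fun t => 2 * (C * ∫ s, |dst s|) * (Icc t1 (t2 + 2)).indicator (fun _ => (1 : ℝ)) t)
      (fun n => ?_) (ibt.const_mul _) (fun n => Eventually.of_forall fun t => ?_) (Eventually.of_forall fun t => ?_)
    · have : StronglyMeasurable (fun p : ℝ × ℝ => q p.2 p.1 * dchi n x1 x2 p.2) :=
        ((mq.comp measurable_swap).mul ((dchi_cont n x1 x2).measurable.comp measurable_snd)).stronglyMeasurable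
      exact ((this.integral_prod_right' (ν := (volume : Measure ℝ))).measurable.mul (chi_cd n t1 t2).continuous.measurable).aestronglyMeasurable
    · rw [Real.norm_eq_abs, abs_mul]
      refine mul_le_mul (dchi_bound (fun y => hC _ _) n) ?_ (abs_nonneg _) D0
      by_cases hz : t ∈ Icc t1 (t2 + 2)
      · simp only [hz, indicator_of_mem]; exact chi_abs _ _ _ _
      · simp [hz, chi_zero n ht hz]
    · by_cases h0 : t ≤ t1
      · have : t ∉ Ioc t1 t2 := fun hh => absurd hh.1 (not_lt.2 h0)
        simp [chi_lt _ ht h0, this]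
      · have tp : 0 < t := by push Not at h0; linarith
        refine Tendsto.mul ?_ (chi_lim ht t)
        have lm : ∀ x, ∀ s ∈ Icc (0 : ℝ) 1, Tendsto (fun n : ℕ => q (x + (s + 1) / ((n : ℝ) + 1)) t) atTop
            (𝓝 (qp x t)) := fun x s hs =>
          (hq x t tp).comp (sarg hs x)
        exact dchi_lim (g := fun _ y => q y t) (fun n => mq.comp (measurable_id.prodMk measurable_const))
          (fun n y => hC _ _) (lm x1) (lm x2)
  exact (R1.add R2).congr key


lemma chi2_cd (n : ℕ) (x1 x2 t1 t2 : ℝ) : ContDiff ℝ 1 fun p : Pl => chi n x1 x2 p.1 * chi n t1 t2 p.2 :=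
  ((chi_cd n x1 x2).comp contDiff_fst).mul ((chi_cd n t1 t2).comp contDiff_snd)
lemma chi2_supp (n : ℕ) {x1 x2 t1 t2 : ℝ} (hx : x1 ≤ x2) (ht : t1 ≤ t2) :
    HasCompactSupport fun p : Pl => chi n x1 x2 p.1 * chi n t1 t2 p.2 :=
  HasCompactSupport.intro (isCompact_Icc.prod isCompact_Icc : IsCompact (Icc x1 (x2 + 2) ×ˢ Icc t1 (t2 + 2))) (by
    intro p hp
    rw [mem_prod, not_and_or] at hp
    rcases hp with hp | hp
    · simp [chi_zero n hx hp]
    · simp [chi_zero n ht hp])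

lemma balance (hl : UC a fl) (hr : UC a fr) (sol : ABSol fl fr A B u0) {x1 x2 t1 t2 : ℝ}
    (hx : x1 ≤ x2) (h1 : 0 ≤ t1) (ht : t1 ≤ t2) :
    (∫ y in x1..x2, sol.u y t1) - (∫ y in x1..x2, sol.u y t2) +
      ∫ t in t1..t2, (dflux fl fr x1 (sol.up x1 t) - dflux fl fr x2 (sol.up x2 t)) = 0 := by
  obtain ⟨M, hM⟩ := sol.bdd
  obtain ⟨C, C0, hC⟩ := dflux_bd hl hr M
  have := bal_lim (e0 := sol.u) (q := fun y t => dflux fl fr y (sol.u y t)) (qp := fun y t => dflux fl fr y (sol.up y t))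
    sol.meas ((dflux_meas hl.cont.measurable hr.cont.measurable).comp (measurable_fst.prodMk sol.meas)) hM
    (fun y t => hC _ _ (hM y t)) sol.timeCont (fun x t h => dflux_up hl hr (sol.up_spec x t h)) hx h1 ht
  refine tendsto_nhds_unique this (tendsto_const_nhds.congr fun n => ?_)
  exact (sol.weak (fun x t => chi n x1 x2 x * chi n t1 t2 t) (chi2_cd n x1 x2 t1 t2) (chi2_supp n hx ht)
    (fun x t h => by simp [chi_lt n ht (h.trans h1)])).symm
end


lemma fub_t {P : Pl → Prop} (hP : MeasurableSet {p | P p}) (h : ∀ t : ℝ, ∀ᵐ x : ℝ, P (x, t)) : ∀ᵐ p, P p := by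
  rw [Measure.volume_eq_prod, Measure.ae_prod_iff_ae_ae hP,
    Measure.ae_ae_comm (p := fun x y => P (x, y)) hP]
  exact Eventually.of_forall h
lemma fub_x {P : Pl → Prop} (hP : MeasurableSet {p | P p}) (h : ∀ x : ℝ, ∀ᵐ t : ℝ, P (x, t)) : ∀ᵐ p, P p := by
  rw [Measure.volume_eq_prod, Measure.ae_prod_iff_ae_ae hP]
  exact Eventually.of_forall h
lemma hd_x {φ : Pl → ℝ} {p : Pl} (h : DifferentiableAt ℝ φ p) : HasDerivAt (fun y => φ (y, p.2)) (dX φ p) p.1 := by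
  have h' : HasFDerivAt φ (fderiv ℝ φ p) (p.1, p.2) := h.hasFDerivAt
  exact h'.comp_hasDerivAt p.1 ((hasDerivAt_id p.1).prodMk (hasDerivAt_const p.1 p.2))
lemma hd_t {φ : Pl → ℝ} {p : Pl} (h : DifferentiableAt ℝ φ p) : HasDerivAt (fun s => φ (p.1, s)) (dT φ p) p.2 := by
  have h' : HasFDerivAt φ (fderiv ℝ φ p) (p.1, p.2) := h.hasFDerivAt
  exact h'.comp_hasDerivAt p.2 ((hasDerivAt_const p.2 p.1).prodMk (hasDerivAt_id p.2))
lemma ent_iff {g1 g2 φ : Pl → ℝ} (h : ContDiff ℝ 1 φ) :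
    ∫ p : Pl, (g1 p * deriv (fun s => φ (p.1, s)) p.2 + g2 p * deriv (fun y => φ (y, p.2)) p.1) =
    ∫ p, (g1 p * dT φ p + g2 p * dX φ p) := by
  refine integral_congr_ae (Eventually.of_forall fun p => ?_)
  have d := h.differentiable (by simp) p
  simp only [(hd_x d).deriv, (hd_t d).deriv]
lemma sgn_minmax {f : ℝ → ℝ} {u k : ℝ} : Real.sign (u - k) * (f u - f k) = f (max u k) - f (min u k) := by
  rcases lt_trichotomy u k with h | h | h
  · rw [Real.sign_of_neg (by linarith), max_eq_right h.le, min_eq_left h.le]; ring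
  · simp [h]
  · rw [Real.sign_of_pos (by linarith), max_eq_left h.le, min_eq_right h.le]; ring
lemma chi_nn (n : ℕ) {x y : ℝ} (h : x ≤ y) (z : ℝ) : 0 ≤ chi n x y z := by
  have : rr n (z - y) ≤ rr n (z - x) := Real.smoothTransition.monotone (by
    have : ((n : ℝ) + 1) * (z - y) ≤ ((n : ℝ) + 1) * (z - x) := by gcongr
    linarith)
  unfold chi; linarith

section
variable {a A B : ℝ} {fl fr u0 : ℝ → ℝ}

lemma upm_meas (sol : ABSol fl fr A B u0) : Measurable fun p : Pl => if 0 < p.2 then sol.up p.1 p.2 else 0 := by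
  have hs : MeasurableSet {p : Pl | 0 < p.2} := measurableSet_lt measurable_const measurable_snd
  refine measurable_of_tendsto_metrizable (f := fun (n : ℕ) (p : Pl) => if 0 < p.2 then sol.u (p.1 + (0 + 1) / ((n : ℝ) + 1)) p.2 else 0)
    (fun n => Measurable.ite hs (sol.meas.comp (by fun_prop : Measurable fun p : Pl => (p.1 + (0 + 1) / ((n : ℝ) + 1), p.2))) measurable_const) ?_
  rw [tendsto_pi_nhds]
  intro p
  by_cases hp : 0 < p.2
  · simp only [hp, if_true]
    exact (sol.up_spec p.1 p.2 hp).comp (sarg (by simp) p.1)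
  · simp [hp]

lemma up_bd (sol : ABSol fl fr A B u0) {M : ℝ} (hM : ∀ x t, |sol.u x t| ≤ M) {x t : ℝ} (ht : 0 < t) : |sol.up x t| ≤ M :=
  le_of_tendsto (sol.up_spec x t ht).abs (Eventually.of_forall fun y => hM y t)

def Fm (sol : ABSol fl fr A B u0) (x t : ℝ) : ℝ := dflux fl fr x (if 0 < t then sol.up x t else 0)
lemma Fm_meas (hl : UC a fl) (hr : UC a fr) (sol : ABSol fl fr A B u0) : Measurable fun p : Pl => Fm sol p.1 p.2 :=
  (dflux_meas hl.cont.measurable hr.cont.measurable).comp (measurable_fst.prodMk (upm_meas sol))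
lemma Fm_bd (hl : UC a fl) (hr : UC a fr) (sol : ABSol fl fr A B u0) : ∃ C, 0 ≤ C ∧ ∀ x t, |Fm sol x t| ≤ C := by
  obtain ⟨M, hM⟩ := sol.bdd
  obtain ⟨C, C0, hC⟩ := dflux_bd hl hr M
  refine ⟨C, C0, fun x t => hC _ _ ?_⟩
  split_ifs with h
  · exact up_bd sol hM h
  · simpa using (abs_nonneg _).trans (hM 0 0)
lemma bdd_ii {g : ℝ → ℝ} (hg : Measurable g) {C : ℝ} (hC : ∀ x, |g x| ≤ C) (x y : ℝ) : IntervalIntegrable g volume x y :=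
  ((intervalIntegrable_const (c := C))).mono_fun' hg.aestronglyMeasurable (Eventually.of_forall hC)
lemma bdd_li {g : ℝ → ℝ} (hg : Measurable g) {C : ℝ} (hC : ∀ x, |g x| ≤ C) : LocallyIntegrable g volume :=
  (locallyIntegrable_const C).mono hg.aestronglyMeasurable (Eventually.of_forall fun x => (hC x).trans (le_abs_self C))
lemma bdd_lip {g : ℝ → ℝ} (hg : Measurable g) {C : ℝ} (hC : ∀ x, |g x| ≤ C) : LipschitzWith C.toNNReal fun x => ∫ y in (0:ℝ)..x, g y := by
  have C0 : 0 ≤ C := (abs_nonneg _).trans (hC 0)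
  refine LipschitzWith.of_dist_le_mul fun x y => ?_
  rw [Real.dist_eq, Real.dist_eq, intervalIntegral.integral_interval_sub_left (bdd_ii hg hC _ _) (bdd_ii hg hC _ _), Real.coe_toNNReal _ C0]
  exact intervalIntegral.norm_integral_le_of_norm_le_const (f := g) (C := C) (fun z _ => hC z)

lemma balance' (hl : UC a fl) (hr : UC a fr) (sol : ABSol fl fr A B u0) (x : ℝ) {t1 t2 : ℝ} (h1 : 0 ≤ t1) (ht : t1 ≤ t2) :
    (∫ y in (0:ℝ)..x, sol.u y t1) - (∫ y in (0:ℝ)..x, sol.u y t2) + ((∫ t in t1..t2, Fm sol 0 t) - ∫ t in t1..t2, Fm sol x t) = 0 := by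
  obtain ⟨C, C0, hC⟩ := Fm_bd hl hr sol
  have mF : ∀ x, Measurable (Fm sol x) := fun x => (Fm_meas hl hr sol).comp (measurable_const.prodMk measurable_id)
  have key : ∀ x y, x ≤ y → (∫ z in x..y, sol.u z t1) - (∫ z in x..y, sol.u z t2) + ((∫ t in t1..t2, Fm sol x t) - ∫ t in t1..t2, Fm sol y t) = 0 := by
    intro x y hxy
    rw [← balance hl hr sol hxy h1 ht, ← intervalIntegral.integral_sub (bdd_ii (mF x) (hC x) _ _) (bdd_ii (mF y) (hC y) _ _)]
    congr 1
    refine intervalIntegral.integral_congr_ae (Eventually.of_forall fun t htt => ?_)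
    rw [uIoc_of_le ht] at htt
    have : 0 < t := lt_of_le_of_lt h1 htt.1
    simp [Fm, this]
  rcases le_total 0 x with h | h
  · exact key 0 x h
  · rw [intervalIntegral.integral_symm, intervalIntegral.integral_symm (f := fun y => sol.u y t2)]
    linarith [key x 0 h]

def Us (sol : ABSol fl fr A B u0) (p : Pl) : ℝ := (∫ y in (0:ℝ)..p.1, sol.u y (max p.2 0)) - ∫ s in (0:ℝ)..(max p.2 0), Fm sol 0 s

lemma Us_t (hl : UC a fl) (hr : UC a fr) (sol : ABSol fl fr A B u0) (x t : ℝ) :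
    Us sol (x, t) = Us sol (x, 0) - ∫ s in (0:ℝ)..(max t 0), Fm sol x s := by
  have := balance' hl hr sol x le_rfl (le_max_right t 0)
  simp only [Us, max_self, intervalIntegral.integral_same]
  linarith

lemma Us_lip (hl : UC a fl) (hr : UC a fr) (sol : ABSol fl fr A B u0) : ∃ K, LipschitzWith K (Us sol) := by
  obtain ⟨M, hM⟩ := sol.bdd
  obtain ⟨C, C0, hC⟩ := Fm_bd hl hr sol
  refine ⟨M.toNNReal + C.toNNReal, ?_⟩
  refine LipschitzWith.uncurry (f := fun x t => Us sol (x, t)) (fun t => ?_) (fun x => ?_)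
  · refine LipschitzWith.of_dist_le_mul fun x y => ?_
    have := (bdd_lip (g := fun y => sol.u y (max t 0)) (sol.meas.comp (measurable_id.prodMk measurable_const)) (fun y => hM y _)).dist_le_mul x y
    simpa [Us, Real.dist_eq] using this
  · refine LipschitzWith.of_dist_le_mul fun s t => ?_
    have := (bdd_lip ((Fm_meas hl hr sol).comp (measurable_const.prodMk measurable_id : Measurable fun t : ℝ => (x, t))) (hC x)).dist_le_mul (max t 0) (max s 0)
    rw [Us_t hl hr, Us_t hl hr sol x t]
    simp only [Real.dist_eq, Function.comp_def] at this ⊢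
    rw [sub_sub_sub_cancel_left]
    refine this.trans ?_
    rw [abs_sub_comm]
    exact mul_le_mul_of_nonneg_left (abs_max_sub_max_le_abs _ _ _) (by positivity)

lemma Us_pde (hl : UC a fl) (hr : UC a fr) (sol : ABSol fl fr A B u0) :
    ∀ᵐ p : Pl, 0 < p.2 → dX (Us sol) p = sol.u p.1 p.2 ∧ dT (Us sol) p = -dflux fl fr p.1 (sol.u p.1 p.2) := by
  obtain ⟨M, hM⟩ := sol.bdd
  obtain ⟨C, C0, hC⟩ := Fm_bd hl hr sol
  obtain ⟨K, hK⟩ := Us_lip hl hr sol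
  have mu : ∀ t, Measurable fun y => sol.u y t := fun t => sol.meas.comp (measurable_id.prodMk measurable_const)
  have hs : MeasurableSet {p : Pl | 0 < p.2} := measurableSet_lt measurable_const measurable_snd
  have hd : MeasurableSet {p : Pl | DifferentiableAt ℝ (Us sol) p} := measurableSet_of_differentiableAt ℝ _
  have u1 : ∀ᵐ p : Pl, 0 < p.2 ∧ DifferentiableAt ℝ (Us sol) p → dX (Us sol) p = sol.u p.1 p.2 := by
    refine fub_t ((hs.inter hd).compl.union (measurableSet_eq_fun (dX_meas (Us sol)) sol.meas) |>.congr ?_) (fun t => ?_)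
    · ext p; simp [imp_iff_not_or, Function.uncurry]
    · filter_upwards [LocallyIntegrable.ae_hasDerivAt_integral (bdd_li (mu t) (fun y => hM y t))] with x hx hp
      have h1 := hd_x hp.2
      have ht : max t 0 = t := max_eq_left hp.1.le
      have h2 := (hx 0).sub_const (∫ s in (0:ℝ)..t, Fm sol 0 s)
      simp only [Us, ht] at h1
      exact h1.unique h2
  have u2 : ∀ᵐ p : Pl, 0 < p.2 ∧ DifferentiableAt ℝ (Us sol) p → dT (Us sol) p = - Fm sol p.1 p.2 := by
    refine fub_x ((hs.inter hd).compl.union (measurableSet_eq_fun (dT_meas (Us sol)) (Fm_meas hl hr sol).neg) |>.congr ?_) (fun x => ?_)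
    · ext p; simp [imp_iff_not_or]
    · filter_upwards [LocallyIntegrable.ae_hasDerivAt_integral (bdd_li ((Fm_meas hl hr sol).comp (measurable_const.prodMk measurable_id : Measurable fun t : ℝ => (x, t))) (hC x))] with t hx hp
      have h1 := hd_t hp.2
      have h2 := (hx 0).const_sub (Us sol (x, 0))
      refine h1.unique (h2.congr_of_eventuallyEq ?_)
      filter_upwards [lt_mem_nhds hp.1] with s hs
      have hs : 0 < s := hs
      simp only [Us_t hl hr sol x s, max_eq_left hs.le]; rfl
  have u3 : ∀ᵐ p : Pl, 0 < p.2 → (if 0 < p.2 then sol.up p.1 p.2 else 0) = sol.u p.1 p.2 := by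
    refine fub_t (hs.compl.union (measurableSet_eq_fun (upm_meas sol) sol.meas) |>.congr ?_) (fun t => ?_)
    · ext p; simp [imp_iff_not_or, Function.uncurry]
    · filter_upwards [LocallyIntegrable.ae_hasDerivAt_integral (bdd_li (mu t) (fun y => hM y t))] with x hx ht
      simp only [ht, if_true]
      have h2 := intervalIntegral.integral_hasDerivWithinAt_of_tendsto_ae_right (s := Ici x) (t := Ioi x) (bdd_ii (mu t) (fun y => hM y t) 0 x)
        (mu t).stronglyMeasurable.stronglyMeasurableAtFilter ((sol.up_spec x t ht).mono_left inf_le_left)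
      exact (uniqueDiffWithinAt_Ici x).eq_deriv _ h2 (hx 0).hasDerivWithinAt
  filter_upwards [u1, u2, u3, hK.ae_differentiableAt] with p h1 h2 h3 h4 hp
  refine ⟨h1 ⟨hp, h4⟩, ?_⟩
  rw [h2 ⟨hp, h4⟩, Fm, h3 hp]

lemma Us_kr (sol : ABSol fl fr A B u0) (k : ℝ) : EntOn quad (fun p => |sol.u p.1 p.2 - k|)
    (fun p => Real.sign (sol.u p.1 p.2 - k) * (fr (sol.u p.1 p.2) - fr k)) := by
  intro φ h1 h2 h3 h4
  rw [← ent_iff h1]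
  refine sol.kruzkov_r k (fun x t => φ (x, t)) h1 h2 (fun x t => h3 _) fun x t hx => image_eq_zero_of_notMem_tsupport fun hm => ?_
  have := h4 hm
  rcases hx with hx | hx
  · exact absurd this.1 (not_lt.2 hx)
  · exact absurd this.2 (not_lt.2 hx)
lemma Us_kl (sol : ABSol fl fr A B u0) (k : ℝ) : EntOn {p | p.1 < 0 ∧ 0 < p.2} (fun p => |sol.u p.1 p.2 - k|)
    (fun p => Real.sign (sol.u p.1 p.2 - k) * (fl (sol.u p.1 p.2) - fl k)) := by
  intro φ h1 h2 h3 h4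
  rw [← ent_iff h1]
  refine sol.kruzkov_l k (fun x t => φ (x, t)) h1 h2 (fun x t => h3 _) fun x t hx => image_eq_zero_of_notMem_tsupport fun hm => ?_
  have := h4 hm
  rcases hx with hx | hx
  · exact absurd this.1 (not_lt.2 hx)
  · exact absurd this.2 (not_lt.2 hx)
lemma Us_ie (sol : ABSol fl fr A B u0) : EntOn {p | 0 < p.2} (fun p => |sol.u p.1 p.2 - cAB A B p.1|)
    (fun p => Real.sign (sol.u p.1 p.2 - cAB A B p.1) * (dflux fl fr p.1 (sol.u p.1 p.2) - dflux fl fr p.1 (cAB A B p.1))) := by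
  intro φ h1 h2 h3 h4
  rw [← ent_iff h1]
  refine sol.interfaceEntropy (fun x t => φ (x, t)) h1 h2 (fun x t => h3 _) fun x t hx => image_eq_zero_of_notMem_tsupport fun hm => ?_
  exact absurd (h4 hm) (not_lt.2 hx)

lemma UC.ge_left (h : UC a fl) (hA : deriv fl A ≤ 0) {p : ℝ} (hp : p ≤ A) : fl A ≤ fl p := by
  nlinarith [h.tangent A p, h.pos, sq_nonneg (p - A), mul_nonneg (neg_nonneg.2 hA) (sub_nonneg.2 hp)]
lemma UC.ge_right (h : UC a fr) (hB : 0 ≤ deriv fr B) {p : ℝ} (hp : B ≤ p) : fr B ≤ fr p := by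
  nlinarith [h.tangent B p, h.pos, sq_nonneg (p - B), mul_nonneg hB (sub_nonneg.2 hp)]

def cR (A B x : ℝ) : ℝ := if x < 0 then A else B
def Qm (sol : ABSol fl fr A B u0) (x t : ℝ) : ℝ :=
  dflux fl fr x (max (if 0 < t then sol.up x t else 0) (cR A B x)) - dflux fl fr x (min (if 0 < t then sol.up x t else 0) (cR A B x))

lemma c_lim (x : ℝ) : Tendsto (cAB A B) (𝓝[>] x) (𝓝 (cR A B x)) := by
  by_cases hx : x < 0
  · refine tendsto_const_nhds.congr' ?_
    filter_upwards [mem_nhdsWithin_of_mem_nhds (gt_mem_nhds hx)] with y hy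
    have hy : y < 0 := hy
    simp [cR, cAB, hx, hy.le]
  · refine tendsto_const_nhds.congr' ?_
    filter_upwards [self_mem_nhdsWithin] with y hy
    have hy : x < y := hy
    simp [cR, cAB, hx, not_le.2 (lt_of_le_of_lt (not_lt.1 hx) hy)]

lemma Us_anti (hl : UC a fl) (hr : UC a fr) (hAB : fl A = fr B) (hA : deriv fl A ≤ 0) (hB : 0 ≤ deriv fr B)
    (sol : ABSol fl fr A B u0) (t1 t2 : ℝ) (h1 : 0 ≤ t1) (ht : t1 ≤ t2) :
    Us sol (0, t2) + fr B * t2 ≤ Us sol (0, t1) + fr B * t1 := by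
  obtain ⟨M, hM⟩ := sol.bdd
  have M0 : 0 ≤ M := (abs_nonneg _).trans (hM 0 0)
  set R := M + |A| + |B|
  have hR : ∀ x, |cAB A B x| ≤ |A| + |B| := fun x => by unfold cAB; split_ifs <;> simp
  obtain ⟨D, D0, hD⟩ := dflux_bd hl hr R
  obtain ⟨C, C0, hC⟩ := Fm_bd hl hr sol
  obtain ⟨K, hK⟩ := Us_lip hl hr sol
  have mdf := dflux_meas hl.cont.measurable hr.cont.measurable
  have mc : Measurable fun p : Pl => cAB A B p.1 := (cAB_meas A B).comp measurable_fst
  have me : Measurable fun p : Pl => |sol.u p.1 p.2 - cAB A B p.1| := (sol.meas.sub mc).abs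
  have bm : ∀ {x y : ℝ}, |x| ≤ R → |y| ≤ R → |max x y| ≤ R ∧ |min x y| ≤ R := fun {x y} hx hy =>
    ⟨abs_max_le_max_abs_abs.trans (max_le hx hy), abs_min_le_max_abs_abs.trans (max_le hx hy)⟩
  have bu : ∀ x t, |sol.u x t| ≤ R := fun x t => by have := hM x t; have := abs_nonneg A; have := abs_nonneg B; simp only [R]; linarith
  have bc : ∀ x, |cAB A B x| ≤ R := fun x => by have := hR x; simp only [R]; linarith
  have be : ∀ x t, |(|sol.u x t - cAB A B x|)| ≤ R := fun x t => by
    rw [abs_abs]; exact (abs_sub _ _).trans (by have := hR x; have := hM x t; simp only [R]; linarith)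
  have hlim := fun (δ : ℝ) (hδ : -δ ≤ δ) => bal_lim (e0 := fun x t => |sol.u x t - cAB A B x|)
    (q := fun x t => dflux fl fr x (max (sol.u x t) (cAB A B x)) - dflux fl fr x (min (sol.u x t) (cAB A B x)))
    (qp := Qm sol) (M := R) (C := D + D) me
    ((mdf.comp (measurable_fst.prodMk (sol.meas.max mc))).sub (mdf.comp (measurable_fst.prodMk (sol.meas.min mc)))) be
    (fun x t => (abs_sub _ _).trans (add_le_add (hD _ _ (bm (bu x t) (bc x)).1) (hD _ _ (bm (bu x t) (bc x)).2))) (fun r t₀ h => by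
      refine squeeze_zero (fun t => integral_nonneg fun _ => abs_nonneg _) (fun t => ?_) (sol.timeCont r t₀ h)
      have ms : ∀ t, Measurable fun y => sol.u y t := fun t => sol.meas.comp (measurable_id.prodMk measurable_const)
      have mm : ∀ t, Measurable fun y => |sol.u y t - cAB A B y| := fun t => ((ms t).sub (cAB_meas A B)).abs
      refine integral_mono ?_ ?_ fun x => ?_
      · refine Measure.integrableOn_of_bounded (M := R + R) (by simp) ((mm _).sub (mm _)).abs.aestronglyMeasurable
          (Eventually.of_forall fun y => ?_)
        rw [Real.norm_eq_abs, abs_abs]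
        exact (abs_sub _ _).trans (add_le_add (be _ _) (be _ _))
      · refine Measure.integrableOn_of_bounded (M := M + M) (by simp) ((ms _).sub (ms _)).abs.aestronglyMeasurable
          (Eventually.of_forall fun y => ?_)
        rw [Real.norm_eq_abs, abs_abs]
        exact (abs_sub _ _).trans (add_le_add (hM _ _) (hM _ _))
      · have := abs_abs_sub_abs_le (sol.u x t - cAB A B x) (sol.u x t₀ - cAB A B x)
        rwa [sub_sub_sub_cancel_right] at this) (fun x t htp => by
      have l1 := (sol.up_spec x t htp).max (c_lim (A := A) (B := B) x)
      have l2 := (sol.up_spec x t htp).min (c_lim (A := A) (B := B) x)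
      simp only [Qm, htp, if_true]
      exact (dflux_up hl hr l1).sub (dflux_up hl hr l2)) hδ h1 ht
  have key : ∀ δ > 0, Us sol (0, t2) + fr B * t2 ≤ Us sol (0, t1) + fr B * t1 + (2 * R + 2 * K) * δ := by
    intro δ hδ
    have g0 := ge_of_tendsto' (hlim δ (by linarith)) (b := 0) (fun n => by
      have := sol.interfaceEntropy (fun x t => chi n (-δ) δ x * chi n t1 t2 t) (chi2_cd n _ _ _ _)
        (chi2_supp n (by linarith) ht) (fun x t => mul_nonneg (chi_nn n (by linarith) _) (chi_nn n ht _))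
        (fun x t h => by simp [chi_lt n ht (h.trans h1)])
      simpa only [sgn_minmax (f := dflux fl fr _)] using this)
    have g1 : ∀ t, |∫ y in (-δ)..δ, (|sol.u y t - cAB A B y|)| ≤ R * (2 * δ) := fun t => by
      have := intervalIntegral.norm_integral_le_of_norm_le_const (a := -δ) (b := δ) (f := fun y => |sol.u y t - cAB A B y|) (C := R) (fun z _ => be z t)
      rw [show δ - -δ = 2 * δ by ring, abs_of_pos (by linarith : 0 < 2 * δ)] at this
      exact this
    have mF : ∀ x, Measurable (Fm sol x) := fun x => (Fm_meas hl hr sol).comp (measurable_const.prodMk measurable_id)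
    have mp : ∀ x, Measurable fun t => if 0 < t then sol.up x t else 0 := fun x => (upm_meas sol).comp (measurable_const.prodMk measurable_id)
    have mQ : ∀ x, Measurable (Qm sol x) := fun x =>
      (mdf.comp (measurable_const.prodMk ((mp x).max measurable_const))).sub (mdf.comp (measurable_const.prodMk ((mp x).min measurable_const)))
    have bp : ∀ x t, |if 0 < t then sol.up x t else 0| ≤ R := fun x t => by
      split_ifs with h
      · have := up_bd sol hM h (x := x); have := abs_nonneg A; have := abs_nonneg B; simp only [R]; linarith
      · have := abs_nonneg A; have := abs_nonneg B; simp only [R, abs_zero]; linarith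
    have bR : ∀ x, |cR A B x| ≤ R := fun x => by
      unfold cR; have := abs_nonneg A; have := abs_nonneg B; simp only [R]; split_ifs <;> linarith
    have bQ : ∀ x t, |Qm sol x t| ≤ D + D := fun x t => (abs_sub _ _).trans (add_le_add (hD _ _ (bm (bp x t) (bR x)).1) (hD _ _ (bm (bp x t) (bR x)).2))
    have g2 : ∫ t in t1..t2, (Qm sol (-δ) t - Qm sol δ t) ≤ ∫ t in t1..t2, ((Fm sol (-δ) t + Fm sol δ t) - 2 * fr B) := by
      refine intervalIntegral.integral_mono_on ht ((bdd_ii (mQ _) (bQ _) _ _).sub (bdd_ii (mQ _) (bQ _) _ _))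
        (((bdd_ii (mF _) (hC _) _ _).add (bdd_ii (mF _) (hC _) _ _)).sub intervalIntegrable_const) fun t _ => ?_
      simp only [Qm, Fm, dflux, cR, show -δ < 0 by linarith, show ¬ δ < 0 by linarith, if_true, if_false]
      generalize (if 0 < t then sol.up (-δ) t else 0) = p
      generalize (if 0 < t then sol.up δ t else 0) = q
      have e1 : fl (max p A) - fl (min p A) ≤ fl p - fr B := by
        rcases le_total p A with h | h
        · rw [max_eq_right h, min_eq_left h]; have := hl.ge_left hA h; linarith
        · rw [max_eq_left h, min_eq_right h]; linarith
      have e2 : fr (min q B) - fr (max q B) ≤ fr q - fr B := by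
        rcases le_total q B with h | h
        · rw [max_eq_right h, min_eq_left h]
        · rw [max_eq_left h, min_eq_right h]; have := hr.ge_right hB h; linarith
      linarith
    rw [intervalIntegral.integral_sub (((bdd_ii (mF _) (hC _) _ _).add (bdd_ii (mF _) (hC _) _ _))) intervalIntegrable_const,
      intervalIntegral.integral_add (bdd_ii (mF _) (hC _) _ _) (bdd_ii (mF _) (hC _) _ _), intervalIntegral.integral_const, smul_eq_mul] at g2
    have g3 : ∀ x, ∫ t in t1..t2, Fm sol x t = Us sol (x, t1) - Us sol (x, t2) := fun x => by
      rw [Us_t hl hr sol x t1, Us_t hl hr sol x t2, max_eq_left h1, max_eq_left (h1.trans ht), sub_sub_sub_cancel_left,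
        intervalIntegral.integral_interval_sub_left (bdd_ii (mF _) (hC _) _ _) (bdd_ii (mF _) (hC _) _ _)]
    rw [g3, g3] at g2
    have k1 := abs_le.1 (lip_x hK (-δ) 0 t1)
    have k2 := abs_le.1 (lip_x hK (-δ) 0 t2)
    have k3 := abs_le.1 (lip_x hK δ 0 t1)
    have k4 := abs_le.1 (lip_x hK δ 0 t2)
    rw [sub_zero, abs_neg, abs_of_pos hδ] at k1 k2
    rw [sub_zero, abs_of_pos hδ] at k3 k4
    have := abs_le.1 (g1 t1)
    have := abs_le.1 (g1 t2)
    linarith [g0, g2]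
  have h0 : Tendsto (fun δ : ℝ => Us sol (0, t1) + fr B * t1 + (2 * R + 2 * K) * δ) (𝓝[>] 0) (𝓝 (Us sol (0, t1) + fr B * t1 + (2 * R + 2 * K) * 0)) :=
    (Continuous.tendsto (by fun_prop) 0).mono_left nhdsWithin_le_nhds
  rw [mul_zero, add_zero] at h0
  exact ge_of_tendsto h0 (by filter_upwards [self_mem_nhdsWithin] with δ hδ using key δ hδ)

lemma left_half {f : ℝ → ℝ} {U u : Pl → ℝ} (lip : ∃ K, LipschitzWith K U) (mu : Measurable u) (bd : ∃ M, ∀ p, |u p| ≤ M)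
    (pde : ∀ᵐ p : Pl, p.1 < 0 ∧ 0 < p.2 → dX U p = u p ∧ dT U p = -f (u p))
    (kr : ∀ k, EntOn {p | p.1 < 0 ∧ 0 < p.2} (fun p => |u p - k|) (fun p => Real.sign (u p - k) * (f (u p) - f k))) :
    HalfPot (fun p => f (-p)) (fun p => U (rf p)) (fun p => -u (rf p)) := by
  obtain ⟨K, hK⟩ := lip
  obtain ⟨M, hM⟩ := bd
  refine ⟨⟨K, lip_rf hK⟩, (mu.comp rf.continuous.measurable).neg, ⟨M, fun p => by rw [abs_neg]; exact hM _⟩, ?_, fun k => ?_⟩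
  · filter_upwards [ae_rf pde] with p hp hq
    have := hp ⟨by simpa [rf_apply] using hq.1, by simpa [rf_apply] using hq.2⟩
    rw [dX_rf, dT_rf, this.1, this.2, neg_neg]; simp
  · have := ent_rf (kr (-k))
    have e : rf ⁻¹' {p : Pl | p.1 < 0 ∧ 0 < p.2} = quad := by ext p; simp [rf_apply, quad]
    rw [e] at this
    convert this using 2 with p p
    · rw [← abs_neg]; congr 1; ring
    · rw [show -u (rf p) - k = -(u (rf p) - -k) by ring, Real.sign_neg, neg_neg]; ring

theorem sol_pot (hl : UC a fl) (hr : UC a fr) (hAB : fl A = fr B) (hA : deriv fl A ≤ 0) (hB : 0 ≤ deriv fr B)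
    (sol : ABSol fl fr A B u0) : Pot fl fr A B (Us sol) (fun p => sol.u p.1 p.2) := by
  obtain ⟨M, hM⟩ := sol.bdd
  have pde := Us_pde hl hr sol
  refine ⟨⟨Us_lip hl hr sol, sol.meas, ⟨M, fun p => hM _ _⟩, ?_, Us_kr sol⟩, left_half (Us_lip hl hr sol) sol.meas ⟨M, fun p => hM _ _⟩ ?_ (Us_kl sol),
    Us_ie sol, fun s t => Us_anti hl hr hAB hA hB sol s t⟩
  · filter_upwards [pde] with p hp hq
    have := hp hq.2
    rwa [show dflux fl fr p.1 (sol.u p.1 p.2) = fr (sol.u p.1 p.2) from if_neg (not_lt.2 (le_of_lt hq.1))] at this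
  · filter_upwards [pde] with p hp hq
    have := hp hq.2
    rwa [show dflux fl fr p.1 (sol.u p.1 p.2) = fl (sol.u p.1 p.2) from if_pos hq.1] at this

lemma Us_zero (sol : ABSol fl fr A B u0) (x : ℝ) : Us sol (x, 0) = ∫ y in (0:ℝ)..x, u0 y := by
  simp only [Us, max_self, intervalIntegral.integral_same, sub_zero]
  refine intervalIntegral.integral_congr_ae ?_
  filter_upwards [sol.init] with y hy _ using hy
lemma Us_T (sol : ABSol fl fr A B u0) {T : ℝ} (hT : 0 ≤ T) : ∃ c, ∀ x, Us sol (x, T) = (∫ y in (0:ℝ)..x, sol.u y T) + c :=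
  ⟨-∫ s in (0:ℝ)..T, Fm sol 0 s, fun x => by simp only [Us, max_eq_left hT]; ring⟩
end


def psi (g i : ℝ → ℝ) (x t p : ℝ) : ℝ := p * x - g p * t + i p
def AM (g i : ℝ → ℝ) (lo hi x t p : ℝ) : Prop := p ∈ Icc lo hi ∧ ∀ q ∈ Icc lo hi, psi g i x t q ≤ psi g i x t p

structure Fam (Z : Type) [TopologicalSpace Z] where
  g : ℝ → ℝ
  gc : Continuous g
  lo : Z → ℝ
  loc : Continuous lo
  pl : ℝ
  hi : ℝ
  hlo : ∀ z, pl ≤ lo z ∧ lo z ≤ hi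
  i : Z → ℝ → ℝ
  ic : Continuous fun q : Z × ℝ => i q.1 q.2
  a : Z → ℝ
  ac : Continuous a
  coer : ∀ R, ∃ K : Set Z, IsCompact K ∧ ∃ z0 ∈ K, ∀ x t, |x| ≤ R → |t| ≤ R → ∀ z ∉ K, ∃ p ∈ Icc (lo z) hi,
    ∀ q ∈ Icc (lo z0) hi, a z0 + psi g (i z0) x t q < a z + psi g (i z) x t p
  uniq : ∀ z x t p q, 0 ≤ x → 0 < t → AM g (i z) (lo z) hi x t p → AM g (i z) (lo z) hi x t q → p = q
  kap : ℝ
  kpos : 0 < kap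
  strong : ∀ z x t p q, 0 < x → 0 < t → AM g (i z) (lo z) hi x t p → q ∈ Icc (lo z) hi →
    psi g (i z) x t q ≤ psi g (i z) x t p - kap * min x t * (q - p) ^ 2
  Lam : ℝ
  Lpos : 0 ≤ Lam
  glip : ∀ p ∈ Icc pl hi, ∀ q ∈ Icc pl hi, |g p - g q| ≤ Lam * |p - q|

namespace Fam
variable {Z : Type} [TopologicalSpace Z] (F : Fam Z)

def ps (z : Z) (x t p : ℝ) : ℝ := psi F.g (F.i z) x t p
def am (z : Z) (x t p : ℝ) : Prop := AM F.g (F.i z) (F.lo z) F.hi x t p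
def c (z : Z) (x t : ℝ) : ℝ := sSup ((fun q => F.ps z x t (max q (F.lo z))) '' Icc F.pl F.hi)

lemma ps_cont : Continuous fun q : (Z × ℝ × ℝ) × ℝ => F.ps q.1.1 q.1.2.1 q.1.2.2 q.2 := by
  have h1 := F.ic.comp (by fun_prop : Continuous fun q : (Z × ℝ × ℝ) × ℝ => (q.1.1, q.2))
  have h2 := F.gc.comp (by fun_prop : Continuous fun q : (Z × ℝ × ℝ) × ℝ => q.2)
  unfold ps psi
  exact ((by fun_prop : Continuous fun q : (Z × ℝ × ℝ) × ℝ => q.2 * q.1.2.1).sub (h2.mul (by fun_prop))).add h1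
lemma hpl (z : Z) : F.pl ≤ F.hi := (F.hlo z).1.trans (F.hlo z).2
lemma c_cont : Continuous fun q : Z × ℝ × ℝ => F.c q.1 q.2.1 q.2.2 := by
  have := F.loc
  exact IsCompact.continuous_sSup (f := fun (q : Z × ℝ × ℝ) p => F.ps q.1 q.2.1 q.2.2 (max p (F.lo q.1))) isCompact_Icc
    (F.ps_cont.comp (by fun_prop : Continuous fun q : (Z × ℝ × ℝ) × ℝ => (q.1, max q.2 (F.lo q.1.1))))
lemma ps_cont1 (z : Z) (x t : ℝ) : Continuous (F.ps z x t) :=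
  F.ps_cont.comp (by fun_prop : Continuous fun p : ℝ => ((z, x, t), p))
lemma le_c {z : Z} {x t p : ℝ} (hp : p ∈ Icc (F.lo z) F.hi) : F.ps z x t p ≤ F.c z x t := by
  refine le_csSup ((isCompact_Icc.image ((F.ps_cont1 z x t).comp (by fun_prop : Continuous fun q : ℝ => max q (F.lo z)))).bddAbove)
    ⟨p, ⟨(F.hlo z).1.trans hp.1, hp.2⟩, by simp [max_eq_left hp.1]⟩
lemma am_ex (z : Z) (x t : ℝ) : ∃ p, F.am z x t p := by
  obtain ⟨p, hp, h⟩ := isCompact_Icc.exists_isMaxOn (nonempty_Icc.2 (F.hlo z).2) (F.ps_cont1 z x t).continuousOn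
  exact ⟨p, hp, fun q hq => h hq⟩
lemma am_val {z : Z} {x t p : ℝ} (h : F.am z x t p) : F.c z x t = F.ps z x t p := by
  refine le_antisymm (csSup_le ((nonempty_Icc.2 (F.hpl z)).image _) ?_) (F.le_c h.1)
  rintro _ ⟨q, hq, rfl⟩
  exact h.2 _ ⟨le_max_right _ _, max_le hq.2 (F.hlo z).2⟩
lemma am_iff {z : Z} {x t p : ℝ} : F.am z x t p ↔ p ∈ Icc (F.lo z) F.hi ∧ F.c z x t = F.ps z x t p :=
  ⟨fun h => ⟨h.1, F.am_val h⟩, fun h => ⟨h.1, fun q hq => (F.le_c hq).trans h.2.le⟩⟩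
lemma mem_pl {z : Z} {x t p : ℝ} (h : F.am z x t p) : p ∈ Icc F.pl F.hi := ⟨(F.hlo z).1.trans h.1.1, h.1.2⟩
lemma ps_shift (z : Z) (x t x' t' p : ℝ) : F.ps z x' t' p = F.ps z x t p + p * (x' - x) - F.g p * (t' - t) := by
  simp only [ps, psi]; ring
lemma c_lower {z : Z} {x t p : ℝ} (h : F.am z x t p) (x' t' : ℝ) :
    F.c z x t + p * (x' - x) - F.g p * (t' - t) ≤ F.c z x' t' := by
  rw [F.am_val h, ← F.ps_shift]; exact F.le_c h.1
lemma c_upper {z : Z} {x t p : ℝ} (hx : 0 < x) (ht : 0 < t) (h : F.am z x t p) (x' t' : ℝ) :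
    F.c z x' t' ≤ F.c z x t + p * (x' - x) - F.g p * (t' - t) +
      (|x' - x| + F.Lam * |t' - t|) ^ 2 / (4 * (F.kap * min x t)) := by
  obtain ⟨q, hq⟩ := F.am_ex z x' t'
  rw [F.am_val hq, F.ps_shift z x t, F.am_val h]
  have h1 := F.strong z x t p q hx ht h hq.1
  have k : 0 < F.kap * min x t := mul_pos F.kpos (lt_min hx ht)
  set κ := F.kap * min x t
  have h2 := F.glip q (F.mem_pl hq) p (F.mem_pl h)
  have h3 : (q - p) * (x' - x) ≤ |q - p| * |x' - x| := (le_abs_self _).trans (abs_mul _ _).le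
  have h4 : -(F.g q - F.g p) * (t' - t) ≤ F.Lam * |q - p| * |t' - t| :=
    (le_abs_self _).trans (by rw [abs_mul, abs_neg]; exact mul_le_mul_of_nonneg_right h2 (abs_nonneg _))
  have h5 : |q - p| * (|x' - x| + F.Lam * |t' - t|) - κ * (q - p) ^ 2 ≤ (|x' - x| + F.Lam * |t' - t|) ^ 2 / (4 * κ) := by
    rw [le_div_iff₀ (by positivity), ← sq_abs (q - p)]
    nlinarith [sq_nonneg (2 * κ * |q - p| - (|x' - x| + F.Lam * |t' - t|))]
  change psi F.g (F.i z) x t q + _ - _ ≤ psi F.g (F.i z) x t p + _ - _ + _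
  nlinarith

def R0 : ℝ := |F.pl| + |F.hi|
lemma abs_R {p : ℝ} (h : p ∈ Icc F.pl F.hi) : |p| ≤ F.R0 := by
  rw [abs_le]; unfold R0
  constructor <;> linarith [h.1, h.2, neg_abs_le F.pl, le_abs_self F.hi, abs_nonneg F.pl, abs_nonneg F.hi]
def G0 : ℝ := |F.g F.hi| + F.Lam * |F.hi - F.pl|
lemma G0_nn : 0 ≤ F.G0 := add_nonneg (abs_nonneg _) (mul_nonneg F.Lpos (abs_nonneg _))
lemma abs_G {p : ℝ} (h : p ∈ Icc F.pl F.hi) : |F.g p| ≤ F.G0 := by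
  have h1 := F.glip p h F.hi ⟨h.1.trans h.2, le_rfl⟩
  have h2 : |p - F.hi| ≤ |F.hi - F.pl| := by
    rw [abs_sub_comm, abs_of_nonneg (by linarith [h.2]), abs_of_nonneg (by linarith [h.1, h.2])]; linarith [h.1]
  have h3 := abs_add_le (F.g p - F.g F.hi) (F.g F.hi)
  rw [sub_add_cancel] at h3
  unfold G0
  linarith [mul_le_mul_of_nonneg_left h2 F.Lpos]
lemma c_lip (z : Z) (x t x' t' : ℝ) : F.c z x t ≤ F.c z x' t' + F.R0 * |x' - x| + F.G0 * |t' - t| := by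
  obtain ⟨p, hp⟩ := F.am_ex z x t
  have h := F.c_lower hp x' t'
  have h1 : |p * (x' - x)| ≤ F.R0 * |x' - x| := by rw [abs_mul]; exact mul_le_mul_of_nonneg_right (F.abs_R (F.mem_pl hp)) (abs_nonneg _)
  have h2 : |F.g p * (t' - t)| ≤ F.G0 * |t' - t| := by rw [abs_mul]; exact mul_le_mul_of_nonneg_right (F.abs_G (F.mem_pl hp)) (abs_nonneg _)
  linarith [neg_abs_le (p * (x' - x)), le_abs_self (F.g p * (t' - t))]

def V (p : Pl) : ℝ := sInf (range fun z => F.a z + F.c z p.1 p.2)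
def ag (x t : ℝ) (z : Z) : Prop := F.V (x, t) = F.a z + F.c z x t
lemma coer' (R : ℝ) : ∃ K : Set Z, IsCompact K ∧ ∀ x t, |x| ≤ R → |t| ≤ R → (∃ z ∈ K, F.ag x t z) ∧ (∀ z, F.ag x t z → z ∈ K) ∧
    ∀ z, F.V (x, t) ≤ F.a z + F.c z x t := by
  obtain ⟨K, hK, z0, hz0, h⟩ := F.coer R
  refine ⟨K, hK, fun x t hx ht => ?_⟩
  have cc : Continuous fun z => F.a z + F.c z x t := F.ac.add (F.c_cont.comp (by fun_prop : Continuous fun z : Z => (z, x, t)))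
  obtain ⟨z1, hz1, hm⟩ := hK.exists_isMinOn ⟨z0, hz0⟩ cc.continuousOn
  have lt : ∀ z ∉ K, F.a z0 + F.c z0 x t < F.a z + F.c z x t := by
    intro z hz
    obtain ⟨p, hp, hq⟩ := h x t hx ht z hz
    obtain ⟨q, hq'⟩ := F.am_ex z0 x t
    rw [F.am_val hq']
    exact (hq q hq'.1).trans_le (by have := F.le_c (x := x) (t := t) hp; unfold ps at this; linarith)
  have hall : ∀ z, F.a z1 + F.c z1 x t ≤ F.a z + F.c z x t := by
    intro z
    by_cases hz : z ∈ K
    · exact hm hz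
    · exact (hm hz0).trans (lt z hz).le
  have hv : F.V (x, t) = F.a z1 + F.c z1 x t :=
    IsLeast.csInf_eq ⟨⟨z1, rfl⟩, by rintro _ ⟨z, rfl⟩; exact hall z⟩
  refine ⟨⟨z1, hz1, hv⟩, fun z hz => ?_, fun z => hv ▸ hall z⟩
  by_contra hzK
  have := lt z hzK
  have h3 := hm hz0
  simp only [mem_ofPred_eq] at h3
  rw [ag, hv] at hz
  linarith
lemma V_le (x t : ℝ) (z : Z) : F.V (x, t) ≤ F.a z + F.c z x t := by
  obtain ⟨K, _, h⟩ := F.coer' (max |x| |t|)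
  exact (h x t (le_max_left _ _) (le_max_right _ _)).2.2 z
lemma ag_ex (x t : ℝ) : ∃ z, F.ag x t z := by
  obtain ⟨K, _, h⟩ := F.coer' (max |x| |t|)
  obtain ⟨z, _, hz⟩ := (h x t (le_max_left _ _) (le_max_right _ _)).1
  exact ⟨z, hz⟩
lemma V_lip : ∃ K, LipschitzWith K F.V := by
  refine ⟨(F.R0 + F.G0).toNNReal, LipschitzWith.of_dist_le_mul fun p q => ?_⟩
  have R : 0 ≤ F.R0 := add_nonneg (abs_nonneg _) (abs_nonneg _)
  have G := F.G0_nn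
  rw [Real.coe_toNNReal _ (by linarith)]
  have key : ∀ p q : Pl, F.V p - F.V q ≤ (F.R0 + F.G0) * dist p q := by
    intro p q
    obtain ⟨z, hz⟩ := F.ag_ex q.1 q.2
    have h1 := F.V_le p.1 p.2 z
    have h2 := F.c_lip z p.1 p.2 q.1 q.2
    have h3 : |q.1 - p.1| ≤ dist p q := by rw [dist_comm]; exact le_max_left _ _
    have h4 : |q.2 - p.2| ≤ dist p q := by rw [dist_comm]; exact le_max_right _ _
    have hz : F.V q = _ := hz
    have h1 : F.V p ≤ _ := h1
    nlinarith [mul_le_mul_of_nonneg_left h3 R, mul_le_mul_of_nonneg_left h4 G]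
  rw [Real.dist_eq, abs_le]
  constructor
  · have := key q p; rw [dist_comm] at this; linarith
  · exact key p q

def P (x t p : ℝ) : Prop := ∃ z, F.ag x t z ∧ F.am z x t p
lemma P_ex (x t : ℝ) : ∃ p, F.P x t p := by
  obtain ⟨z, hz⟩ := F.ag_ex x t
  obtain ⟨p, hp⟩ := F.am_ex z x t
  exact ⟨p, z, hz, hp⟩
lemma P_mem {x t p : ℝ} (h : F.P x t p) : p ∈ Icc F.pl F.hi := by obtain ⟨z, _, h⟩ := h; exact F.mem_pl h
lemma P_sc {x t p : ℝ} (hx : 0 < x) (ht : 0 < t) (h : F.P x t p) (x' t' : ℝ) :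
    F.V (x', t') ≤ F.V (x, t) + p * (x' - x) - F.g p * (t' - t) + (|x' - x| + F.Lam * |t' - t|) ^ 2 / (4 * (F.kap * min x t)) := by
  obtain ⟨z, hz, hp⟩ := h
  rw [hz]
  linarith [F.V_le x' t' z, F.c_upper hx ht hp x' t']

lemma c_tend {ι : Type} {l : Filter ι} {z : ι → Z} {x t : ι → ℝ} {z' : Z} {x' t' : ℝ} (hz : Tendsto z l (𝓝 z'))
    (hx : Tendsto x l (𝓝 x')) (ht : Tendsto t l (𝓝 t')) : Tendsto (fun n => F.c (z n) (x n) (t n)) l (𝓝 (F.c z' x' t')) :=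
  Tendsto.comp (g := fun q : Z × ℝ × ℝ => F.c q.1 q.2.1 q.2.2) (f := fun n => (z n, x n, t n))
    (F.c_cont.tendsto (z', x', t')) (hz.prodMk_nhds (hx.prodMk_nhds ht))
/-- stability of optimisers -/
lemma am_lim {ι : Type} {l : Filter ι} [l.NeBot] {z : ι → Z} {x t p : ι → ℝ} {z' : Z} {x' t' p' : ℝ} (hz : Tendsto z l (𝓝 z'))
    (hx : Tendsto x l (𝓝 x')) (ht : Tendsto t l (𝓝 t')) (hp : Tendsto p l (𝓝 p')) (h : ∀ᶠ n in l, F.am (z n) (x n) (t n) (p n)) :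
    F.am z' x' t' p' := by
  rw [am_iff]
  refine ⟨⟨le_of_tendsto_of_tendsto ((F.loc.tendsto z').comp hz) hp (h.mono fun n hn => hn.1.1), le_of_tendsto hp (h.mono fun n hn => hn.1.2)⟩, ?_⟩
  have h1 : Tendsto (fun n => F.c (z n) (x n) (t n)) l (𝓝 (F.c z' x' t')) := F.c_tend hz hx ht
  have h2 : Tendsto (fun n => F.ps (z n) (x n) (t n) (p n)) l (𝓝 (F.ps z' x' t' p')) :=
    Tendsto.comp (g := fun q : (Z × ℝ × ℝ) × ℝ => F.ps q.1.1 q.1.2.1 q.1.2.2 q.2) (f := fun n => ((z n, x n, t n), p n)) (F.ps_cont.tendsto ((z', x', t'), p')) ((hz.prodMk_nhds (hx.prodMk_nhds ht)).prodMk_nhds hp)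
  exact tendsto_nhds_unique h1 (h2.congr' (h.mono fun n hn => (F.am_val hn).symm))
lemma ag_lim {ι : Type} {l : Filter ι} [l.NeBot] {z : ι → Z} {x t : ι → ℝ} {z' : Z} {x' t' : ℝ} (hz : Tendsto z l (𝓝 z'))
    (hx : Tendsto x l (𝓝 x')) (ht : Tendsto t l (𝓝 t')) (h : ∀ᶠ n in l, F.ag (x n) (t n) (z n)) : F.ag x' t' z' := by
  obtain ⟨K, hK⟩ := F.V_lip
  have hc : Tendsto (fun n => F.c (z n) (x n) (t n)) l (𝓝 (F.c z' x' t')) := F.c_tend hz hx ht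
  have ha : Tendsto (fun n => F.a (z n)) l (𝓝 (F.a z')) := (F.ac.tendsto z').comp hz
  have h2 : Tendsto (fun n => F.V (x n, t n)) l (𝓝 (F.V (x', t'))) := by
    have e : Tendsto (fun n => ((x n, t n) : Pl)) l (𝓝 ((x', t') : Pl)) := hx.prodMk_nhds ht
    exact Tendsto.comp (g := F.V) (f := fun n => ((x n, t n) : Pl)) (hK.continuous.tendsto ((x', t') : Pl)) e
  refine tendsto_nhds_unique h2 ((ha.add hc).congr' ?_)
  filter_upwards [h] with n hn
  unfold ag at hn
  exact hn.symm

lemma ultra_ex {ι : Type} (l : Ultrafilter ι) {Y : Type} [TopologicalSpace Y] {K : Set Y} (hK : IsCompact K) {f : ι → Y}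
    (h : ∀ᶠ n in l, f n ∈ K) : ∃ y, Tendsto f l (𝓝 y) := by
  obtain ⟨y, _, hy⟩ := hK.ultrafilter_le_nhds' (l.map f) h
  exact ⟨y, hy⟩

/-- the smallest optimal slope -/
lemma P_min (x t : ℝ) : ∃ L, F.P x t L ∧ ∀ p, F.P x t p → L ≤ p := by
  have hne : {p | F.P x t p}.Nonempty := F.P_ex x t
  have hcl : IsClosed {p | F.P x t p} := by
    rw [isClosed_iff_ultrafilter]
    intro p l hl hm
    obtain ⟨K, hK, h⟩ := F.coer' (max |x| |t|)
    have : ∀ q, ∃ z, F.P x t q → F.ag x t z ∧ F.am z x t q := fun q => by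
      by_cases hq : F.P x t q
      · obtain ⟨z, hz⟩ := hq; exact ⟨z, fun _ => hz⟩
      · obtain ⟨z, _⟩ := F.ag_ex x t; exact ⟨z, fun h => absurd h hq⟩
    choose z hz using this
    have hm' : ∀ᶠ q in (l : Filter ℝ), F.P x t q := hm
    obtain ⟨z', hz'⟩ := ultra_ex l hK (f := z) (hm'.mono fun q hq => (h x t (le_max_left _ _) (le_max_right _ _)).2.1 _ (hz q hq).1)
    exact ⟨z', F.ag_lim hz' tendsto_const_nhds tendsto_const_nhds (hm'.mono fun q hq => (hz q hq).1),
      F.am_lim hz' tendsto_const_nhds tendsto_const_nhds (tendsto_id'.2 hl) (hm'.mono fun q hq => (hz q hq).2)⟩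
  have hb : BddBelow {p | F.P x t p} := ⟨F.pl, fun p hp => (F.P_mem hp).1⟩
  exact ⟨_, hcl.csInf_mem hne hb, fun p hp => csInf_le hb hp⟩

lemma trace {x t L : ℝ} (hx : 0 ≤ x) (ht : 0 < t) (hL : F.P x t L) (hmin : ∀ p, F.P x t p → L ≤ p) {s : ℝ → ℝ}
    (hs : ∀ y, x < y → F.P y t (s y)) : Tendsto s (𝓝[>] x) (𝓝 L) := by
  rw [tendsto_iff_ultrafilter]
  intro l hl
  obtain ⟨z0, g0, a0⟩ := hL
  obtain ⟨K, hK, h⟩ := F.coer' (max (|x| + 1) |t|)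
  have e1 : ∀ᶠ y in (l : Filter ℝ), x < y := hl self_mem_nhdsWithin
  have e2 : ∀ᶠ y in (l : Filter ℝ), |y| ≤ |x| + 1 := by
    have : ∀ᶠ y in 𝓝 x, |y| ≤ |x| + 1 := by
      filter_upwards [(continuous_abs.tendsto x).eventually (ge_mem_nhds (show |x| < |x| + 1 by linarith))] with y hy using hy
    exact hl (mem_nhdsWithin_of_mem_nhds this)
  have hx' : Tendsto (fun y : ℝ => y) l (𝓝 x) := tendsto_id'.2 (hl.trans nhdsWithin_le_nhds)
  have : ∀ y, ∃ z, x < y → F.ag y t z ∧ F.am z y t (s y) := fun y => by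
    by_cases hy : x < y
    · obtain ⟨z, hz⟩ := hs y hy; exact ⟨z, fun _ => hz⟩
    · exact ⟨z0, fun h => absurd h hy⟩
  choose z hz using this
  choose q hq using fun y => F.am_ex (z y) x t
  choose r hr using fun y => F.am_ex z0 y t
  obtain ⟨z', hz'⟩ := ultra_ex l hK (f := z) (by
    filter_upwards [e1, e2] with y h1 h2 using (h y t (h2.trans (le_max_left _ _)) (le_max_right _ _)).2.1 _ (hz y h1).1)
  have hc := isCompact_Icc (a := F.pl) (b := F.hi)
  obtain ⟨s', hs'⟩ := ultra_ex l hc (f := s) (by filter_upwards [e1] with y h1 using F.mem_pl (hz y h1).2)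
  obtain ⟨q', hq'⟩ := ultra_ex l hc (f := q) (Eventually.of_forall fun y => F.mem_pl (hq y))
  obtain ⟨r', hr'⟩ := ultra_ex l hc (f := r) (Eventually.of_forall fun y => F.mem_pl (hr y))
  have A1 : F.am z' x t s' := F.am_lim hz' hx' tendsto_const_nhds hs' (by filter_upwards [e1] with y h1 using (hz y h1).2)
  have A2 : F.am z' x t q' := F.am_lim hz' tendsto_const_nhds tendsto_const_nhds hq' (Eventually.of_forall hq)
  have A3 : F.am z0 x t r' := F.am_lim tendsto_const_nhds hx' tendsto_const_nhds hr' (Eventually.of_forall hr)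
  have A4 : F.ag x t z' := F.ag_lim hz' hx' tendsto_const_nhds (by filter_upwards [e1] with y h1 using (hz y h1).1)
  have k1 : s' = q' := F.uniq _ _ _ _ _ hx ht A1 A2
  have k2 : r' = L := F.uniq _ _ _ _ _ hx ht A3 a0
  have k3 : q' ≤ r' := by
    refine le_of_tendsto_of_tendsto hq' hr' ?_
    filter_upwards [e1] with y h1
    have b1 := F.c_lower (hq y) y t
    have b2 := F.c_lower (hr y) x t
    have b3 := (hz y h1).1
    have b4 := F.V_le y t z0
    have b5 := F.V_le x t (z y)
    unfold ag at b3 g0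
    rw [sub_self, mul_zero, sub_zero] at b1 b2
    by_contra hcon
    push Not at hcon
    nlinarith
  have k4 : s' = L := le_antisymm (by linarith) (hmin _ ⟨z', A4, A1⟩)
  rw [← k4]; exact hs'

end Fam


open Classical in
def pp (f : ℝ → ℝ) (b F : ℝ) : ℝ := if h : ∃ p, b ≤ p ∧ f p = max F (f b) then h.choose else b

section pp
variable {a : ℝ} {f : ℝ → ℝ} {b : ℝ}
lemma UC.inc (h : UC a f) (hb : 0 ≤ deriv f b) {p q : ℝ} (hp : b ≤ p) (hpq : p ≤ q) : f p + a / 2 * (q - p) ^ 2 ≤ f q := by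
  have h1 := h.tangent b p
  have h2 := h.tangent p q
  have h3 := h.tangent p b
  have : 0 ≤ deriv f p * (p - b) := by nlinarith [mul_nonneg hb (sub_nonneg.2 hp), mul_nonneg h.pos.le (sq_nonneg (p - b))]
  rcases hp.eq_or_lt with rfl | hp
  · nlinarith [mul_nonneg hb (sub_nonneg.2 hpq)]
  · have h4 : 0 ≤ deriv f p := nonneg_of_mul_nonneg_left this (sub_pos.2 hp)
    nlinarith [mul_nonneg h4 (sub_nonneg.2 hpq)]
lemma UC.le_of (h : UC a f) (hb : 0 ≤ deriv f b) {p q : ℝ} (hp : b ≤ p) (hq : b ≤ q) (hf : f p ≤ f q) : p ≤ q := by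
  by_contra hc
  push Not at hc
  have := h.inc hb hq hc.le
  have : 0 < a / 2 * (p - q) ^ 2 := mul_pos (half_pos h.pos) (pow_pos (sub_pos.2 hc) 2)
  linarith
lemma UC.lt_of (h : UC a f) (hb : 0 ≤ deriv f b) {p q : ℝ} (hp : b ≤ p) (hpq : p < q) : f p < f q := by
  have := h.inc hb hp hpq.le
  have : 0 < a / 2 * (q - p) ^ 2 := mul_pos (half_pos h.pos) (pow_pos (sub_pos.2 hpq) 2)
  linarith
lemma UC.inj (h : UC a f) (hb : 0 ≤ deriv f b) {p q : ℝ} (hp : b ≤ p) (hq : b ≤ q) (hf : f p = f q) : p = q :=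
  le_antisymm (h.le_of hb hp hq hf.le) (h.le_of hb hq hp hf.ge)
lemma pp_spec (h : UC a f) (hb : 0 ≤ deriv f b) (F : ℝ) : b ≤ pp f b F ∧ f (pp f b F) = max F (f b) := by
  have ex : ∃ p, b ≤ p ∧ f p = max F (f b) := by
    set F' := max F (f b)
    have hF : f b ≤ F' := le_max_right _ _
    set q := b + (1 + 2 * (F' - f b) / a) with hq
    have hnn : 0 ≤ 2 * (F' - f b) / a := div_nonneg (by linarith) h.pos.le
    have h1 := h.inc hb le_rfl (show b ≤ q by linarith)
    have h2 : F' ≤ f q := by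
      have e : a * (2 * (F' - f b) / a) = 2 * (F' - f b) := by field_simp [h.pos.ne']
      have : q - b = 1 + 2 * (F' - f b) / a := by rw [hq]; ring
      rw [this] at h1
      nlinarith [mul_nonneg h.pos.le (sq_nonneg (2 * (F' - f b) / a)), h.pos]
    obtain ⟨p, hp, e⟩ := intermediate_value_Icc (show b ≤ q by linarith) h.cont.continuousOn ⟨hF, h2⟩
    exact ⟨p, hp.1, e⟩
  unfold pp; rw [dif_pos ex]; exact ex.choose_spec
lemma pp_eq (h : UC a f) (hb : 0 ≤ deriv f b) {p : ℝ} (hp : b ≤ p) : pp f b (f p) = p := by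
  have := pp_spec h hb (f p)
  refine h.inj hb this.1 hp (this.2.trans (max_eq_left ?_))
  nlinarith [h.inc hb le_rfl hp, mul_nonneg h.pos.le (sq_nonneg (p - b))]
lemma pp_mid (h : UC a f) (hb : 0 ≤ deriv f b) {F F' : ℝ} (hF : f b ≤ F) (hF' : f b ≤ F') :
    (pp f b F + pp f b F') / 2 ≤ pp f b ((F + F') / 2) := by
  obtain ⟨p1, p2⟩ := pp_spec h hb F
  obtain ⟨q1, q2⟩ := pp_spec h hb F'
  obtain ⟨m1, m2⟩ := pp_spec h hb ((F + F') / 2)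
  rw [max_eq_left hF] at p2
  rw [max_eq_left hF'] at q2
  rw [max_eq_left (by linarith)] at m2
  set p := pp f b F
  set q := pp f b F'
  refine h.le_of hb (by linarith) m1 ?_
  have e1 := h.tangent ((p + q) / 2) p
  have e2 := h.tangent ((p + q) / 2) q
  nlinarith [mul_nonneg h.pos.le (sq_nonneg (p - q))]
lemma pp_mid' (h : UC a f) (hb : 0 ≤ deriv f b) {F F' Λ : ℝ} (hF : f b ≤ F) (hF' : f b ≤ F') (hΛ : 0 < Λ)
    (hl : ∀ x ∈ Icc (min (pp f b F) (pp f b F')) (max (pp f b F) (pp f b F')), ∀ y ∈ Icc (min (pp f b F) (pp f b F')) (max (pp f b F) (pp f b F')), |f x - f y| ≤ Λ * |x - y|) :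
    (pp f b F + pp f b F') / 2 + a / (8 * Λ) * (pp f b F - pp f b F') ^ 2 ≤ pp f b ((F + F') / 2) := by
  have h0 := pp_mid h hb hF hF'
  obtain ⟨p1, p2⟩ := pp_spec h hb F
  obtain ⟨q1, q2⟩ := pp_spec h hb F'
  obtain ⟨m1, m2⟩ := pp_spec h hb ((F + F') / 2)
  rw [max_eq_left hF] at p2
  rw [max_eq_left hF'] at q2
  rw [max_eq_left (by linarith)] at m2
  set p := pp f b F
  set q := pp f b F'
  set m := pp f b ((F + F') / 2)
  have e1 := h.tangent ((p + q) / 2) p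
  have e2 := h.tangent ((p + q) / 2) q
  have hm : m ≤ max p q := by
    rcases le_total F F' with hh | hh
    · exact (h.le_of hb m1 q1 (by linarith)).trans (le_max_right _ _)
    · exact (h.le_of hb m1 p1 (by linarith)).trans (le_max_left _ _)
  have a1 : min p q ≤ (p + q) / 2 := by linarith [min_le_left p q, min_le_right p q]
  have a2 : (p + q) / 2 ≤ max p q := by linarith [le_max_left p q, le_max_right p q]
  have := hl m ⟨a1.trans h0, hm⟩ ((p + q) / 2) ⟨a1, a2⟩
  rw [abs_of_nonneg (sub_nonneg.2 h0)] at this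
  have h3 := le_abs_self (f m - f ((p + q) / 2))
  have h4 : a / 8 * (p - q) ^ 2 ≤ Λ * (m - (p + q) / 2) := by nlinarith
  have h5 : a / (8 * Λ) * (p - q) ^ 2 = (a / 8 * (p - q) ^ 2) / Λ := by field_simp
  have h6 : (a / 8 * (p - q) ^ 2) / Λ ≤ m - (p + q) / 2 := by rw [div_le_iff₀ hΛ]; linarith
  linarith
lemma pp_mid_lt (h : UC a f) (hb : 0 ≤ deriv f b) {F F' : ℝ} (hF : f b ≤ F) (hF' : f b ≤ F') (hne : F ≠ F') :
    (pp f b F + pp f b F') / 2 < pp f b ((F + F') / 2) := by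
  refine lt_of_le_of_ne (pp_mid h hb hF hF') fun he => ?_
  obtain ⟨p1, p2⟩ := pp_spec h hb F
  obtain ⟨q1, q2⟩ := pp_spec h hb F'
  obtain ⟨m1, m2⟩ := pp_spec h hb ((F + F') / 2)
  rw [max_eq_left hF] at p2
  rw [max_eq_left hF'] at q2
  rw [max_eq_left (by linarith), ← he] at m2
  set p := pp f b F
  set q := pp f b F'
  have e1 := h.tangent ((p + q) / 2) p
  have e2 := h.tangent ((p + q) / 2) q
  have : p ≠ q := fun e => hne (by rw [← p2, ← q2, e])
  have : 0 < a * (p - q) ^ 2 := mul_pos h.pos (by positivity [sub_ne_zero.2 this])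
  nlinarith
lemma pp_mono (h : UC a f) (hb : 0 ≤ deriv f b) {F F' : ℝ} (hF : F ≤ F') : pp f b F ≤ pp f b F' := by
  obtain ⟨p1, p2⟩ := pp_spec h hb F
  obtain ⟨q1, q2⟩ := pp_spec h hb F'
  exact h.le_of hb p1 q1 (by rw [p2, q2]; exact max_le_max_right _ hF)
lemma pp_cont (h : UC a f) (hb : 0 ≤ deriv f b) : Continuous (pp f b) := by
  have key : ∀ F F', F ≤ F' → a / 2 * (pp f b F' - pp f b F) ^ 2 ≤ F' - F := by
    intro F F' hF
    obtain ⟨p1, p2⟩ := pp_spec h hb F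
    obtain ⟨q1, q2⟩ := pp_spec h hb F'
    have := h.inc hb p1 (pp_mono h hb hF)
    rw [p2, q2] at this
    have : max F' (f b) - max F (f b) ≤ F' - F := by
      rcases le_total F (f b) with h1 | h1 <;> rcases le_total F' (f b) with h2 | h2 <;> simp [h1, h2] <;> linarith
    linarith
  have key' : ∀ F F', (pp f b F' - pp f b F) ^ 2 ≤ 2 / a * |F' - F| := by
    intro F F'
    have e : ∀ X Y : ℝ, a / 2 * X ≤ Y → X ≤ 2 / a * Y := fun X Y hh => by
      rw [div_mul_eq_mul_div, le_div_iff₀ h.pos]; linarith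
    rcases le_total F F' with hh | hh
    · rw [abs_of_nonneg (sub_nonneg.2 hh)]; exact e _ _ (key F F' hh)
    · rw [abs_of_nonpos (sub_nonpos.2 hh), neg_sub, ← neg_sq, neg_sub]; exact e _ _ (key F' F hh)
  rw [continuous_iff_continuousAt]
  intro F
  have h1 : Tendsto (fun F' => |pp f b F' - pp f b F|) (𝓝 F) (𝓝 0) := by
    have h2 : Tendsto (fun F' => Real.sqrt (2 / a * |F' - F|)) (𝓝 F) (𝓝 0) := by
      have : Continuous fun F' => Real.sqrt (2 / a * |F' - F|) := by fun_prop
      have := this.tendsto F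
      simpa using this
    exact squeeze_zero (fun _ => abs_nonneg _) (fun F' => Real.abs_le_sqrt (key' F F')) h2
  exact tendsto_iff_dist_tendsto_zero.2 h1
end pp


/-- geometry of the two fluxes, the connection and the cut-off level -/
structure Geo (a M : ℝ) where
  g : ℝ → ℝ
  h : ℝ → ℝ
  B : ℝ
  Bb : ℝ
  A : ℝ
  Aa : ℝ
  hg : UC a g
  hh : UC a h
  hB : 0 ≤ deriv g B
  hBb : deriv g Bb ≤ 0
  hA : deriv h A ≤ 0
  hAa : 0 ≤ deriv h Aa
  eBb : g Bb = g B
  eA : h A = g B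
  eAa : h Aa = g B
  lBb : Bb ≤ B
  lA : A ≤ Aa
  Φ : ℝ
  pl : ℝ
  hi : ℝ
  al : ℝ
  ah : ℝ
  gpl : g pl = Φ
  ghi : g hi = Φ
  hal : h al = Φ
  hah : h ah = Φ
  lpl : pl ≤ Bb
  lhi : B ≤ hi
  lal : al ≤ A
  lah : Aa ≤ ah
  M0 : 0 ≤ M
  Mpl : pl ≤ -(M + 1)
  Mhi : M + 1 ≤ hi
  Mal : al ≤ -(M + 1)
  Mah : M + 1 ≤ ah

lemma deriv_cn (f : ℝ → ℝ) (b : ℝ) : deriv (fun p => f (-p)) (-b) = - deriv f b := by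
  rw [deriv_comp_neg, neg_neg]

namespace Geo
variable {a M : ℝ} (D : Geo a M)
def refl : Geo a M where
  g := fun p => D.h (-p)
  h := fun p => D.g (-p)
  B := -D.A
  Bb := -D.Aa
  A := -D.B
  Aa := -D.Bb
  hg := D.hh.neg
  hh := D.hg.neg
  hB := by rw [deriv_cn]; linarith [D.hA]
  hBb := by rw [deriv_cn]; linarith [D.hAa]
  hA := by rw [deriv_cn]; linarith [D.hB]
  hAa := by rw [deriv_cn]; linarith [D.hBb]
  eBb := by rw [neg_neg, neg_neg, D.eA, D.eAa]
  eA := by rw [neg_neg, neg_neg, D.eA]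
  eAa := by rw [neg_neg, neg_neg, D.eA, D.eBb]
  lBb := neg_le_neg D.lA
  lA := neg_le_neg D.lBb
  Φ := D.Φ
  pl := -D.ah
  hi := -D.al
  al := -D.hi
  ah := -D.pl
  gpl := by rw [neg_neg, D.hah]
  ghi := by rw [neg_neg, D.hal]
  hal := by rw [neg_neg, D.ghi]
  hah := by rw [neg_neg, D.gpl]
  lpl := neg_le_neg D.lah
  lhi := neg_le_neg D.lal
  lal := neg_le_neg D.lhi
  lah := neg_le_neg D.lpl
  M0 := D.M0
  Mpl := by linarith [D.Mah]
  Mhi := by linarith [D.Mal]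
  Mal := by linarith [D.Mhi]
  Mah := by linarith [D.Mpl]
def rev : Geo a M where
  g := D.h
  h := D.g
  B := D.Aa
  Bb := D.A
  A := D.Bb
  Aa := D.B
  hg := D.hh
  hh := D.hg
  hB := D.hAa
  hBb := D.hA
  hA := D.hBb
  hAa := D.hB
  eBb := D.eA.trans D.eAa.symm
  eA := D.eBb.trans D.eAa.symm
  eAa := D.eAa.symm
  lBb := D.lA
  lA := D.lBb
  Φ := D.Φ
  pl := D.al
  hi := D.ah
  al := D.pl
  ah := D.hi
  gpl := D.hal
  ghi := D.hah
  hal := D.gpl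
  hah := D.ghi
  lpl := D.lal
  lhi := D.lah
  lal := D.lpl
  lah := D.lhi
  M0 := D.M0
  Mpl := D.Mal
  Mhi := D.Mah
  Mal := D.Mpl
  Mah := D.Mhi
lemma refl_refl : D.refl.refl = D := by
  cases D; simp [refl]

/-- branch functions -/
def e0 (F : ℝ) : ℝ := pp D.g D.B F
def e1 (F : ℝ) : ℝ := pp (fun p => D.g (-p)) (-D.Bb) F
def e2 (F : ℝ) : ℝ := pp D.h D.Aa F
lemma hBb' : 0 ≤ deriv (fun p => D.g (-p)) (-D.Bb) := by rw [deriv_cn]; linarith [D.hBb]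
lemma γle : D.g D.B ≤ D.Φ := by
  have := D.hg.inc D.hB le_rfl D.lhi
  rw [D.ghi] at this
  nlinarith [mul_nonneg D.hg.pos.le (sq_nonneg (D.hi - D.B))]
lemma e0_spec {F : ℝ} (hF : D.g D.B ≤ F) : D.B ≤ D.e0 F ∧ D.g (D.e0 F) = F := by
  have := pp_spec D.hg D.hB F; rw [max_eq_left hF] at this; exact this
lemma e1_spec {F : ℝ} (hF : D.g D.B ≤ F) : -D.e1 F ≤ D.Bb ∧ D.g (-D.e1 F) = F := by
  have := pp_spec D.hg.neg D.hBb' F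
  rw [neg_neg, D.eBb, max_eq_left hF] at this
  exact ⟨by have := this.1; unfold e1; linarith, this.2⟩
lemma e2_spec {F : ℝ} (hF : D.g D.B ≤ F) : D.Aa ≤ D.e2 F ∧ D.h (D.e2 F) = F := by
  have := pp_spec D.hh D.hAa F; rw [D.eAa, max_eq_left hF] at this; exact this
lemma e0_eq {p : ℝ} (hp : D.B ≤ p) : D.e0 (D.g p) = p := pp_eq D.hg D.hB hp
lemma e1_eq {p : ℝ} (hp : p ≤ D.Bb) : D.e1 (D.g p) = -p := by
  have := pp_eq D.hg.neg D.hBb' (neg_le_neg hp)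
  rwa [neg_neg] at this
lemma e0_Φ : D.e0 D.Φ = D.hi := by rw [← D.ghi]; exact D.e0_eq D.lhi
lemma e1_Φ : D.e1 D.Φ = -D.pl := by rw [← D.gpl]; exact D.e1_eq D.lpl
lemma e2_Φ : D.e2 D.Φ = D.ah := by rw [← D.hah]; exact pp_eq D.hh D.hAa D.lah
lemma e0_cont : Continuous D.e0 := pp_cont D.hg D.hB
lemma e1_cont : Continuous D.e1 := pp_cont D.hg.neg D.hBb'
lemma e2_cont : Continuous D.e2 := pp_cont D.hh D.hAa
lemma e1_mid {F F' : ℝ} (hF : D.g D.B ≤ F) (hF' : D.g D.B ≤ F') : (D.e1 F + D.e1 F') / 2 ≤ D.e1 ((F + F') / 2) :=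
  pp_mid D.hg.neg D.hBb' (by rwa [neg_neg, D.eBb]) (by rwa [neg_neg, D.eBb])
lemma e2_mid {F F' : ℝ} (hF : D.g D.B ≤ F) (hF' : D.g D.B ≤ F') : (D.e2 F + D.e2 F') / 2 ≤ D.e2 ((F + F') / 2) :=
  pp_mid D.hh D.hAa (by rwa [D.eAa]) (by rwa [D.eAa])
lemma e1_lt {F F' : ℝ} (hF : D.g D.B ≤ F) (hF' : D.g D.B ≤ F') (hne : F ≠ F') : (D.e1 F + D.e1 F') / 2 < D.e1 ((F + F') / 2) :=
  pp_mid_lt D.hg.neg D.hBb' (by rwa [neg_neg, D.eBb]) (by rwa [neg_neg, D.eBb]) hne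
lemma e2_lt {F F' : ℝ} (hF : D.g D.B ≤ F) (hF' : D.g D.B ≤ F') (hne : F ≠ F') : (D.e2 F + D.e2 F') / 2 < D.e2 ((F + F') / 2) :=
  pp_mid_lt D.hh D.hAa (by rwa [D.eAa]) (by rwa [D.eAa]) hne
lemma refl_e0 : D.refl.e0 = fun F => pp (fun p => D.h (-p)) (-D.A) F := rfl
lemma refl_e1 : D.refl.e1 = D.e2 := by
  ext F; simp [e1, e2, refl]
lemma refl_e2 : D.refl.e2 = D.e1 := rfl
lemma rev_e0 : D.rev.e0 = D.e2 := rfl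
lemma rev_e2 : D.rev.e2 = D.e0 := rfl

lemma g_ge {p : ℝ} (hp : D.B ≤ p) : D.g D.B ≤ D.g p := by
  have := D.hg.inc D.hB le_rfl hp
  nlinarith [mul_nonneg D.hg.pos.le (sq_nonneg (p - D.B))]
lemma g_le {p : ℝ} (hp : D.B ≤ p) (hp' : p ≤ D.hi) : D.g p ≤ D.Φ := by
  have := D.hg.inc D.hB hp hp'
  rw [D.ghi] at this
  nlinarith [mul_nonneg D.hg.pos.le (sq_nonneg (D.hi - p))]
lemma e0_le {F : ℝ} (hF : F ≤ D.Φ) : D.e0 F ≤ D.hi := by rw [← D.e0_Φ]; exact pp_mono D.hg D.hB hF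
lemma e1_le {F : ℝ} (hF : F ≤ D.Φ) : D.e1 F ≤ -D.pl := by rw [← D.e1_Φ]; exact pp_mono D.hg.neg D.hBb' hF
lemma g_conv (p q : ℝ) : D.g ((p + q) / 2) ≤ (D.g p + D.g q) / 2 - a / 8 * (p - q) ^ 2 := by
  have e1 := D.hg.tangent ((p + q) / 2) p
  have e2 := D.hg.tangent ((p + q) / 2) q
  nlinarith

/-- boundary-cost -/
def ii (z : Bool × ℝ) (p : ℝ) : ℝ :=
  if z.1 = true then -p * |z.2| else max z.2 0 * D.e1 (D.g p) + max (-z.2) 0 * D.e2 (D.g p)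
def lo (z : Bool × ℝ) : ℝ := if z.1 = true then D.pl else D.B
lemma glip : ∃ L, 1 ≤ L ∧ ∀ p ∈ Icc D.pl D.hi, ∀ q ∈ Icc D.pl D.hi, |D.g p - D.g q| ≤ L * |p - q| := by
  obtain ⟨L, hL, h⟩ := D.hg.lip (|D.pl| + |D.hi|)
  have e : ∀ p ∈ Icc D.pl D.hi, |p| ≤ |D.pl| + |D.hi| := fun p hp => abs_le.2 ⟨by linarith [hp.1, neg_abs_le D.pl, abs_nonneg D.hi], by linarith [hp.2, le_abs_self D.hi, abs_nonneg D.pl]⟩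
  exact ⟨L + 1, by linarith, fun p hp q hq => (h p q (e p hp) (e q hq)).trans (by nlinarith [abs_nonneg (p - q)])⟩
lemma pl_lt : D.pl ≤ D.hi := D.lpl.trans (D.lBb.trans D.lhi)

/-- midpoint in flux for interface indices -/
lemma int_mid {y x t p q L : ℝ} (hL : 0 < L) (hl : ∀ p ∈ Icc D.pl D.hi, ∀ q ∈ Icc D.pl D.hi, |D.g p - D.g q| ≤ L * |p - q|)
    (hx : 0 ≤ x) (hp : p ∈ Icc D.B D.hi) (hq : q ∈ Icc D.B D.hi) :
    ∃ m ∈ Icc D.B D.hi, (psi D.g (D.ii (false, y)) x t p + psi D.g (D.ii (false, y)) x t q) / 2 + x * (a / (8 * L) * (p - q) ^ 2) +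
      max y 0 * (D.e1 ((D.g p + D.g q) / 2) - (D.e1 (D.g p) + D.e1 (D.g q)) / 2) +
      max (-y) 0 * (D.e2 ((D.g p + D.g q) / 2) - (D.e2 (D.g p) + D.e2 (D.g q)) / 2) ≤ psi D.g (D.ii (false, y)) x t m := by
  have gp := D.g_ge hp.1
  have gq := D.g_ge hq.1
  have gm : D.g D.B ≤ (D.g p + D.g q) / 2 := by linarith
  have hm := D.e0_spec gm
  have hpl := D.lpl.trans D.lBb
  refine ⟨D.e0 ((D.g p + D.g q) / 2), ⟨hm.1, D.e0_le (by linarith [D.g_le hp.1 hp.2, D.g_le hq.1 hq.2])⟩, ?_⟩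
  have key := pp_mid' D.hg D.hB gp gq hL (by
    rw [pp_eq D.hg D.hB hp.1, pp_eq D.hg D.hB hq.1]
    intro u hu v hv
    refine hl u ⟨?_, ?_⟩ v ⟨?_, ?_⟩
    · exact hpl.trans ((le_min hp.1 hq.1).trans hu.1)
    · exact hu.2.trans (max_le hp.2 hq.2)
    · exact hpl.trans ((le_min hp.1 hq.1).trans hv.1)
    · exact hv.2.trans (max_le hp.2 hq.2))
  rw [pp_eq D.hg D.hB hp.1, pp_eq D.hg D.hB hq.1] at key
  change _ ≤ D.e0 _ at key
  have k2 := mul_le_mul_of_nonneg_left key hx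
  simp only [psi, ii, Bool.false_eq_true, if_false, hm.2]
  nlinarith
lemma dir_mid {y x t p q : ℝ} : (psi D.g (D.ii (true, y)) x t p + psi D.g (D.ii (true, y)) x t q) / 2 + (if 0 ≤ t then t * (a / 8 * (p - q) ^ 2) else 0) ≤
    psi D.g (D.ii (true, y)) x t ((p + q) / 2) ∨ t < 0 := by
  by_cases ht : 0 ≤ t
  · left
    have := mul_le_mul_of_nonneg_left (D.g_conv p q) ht
    simp only [psi, ii, if_true, if_pos ht]
    nlinarith
  · right; linarith
lemma ii_cont : Continuous fun q : (Bool × ℝ) × ℝ => D.ii q.1 q.2 := by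
  have h1 := D.e1_cont.comp D.hg.cont
  have h2 := D.e2_cont.comp D.hg.cont
  have : Continuous fun q : Bool × ℝ × ℝ => D.ii (q.1, q.2.1) q.2.2 := by
    rw [continuous_prod_of_discrete_left]
    rintro (_ | _)
    · simp only [ii, Bool.false_eq_true, if_false]
      exact ((by fun_prop : Continuous fun q : ℝ × ℝ => max q.1 0).mul (h1.comp continuous_snd)).add
        ((by fun_prop : Continuous fun q : ℝ × ℝ => max (-q.1) 0).mul (h2.comp continuous_snd))
    · simp only [ii, if_true]
      fun_prop
  exact this.comp (by fun_prop : Continuous fun q : (Bool × ℝ) × ℝ => (q.1.1, q.1.2, q.2))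
lemma lo_cont : Continuous D.lo := by
  rw [show D.lo = fun q : Bool × ℝ => D.lo q from rfl, continuous_prod_of_discrete_left]
  rintro (_ | _) <;> simp only [lo] <;> simp <;> exact continuous_const

lemma int_uniq {y x t p q : ℝ} (hx : 0 ≤ x) (ht : 0 < t) (hp : AM D.g (D.ii (false, y)) D.B D.hi x t p) (hq : AM D.g (D.ii (false, y)) D.B D.hi x t q) : p = q := by
  by_contra hne
  obtain ⟨L, hL, hl⟩ := D.glip
  have gne : D.g p ≠ D.g q := fun e => hne (D.hg.inj D.hB hp.1.1 hq.1.1 e)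
  have gp := D.g_ge hp.1.1
  have gq := D.g_ge hq.1.1
  obtain ⟨m, hm, hmm⟩ := D.int_mid (y := y) (t := t) (by linarith) hl hx hp.1 hq.1
  have h1 := hp.2 q hq.1
  have h2 := hq.2 p hp.1
  have h3 := hp.2 m hm
  have n1 : 0 ≤ x * (a / (8 * L) * (p - q) ^ 2) := mul_nonneg hx (mul_nonneg (div_nonneg D.hg.pos.le (by linarith)) (sq_nonneg _))
  have d1 := D.e1_lt gp gq gne
  have d2 := D.e2_lt gp gq gne
  rcases lt_trichotomy y 0 with hy | hy | hy
  · have := mul_pos (show 0 < max (-y) 0 by rw [max_eq_left (by linarith)]; linarith) (sub_pos.2 d2)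
    have := mul_nonneg (le_max_right y 0) (sub_pos.2 d1).le
    linarith
  · subst hy
    rcases hx.eq_or_lt with rfl | hx
    · have hB := hp.2 D.B ⟨le_rfl, D.lhi⟩
      have hB' := hq.2 D.B ⟨le_rfl, D.lhi⟩
      simp only [psi, ii, Bool.false_eq_true, if_false, neg_zero, max_self] at hB hB'
      have e1 : D.g p ≤ D.g D.B := by nlinarith
      have e2 : D.g q ≤ D.g D.B := by nlinarith
      exact gne (by linarith)
    · have : 0 < x * (a / (8 * L) * (p - q) ^ 2) := mul_pos hx (mul_pos (div_pos D.hg.pos (by linarith)) (pow_pos (abs_pos.2 (sub_ne_zero.2 hne)) 2 |>.trans_le (sq_abs _).le))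
      simp only [neg_zero, max_self, zero_mul] at hmm
      linarith
  · have := mul_pos (show 0 < max y 0 by rw [max_eq_left (by linarith)]; linarith) (sub_pos.2 d1)
    have := mul_nonneg (le_max_right (-y) 0) (sub_pos.2 d2).le
    linarith
lemma int_strong {y x t p q L : ℝ} (hL : 0 < L) (hl : ∀ p ∈ Icc D.pl D.hi, ∀ q ∈ Icc D.pl D.hi, |D.g p - D.g q| ≤ L * |p - q|)
    (hx : 0 ≤ x) (hp : AM D.g (D.ii (false, y)) D.B D.hi x t p) (hq : q ∈ Icc D.B D.hi) :
    psi D.g (D.ii (false, y)) x t q ≤ psi D.g (D.ii (false, y)) x t p - a / (4 * L) * x * (q - p) ^ 2 := by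
  obtain ⟨m, hm, hmm⟩ := D.int_mid (y := y) (t := t) hL hl hx hp.1 hq
  have h3 := hp.2 m hm
  have gp := D.g_ge hp.1.1
  have gq := D.g_ge hq.1
  have := mul_nonneg (le_max_right (-y) 0) (sub_nonneg.2 (D.e2_mid gp gq))
  have := mul_nonneg (le_max_right y 0) (sub_nonneg.2 (D.e1_mid gp gq))
  have e : a / (4 * L) * x * (q - p) ^ 2 = 2 * (x * (a / (8 * L) * (p - q) ^ 2)) := by field_simp; ring
  rw [e]; linarith
lemma dir_strong {y x t p q : ℝ} (ht : 0 ≤ t) (hp : AM D.g (D.ii (true, y)) D.pl D.hi x t p) (hq : q ∈ Icc D.pl D.hi) :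
    psi D.g (D.ii (true, y)) x t q ≤ psi D.g (D.ii (true, y)) x t p - a / 4 * t * (q - p) ^ 2 := by
  have h1 := hp.2 ((p + q) / 2) ⟨by linarith [hp.1.1, hq.1], by linarith [hp.1.2, hq.2]⟩
  rcases D.dir_mid (y := y) (x := x) (t := t) (p := p) (q := q) with h | h
  · rw [if_pos ht] at h
    nlinarith
  · linarith

def fam (G : ℝ → ℝ) (hG : ∀ x y, |G x - G y| ≤ M * |x - y|) : Fam (Bool × ℝ) where
  g := D.g
  gc := D.hg.cont
  lo := D.lo
  loc := D.lo_cont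
  pl := D.pl
  hi := D.hi
  hlo := by
    rintro ⟨_ | _, y⟩ <;> simp only [lo]
    · simpa using ⟨D.lpl.trans D.lBb, D.lhi⟩
    · simpa using D.pl_lt
  i := D.ii
  ic := D.ii_cont
  a := fun z => if z.1 = true then G |z.2| else G z.2
  ac := by
    have cG : Continuous G := (LipschitzWith.of_dist_le_mul (K := M.toNNReal) fun x y => by
      rw [Real.coe_toNNReal _ D.M0]; exact hG x y).continuous
    rw [continuous_prod_of_discrete_left]
    rintro (_ | _) <;> simp
    · exact cG
    · fun_prop
  coer := by
    intro R
    obtain ⟨L, hL, hl⟩ := D.glip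
    obtain ⟨C, hC⟩ := (isCompact_Icc (a := D.pl) (b := D.hi)).exists_bound_of_continuousOn (f := fun p => |p| + |D.g p|)
      (by have := D.hg.cont; fun_prop)
    have hC' : ∀ p ∈ Icc D.pl D.hi, ∀ x t, |x| ≤ R → |t| ≤ R → |p * x - D.g p * t| ≤ 2 * C * R := by
      intro p hp x t hx ht
      have := hC p hp
      rw [Real.norm_of_nonneg (by positivity)] at this
      have h1 := abs_sub (p * x) (D.g p * t)
      rw [abs_mul, abs_mul] at h1
      have := abs_nonneg p
      have := abs_nonneg (D.g p)
      nlinarith [mul_le_mul (show |p| ≤ C by linarith) hx (abs_nonneg _) (by linarith), mul_le_mul (show |D.g p| ≤ C by linarith) ht (abs_nonneg _) (by linarith)]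
    refine ⟨univ ×ˢ Icc (-(4 * |C * R| + 1)) (4 * |C * R| + 1), isCompact_univ.prod isCompact_Icc, (true, 0), ⟨mem_univ _, ?_⟩, ?_⟩
    · exact ⟨by have := abs_nonneg (C * R); simp only; linarith, by have := abs_nonneg (C * R); simp only; linarith⟩
    · rintro x t hx ht ⟨b, y⟩ hz
      have hy : 4 * |C * R| + 1 < |y| := by
        by_contra hc
        push Not at hc
        exact hz ⟨mem_univ _, abs_le.1 hc⟩
      have hcr := le_abs_self (C * R)
      have hq : ∀ q ∈ Icc (D.lo (true, 0)) D.hi, (if (true, (0:ℝ)).1 = true then G |(true, (0:ℝ)).2| else G (true, (0:ℝ)).2) + psi D.g (D.ii (true, 0)) x t q ≤ G 0 + 2 * C * R := by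
        intro q hq
        have := hC' q (by simpa [lo] using hq) x t hx ht
        simp [psi, ii]
        linarith [le_abs_self (q * x - D.g q * t)]
      have hM0 := D.M0
      rcases b with _ | _
      · refine ⟨D.hi, ⟨by simpa [lo] using D.lhi, le_rfl⟩, fun q hq' => (hq q hq').trans_lt ?_⟩
        have := hC' D.hi ⟨D.pl_lt, le_rfl⟩ x t hx ht
        have h2 := hG 0 y
        rw [zero_sub, abs_neg] at h2
        have h3 := neg_abs_le (D.hi * x - D.g D.hi * t)
        have h4 := le_abs_self (G 0 - G y)
        have h5 : (M + 1) * |y| ≤ max y 0 * D.e1 (D.g D.hi) + max (-y) 0 * D.e2 (D.g D.hi) := by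
          rw [D.ghi, D.e1_Φ, D.e2_Φ]
          rcases le_total 0 y with h | h
          · rw [abs_of_nonneg h, max_eq_left h, max_eq_right (by linarith)]; nlinarith [D.Mpl]
          · rw [abs_of_nonpos h, max_eq_right h, max_eq_left (by linarith)]; nlinarith [D.Mah]
        simp only [psi, ii, Bool.false_eq_true, if_false]
        nlinarith
      · refine ⟨D.pl, ⟨by simp [lo], D.pl_lt⟩, fun q hq' => (hq q hq').trans_lt ?_⟩
        have := hC' D.pl ⟨le_rfl, D.pl_lt⟩ x t hx ht
        have h2 := hG 0 |y|
        rw [zero_sub, abs_neg, abs_abs] at h2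
        have h3 := neg_abs_le (D.pl * x - D.g D.pl * t)
        have h4 := le_abs_self (G 0 - G |y|)
        have h5 : (M + 1) * |y| ≤ -D.pl * |y| := by nlinarith [D.Mpl, abs_nonneg y]
        simp only [psi, ii, if_true]
        nlinarith
  uniq := by
    rintro ⟨_ | _, y⟩ x t p q hx ht hp hq
    · simp only [lo] at hp hq
      exact D.int_uniq hx ht (by simpa using hp) (by simpa using hq)
    · have h1 := D.dir_strong ht.le (by simpa [lo] using hp) (show q ∈ Icc D.pl D.hi by simpa [lo] using hq.1)
      have h2 := hq.2 p hp.1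
      by_contra hne
      have : 0 < (q - p) ^ 2 := by positivity [sub_ne_zero.2 (Ne.symm hne)]
      have := mul_pos (mul_pos D.hg.pos ht) this
      linarith
  kap := a / (4 * D.glip.choose)
  kpos := div_pos D.hg.pos (by linarith [D.glip.choose_spec.1])
  strong := by
    have hL1 := D.glip.choose_spec.1
    rintro ⟨_ | _, y⟩ x t p q hx ht hp hq
    · have h1 := D.int_strong (by linarith) D.glip.choose_spec.2 hx.le (by simpa [lo] using hp) (by simpa [lo] using hq)
      have : a / (4 * D.glip.choose) * min x t * (q - p) ^ 2 ≤ a / (4 * D.glip.choose) * x * (q - p) ^ 2 := by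
        refine mul_le_mul_of_nonneg_right (mul_le_mul_of_nonneg_left (min_le_left _ _) ?_) (sq_nonneg _)
        exact div_nonneg D.hg.pos.le (by linarith)
      linarith
    · have h1 := D.dir_strong ht.le (by simpa [lo] using hp) (show q ∈ Icc D.pl D.hi by simpa [lo] using hq)
      have : a / (4 * D.glip.choose) * min x t * (q - p) ^ 2 ≤ a / 4 * t * (q - p) ^ 2 := by
        refine mul_le_mul_of_nonneg_right (mul_le_mul ?_ (min_le_right _ _) (le_min hx.le ht.le) (by linarith [D.hg.pos])) (sq_nonneg _)
        exact div_le_div_of_nonneg_left D.hg.pos.le (by norm_num) (by linarith)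
      linarith
  Lam := D.glip.choose
  Lpos := by linarith [D.glip.choose_spec.1]
  glip := D.glip.choose_spec.2

end Geo


namespace Fam
variable {Z : Type} [TopologicalSpace Z] (F : Fam Z)

lemma P_closed {ι : Type} (l : Ultrafilter ι) {x t p : ι → ℝ} {x' t' p' : ℝ} (hx : Tendsto x l (𝓝 x'))
    (ht : Tendsto t l (𝓝 t')) (hp : Tendsto p l (𝓝 p')) (h : ∀ᶠ n in (l : Filter ι), F.P (x n) (t n) (p n)) : F.P x' t' p' := by
  obtain ⟨K, hK, hk⟩ := F.coer' (max (|x'| + 1) (|t'| + 1))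
  have e1 : ∀ᶠ n in (l : Filter ι), |x n| ≤ |x'| + 1 := hx.abs.eventually (ge_mem_nhds (by linarith))
  have e2 : ∀ᶠ n in (l : Filter ι), |t n| ≤ |t'| + 1 := ht.abs.eventually (ge_mem_nhds (by linarith))
  have : ∀ n, ∃ z, F.P (x n) (t n) (p n) → F.ag (x n) (t n) z ∧ F.am z (x n) (t n) (p n) := fun n => by
    by_cases hq : F.P (x n) (t n) (p n)
    · obtain ⟨z, hz⟩ := hq; exact ⟨z, fun _ => hz⟩
    · obtain ⟨z, _⟩ := F.ag_ex x' t'; exact ⟨z, fun h => absurd h hq⟩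
  choose z hz using this
  obtain ⟨z', hz'⟩ := ultra_ex l hK (f := z) (by
    filter_upwards [e1, e2, h] with n h1 h2 h3
    exact (hk _ _ (h1.trans (le_max_left _ _)) (h2.trans (le_max_right _ _))).2.1 _ (hz n h3).1)
  exact ⟨z', F.ag_lim hz' hx ht (h.mono fun n hn => (hz n hn).1), F.am_lim hz' hx ht hp (h.mono fun n hn => (hz n hn).2)⟩

/-- the minimal slope -/
def sl (x t : ℝ) : ℝ := (F.P_min x t).choose
lemma sl_P (x t : ℝ) : F.P x t (F.sl x t) := (F.P_min x t).choose_spec.1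
lemma sl_le {x t p : ℝ} (h : F.P x t p) : F.sl x t ≤ p := (F.P_min x t).choose_spec.2 p h
lemma sl_abs (x t : ℝ) : |F.sl x t| ≤ F.R0 := F.abs_R (F.P_mem (F.sl_P x t))
lemma sl_meas : Measurable fun p : Pl => F.sl p.1 p.2 := by
  refine LowerSemicontinuous.measurable ?_
  rintro ⟨x, t⟩ y hy
  by_contra hc
  have hf : ∃ᶠ p : Pl in 𝓝 (x, t), ¬ y < F.sl p.1 p.2 := not_eventually.1 hc
  have hne := frequently_iff_neBot.1 hf
  have hll := Ultrafilter.of_le (𝓝 (x, t) ⊓ 𝓟 {p : Pl | ¬ y < F.sl p.1 p.2})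
  set l := Ultrafilter.of (𝓝 (x, t) ⊓ 𝓟 {p : Pl | ¬ y < F.sl p.1 p.2})
  have hl := hll.trans inf_le_left
  have hl' := hll.trans inf_le_right
  have e1 : ∀ᶠ p in (l : Filter Pl), ¬ y < F.sl p.1 p.2 := hl' (mem_principal_self _)
  obtain ⟨s, hs⟩ := ultra_ex l (isCompact_Icc (a := F.pl) (b := F.hi)) (f := fun p : Pl => F.sl p.1 p.2)
    (Eventually.of_forall fun p => F.P_mem (F.sl_P _ _))
  have h1 : Tendsto (fun p : Pl => p.1) l (𝓝 x) := (continuous_fst.tendsto (x, t)).mono_left hl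
  have h2 : Tendsto (fun p : Pl => p.2) l (𝓝 t) := (continuous_snd.tendsto (x, t)).mono_left hl
  have := F.sl_le (F.P_closed l h1 h2 hs (Eventually.of_forall fun p => F.sl_P _ _))
  have h3 := le_of_tendsto hs (e1.mono fun p hp => not_lt.1 hp)
  change y < F.sl x t at hy
  linarith
lemma sl_right {x t : ℝ} (hx : 0 ≤ x) (ht : 0 < t) : Tendsto (fun y => F.sl y t) (𝓝[>] x) (𝓝 (F.sl x t)) :=
  F.trace hx ht (F.sl_P x t) (fun _ h => F.sl_le h) fun y _ => F.sl_P y t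
lemma P_osl {x x' t d p p' : ℝ} (hd : 0 < d) (hx : d ≤ x) (hxx : x < x') (ht : d ≤ t) (hp : F.P x t p) (hp' : F.P x' t p') :
    p' - p ≤ 1 / (2 * (F.kap * d)) * (x' - x) := by
  have h1 := F.P_sc (by linarith) (by linarith) hp x' t
  have h2 := F.P_sc (by linarith) (by linarith) hp' x t
  simp only [sub_self, mul_zero, abs_zero, add_zero, sub_zero, sq_abs] at h1 h2
  have k : 0 < F.kap * d := mul_pos F.kpos hd
  have b1 : (x' - x) ^ 2 / (4 * (F.kap * min x t)) ≤ (x' - x) ^ 2 / (4 * (F.kap * d)) := by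
    refine div_le_div_of_nonneg_left (sq_nonneg _) (by linarith) ?_
    have := mul_le_mul_of_nonneg_left (le_min hx ht) F.kpos.le
    linarith
  have b2 : (x - x') ^ 2 / (4 * (F.kap * min x' t)) ≤ (x' - x) ^ 2 / (4 * (F.kap * d)) := by
    rw [show (x - x') ^ 2 = (x' - x) ^ 2 by ring]
    refine div_le_div_of_nonneg_left (sq_nonneg _) (by linarith) ?_
    have := mul_le_mul_of_nonneg_left (le_min (hx.trans hxx.le) ht) F.kpos.le
    linarith
  have e : (x' - x) ^ 2 / (4 * (F.kap * d)) = (1 / (4 * (F.kap * d)) * (x' - x)) * (x' - x) := by ring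
  have e2 : 1 / (2 * (F.kap * d)) * (x' - x) = 2 * (1 / (4 * (F.kap * d)) * (x' - x)) := by field_simp; ring
  rw [e2]
  rw [e] at b1 b2
  have : (p' - p) * (x' - x) ≤ 2 * (1 / (4 * (F.kap * d)) * (x' - x)) * (x' - x) := by nlinarith
  exact le_of_mul_le_mul_right this (by linarith)
lemma sl_left {x t : ℝ} (hx : 0 < x) (ht : 0 < t) : ∃ L, Tendsto (fun y => F.sl y t) (𝓝[<] x) (𝓝 L) := by
  set d := min (x / 2) t with hd
  have d0 : 0 < d := lt_min (by linarith) ht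
  set C := 1 / (2 * (F.kap * d))
  have am : Antitone fun y => F.sl (max y d) t - C * max y d := by
    intro y y' hy
    simp only
    rcases (max_le_max_right d hy).eq_or_lt with h | h
    · rw [h]
    · have := F.P_osl d0 (le_max_right y d) h (min_le_right _ _) (F.sl_P _ t) (F.sl_P _ t)
      change _ ≤ C * _ at this
      linarith
  have h1 := am.tendsto_nhdsLT x
  have h2 : Tendsto (fun y => C * max y d) (𝓝[<] x) (𝓝 (C * max x d)) :=
    ((by fun_prop : Continuous fun y => C * max y d).tendsto x).mono_left nhdsWithin_le_nhds
  refine ⟨_, (h1.add h2).congr' ?_⟩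
  have : ∀ᶠ y in 𝓝[<] x, d < y := nhdsWithin_le_nhds (lt_mem_nhds ((min_le_left _ _).trans_lt (by linarith)))
  filter_upwards [this] with y hy
  rw [max_eq_left hy.le]; ring

lemma P_grad {x t p : ℝ} (hx : 0 < x) (ht : 0 < t) (h : F.P x t p) (hd : DifferentiableAt ℝ F.V (x, t)) :
    dX F.V (x, t) = p ∧ dT F.V (x, t) = -F.g p := by
  have h1 := hd_x hd
  have h2 := hd_t hd
  simp only at h1 h2
  set c := 4 * (F.kap * min x t)
  constructor
  · have h3 := ((((hasDerivAt_id x).sub_const x).const_mul p).add ((((hasDerivAt_id x).sub_const x).pow 2).div_const c)).sub h1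
    have hm : IsLocalMin (fun y => (p * (y - x) + (y - x) ^ 2 / c) - F.V (y, t)) x := by
      refine Eventually.of_forall fun y => ?_
      have := F.P_sc hx ht h y t
      simp only [sub_self, mul_zero, abs_zero, add_zero, sub_zero, sq_abs] at this
      simp only [sub_self, mul_zero, ne_eq, OfNat.ofNat_ne_zero, not_false_eq_true, zero_pow, zero_div, add_zero, zero_sub]
      linarith
    have := hm.hasDerivAt_eq_zero h3
    simp at this
    linarith
  · have h3 := ((((hasDerivAt_id t).sub_const t).const_mul (-F.g p)).add (((((hasDerivAt_id t).sub_const t).const_mul F.Lam).pow 2).div_const c)).sub h2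
    have hm : IsLocalMin (fun y => (-F.g p * (y - t) + (F.Lam * (y - t)) ^ 2 / c) - F.V (x, y)) t := by
      refine Eventually.of_forall fun y => ?_
      have := F.P_sc hx ht h x y
      simp only [sub_self, mul_zero, abs_zero, zero_add, sub_zero, mul_pow, sq_abs] at this
      simp only [sub_self, mul_zero, ne_eq, OfNat.ofNat_ne_zero, not_false_eq_true, zero_pow, zero_div, add_zero, zero_sub, mul_pow]
      linarith
    have := hm.hasDerivAt_eq_zero h3
    simp at this
    linarith
lemma V_pde : ∀ᵐ p : Pl, p ∈ quad → dX F.V p = F.sl p.1 p.2 ∧ dT F.V p = -F.g (F.sl p.1 p.2) := by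
  obtain ⟨K, hK⟩ := F.V_lip
  filter_upwards [hK.ae_differentiableAt] with p hp hq
  exact F.P_grad hq.1 hq.2 (F.sl_P _ _) hp
/-- discrete semiconcavity -/
lemma V_semi {x x' t d k : ℝ} (hd : 0 < d) (hx : d ≤ x) (ht : d ≤ t) (hk : 0 < k) (hxx : x + k < x') :
    F.V (x' + k, t) - F.V (x', t) - (F.V (x + k, t) - F.V (x, t)) ≤ 1 / (2 * (F.kap * d)) * (x' - x) * k := by
  obtain ⟨p, hp⟩ := F.P_ex (x + k) t
  obtain ⟨q, hq⟩ := F.P_ex x' t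
  have h0 := F.P_osl hd (by linarith) hxx ht hp hq
  have h1 := F.P_sc (by linarith) (by linarith) hq (x' + k) t
  have h2 := F.P_sc (by linarith) (by linarith) hp x t
  simp only [sub_self, mul_zero, abs_zero, add_zero, sub_zero, sq_abs, add_sub_cancel_left, sub_add_cancel_left, even_two, Even.neg_pow] at h1 h2
  have kd : 0 < F.kap * d := mul_pos F.kpos hd
  have b1 : k ^ 2 / (4 * (F.kap * min x' t)) ≤ k ^ 2 / (4 * (F.kap * d)) := by
    refine div_le_div_of_nonneg_left (sq_nonneg _) (by linarith) ?_
    have := mul_le_mul_of_nonneg_left (le_min (show d ≤ x' by linarith) ht) F.kpos.le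
    linarith
  have b2 : k ^ 2 / (4 * (F.kap * min (x + k) t)) ≤ k ^ 2 / (4 * (F.kap * d)) := by
    refine div_le_div_of_nonneg_left (sq_nonneg _) (by linarith) ?_
    have := mul_le_mul_of_nonneg_left (le_min (show d ≤ x + k by linarith) ht) F.kpos.le
    linarith
  have e : k ^ 2 / (4 * (F.kap * d)) = 1 / (2 * (F.kap * d)) * k * k / 2 := by field_simp; ring
  rw [e] at b1 b2
  nlinarith [mul_le_mul_of_nonneg_right h0 hk.le]
end Fam


lemma mol_osl {V : Pl → ℝ} {K : ℝ≥0} (hV : LipschitzWith K V) {C d : ℝ}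
    (semi : ∀ x x' t k, d ≤ x → d ≤ t → 0 < k → x + k < x' →
      V (x' + k, t) - V (x', t) - (V (x + k, t) - V (x, t)) ≤ C * (x' - x) * k)
    (n : ℕ) {q : Pl} (h1 : d + 1 / ((n : ℝ) + 1) ≤ q.1) (h2 : d + 1 / ((n : ℝ) + 1) ≤ q.2) :
    dX (dX (mol n V)) q ≤ C := by
  have hc := hV.continuous
  have hsm := mol_smooth n hc
  have hW : Differentiable ℝ (mol n V) := hsm.differentiable (by simp)
  have hw : Differentiable ℝ (dX (mol n V)) :=
    ((hsm.fderiv_right (m := ∞) (by simp)).clm_apply contDiff_const).differentiable (by simp)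
  have s1 : ∀ x' k, q.1 + k < x' → 0 < k →
      mol n V (x' + k, q.2) - mol n V (x', q.2) - (mol n V (q.1 + k, q.2) - mol n V (q.1, q.2)) ≤ C * (x' - q.1) * k := by
    intro x' k hx hk
    have c : ∀ z : Pl, Continuous fun y : Pl => V (z - y) := fun z => by fun_prop
    have := avg_mono n (F := fun y => V ((x' + k, q.2) - y) + V (q - y))
      (H := fun y => (V ((x', q.2) - y) + V ((q.1 + k, q.2) - y)) + C * (x' - q.1) * k)
      ((c _).add (c _)) (((c _).add (c _)).add continuous_const) (by
        intro y hy
        have y1 : |y.1| < 1 / ((n : ℝ) + 1) := (norm_fst_le y).trans_lt hy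
        have y2 : |y.2| < 1 / ((n : ℝ) + 1) := (norm_snd_le y).trans_lt hy
        rw [abs_lt] at y1 y2
        have := semi (q.1 - y.1) (x' - y.1) (q.2 - y.2) k (by linarith) (by linarith) hk (by linarith)
        have e1 : ((x' + k, q.2) - y : Pl) = (x' - y.1 + k, q.2 - y.2) := by ext <;> simp; ring
        have e2 : ((q.1 + k, q.2) - y : Pl) = (q.1 - y.1 + k, q.2 - y.2) := by ext <;> simp; ring
        have e3 : ((x', q.2) - y : Pl) = (x' - y.1, q.2 - y.2) := by ext <;> simp
        have e4 : (q - y : Pl) = (q.1 - y.1, q.2 - y.2) := by ext <;> simp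
        rw [e1, e2, e3, e4]
        linarith [this, (by ring : C * (x' - y.1 - (q.1 - y.1)) * k = C * (x' - q.1) * k)])
    rw [avg_add n (c _) (c _), avg_add n (F := fun y => V ((x', q.2) - y) + V ((q.1 + k, q.2) - y)) ((c _).add (c _)) continuous_const, avg_add n (c _) (c _), avg_const] at this
    change mol n V (x' + k, q.2) + mol n V q ≤ mol n V (x', q.2) + mol n V (q.1 + k, q.2) + _ at this
    change _ - _ - (_ - mol n V q) ≤ _
    linarith
  have s2 : ∀ x', q.1 < x' → dX (mol n V) (x', q.2) - dX (mol n V) q ≤ C * (x' - q.1) := by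
    intro x' hx
    have l1 := (hd_x (hW (x', q.2))).tendsto_slope_zero_right
    have l2 := (hd_x (hW q)).tendsto_slope_zero_right
    refine le_of_tendsto (l1.sub l2) ?_
    have : ∀ᶠ k in 𝓝[>] (0 : ℝ), k < x' - q.1 := mem_nhdsWithin_of_mem_nhds (Iio_mem_nhds (by linarith))
    filter_upwards [this, self_mem_nhdsWithin] with k hk hk0
    have hk0 : 0 < k := hk0
    have := s1 x' k (by linarith) hk0
    simp only [smul_eq_mul]
    rw [← mul_sub, inv_mul_le_iff₀ hk0]
    linarith
  have l := (hd_x (hw q)).tendsto_slope_zero_right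
  refine le_of_tendsto l ?_
  filter_upwards [self_mem_nhdsWithin] with k hk0
  have hk0 : 0 < k := hk0
  have := s2 (q.1 + k) (by linarith)
  simp only [smul_eq_mul]
  rw [inv_mul_le_iff₀ hk0]
  change _ - dX (mol n V) q ≤ _
  linarith

lemma c1_of {b b' : ℝ → ℝ} (h : ∀ s, HasDerivAt b (b' s) s) (hc : Continuous b') : ContDiff ℝ 1 b := by
  rw [contDiff_one_iff_deriv]
  refine ⟨fun s => (h s).differentiableAt, ?_⟩
  rwa [(funext fun s => (h s).deriv : deriv b = b')]

lemma int_dT {φ : Pl → ℝ} (hφ : ContDiff ℝ 1 φ) (hc : HasCompactSupport φ) : ∫ p, dT φ p = 0 := by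
  have := weak_lip (W := fun p : Pl => p.1) LipschitzWith.prod_fst hφ hc
  simpa [dX, dT, fderiv_fst] using this
lemma int_dX {φ : Pl → ℝ} (hφ : ContDiff ℝ 1 φ) (hc : HasCompactSupport φ) : ∫ p, dX φ p = 0 := by
  have := weak_lip (W := fun p : Pl => p.2) LipschitzWith.prod_snd hφ hc
  simp only [dX, dT, fderiv_snd] at this
  simpa [integral_neg, dX] using this

lemma dX_cont {φ : Pl → ℝ} (hφ : ContDiff ℝ 1 φ) : Continuous (dX φ) :=
  (hφ.continuous_fderiv (by simp)).clm_apply continuous_const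
lemma dT_cont {φ : Pl → ℝ} (hφ : ContDiff ℝ 1 φ) : Continuous (dT φ) :=
  (hφ.continuous_fderiv (by simp)).clm_apply continuous_const
lemma cs_dX {φ : Pl → ℝ} (hc : HasCompactSupport φ) : HasCompactSupport (dX φ) :=
  HasCompactSupport.intro hc fun _ h => dX_zero h
lemma cs_dT {φ : Pl → ℝ} (hc : HasCompactSupport φ) : HasCompactSupport (dT φ) :=
  HasCompactSupport.intro hc fun _ h => dT_zero h

lemma kruz_id {W φ : Pl → ℝ} {g b b' η q : ℝ → ℝ} {a : ℝ} (hg : UC a g) (hW : ContDiff ℝ ∞ W)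
    (hφ : ContDiff ℝ 1 φ) (hc : HasCompactSupport φ)
    (hb : ∀ s, HasDerivAt b (b' s) s) (hb' : Continuous b') (hη : ∀ s, HasDerivAt η (b s) s)
    (hq : ∀ s, HasDerivAt q (b s * deriv g s) s) :
    ∫ p, (η (dX W p) * dT φ p + q (dX W p) * dX φ p) =
    ∫ p, (dT W p + g (dX W p)) * (b (dX W p) * dX φ p + φ p * (b' (dX W p) * dX (dX W) p)) := by
  have hb1 := c1_of hb hb'
  have hη1 := c1_of hη hb1.continuous
  have hq1 := c1_of hq (hb1.continuous.mul hg.smooth'.continuous)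
  have hf : ContDiff ℝ ∞ (fderiv ℝ W) := hW.fderiv_right (by simp)
  have hw : ContDiff ℝ ∞ (dX W) := hf.clm_apply contDiff_const
  have ht : ContDiff ℝ ∞ (dT W) := hf.clm_apply contDiff_const
  have hw1 : ContDiff ℝ 1 (dX W) := hw.of_le (by exact_mod_cast le_top)
  have ht1 : ContDiff ℝ 1 (dT W) := ht.of_le (by exact_mod_cast le_top)
  have sym : ∀ p, dT (dX W) p = dX (dT W) p := by
    intro p
    have hs := hW.contDiffAt (x := p) |>.isSymmSndFDerivAt (by simpa using WithTop.coe_le_coe.2 (le_top : (2 : ℕ∞) ≤ ⊤))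
    have hdf : DifferentiableAt ℝ (fderiv ℝ W) p := hf.differentiable (by simp) p
    have e : ∀ v w, fderiv ℝ (fun p => fderiv ℝ W p v) p w = fderiv ℝ (fderiv ℝ W) p w v := by
      intro v w
      rw [fderiv_clm_apply hdf (differentiableAt_const _)]; simp
    unfold dT dX
    rw [e, e]
    exact (hs _ _)
  have g1 : ContDiff ℝ 1 g := hg.smooth.of_le (by norm_num)
  have p1 : ContDiff ℝ 1 fun p => φ p * η (dX W p) := hφ.mul (hη1.comp hw1)
  have p2 : ContDiff ℝ 1 fun p => φ p * q (dX W p) := hφ.mul (hq1.comp hw1)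
  have p3 : ContDiff ℝ 1 fun p => φ p * (b (dX W p) * (dT W p + g (dX W p))) :=
    hφ.mul ((hb1.comp hw1).mul (ht1.add (g1.comp hw1)))
  have i1 := int_dT p1 hc.mul_right
  have i2 := int_dX p2 hc.mul_right
  have i3 := int_dX p3 hc.mul_right
  have j1 := (dT_cont p1).integrable_of_hasCompactSupport (μ := volume) (cs_dT hc.mul_right)
  have j2 := (dX_cont p2).integrable_of_hasCompactSupport (μ := volume) (cs_dX hc.mul_right)
  have j3 := (dX_cont p3).integrable_of_hasCompactSupport (μ := volume) (cs_dX hc.mul_right)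
  have hφd := hφ.differentiable (by simp)
  have hwd := hw1.differentiable (by simp)
  have htd := ht1.differentiable (by simp)
  have key : ∀ p, (η (dX W p) * dT φ p + q (dX W p) * dX φ p) -
      (dT W p + g (dX W p)) * (b (dX W p) * dX φ p + φ p * (b' (dX W p) * dX (dX W) p)) =
      dT (fun p => φ p * η (dX W p)) p + dX (fun p => φ p * q (dX W p)) p -
        dX (fun p => φ p * (b (dX W p) * (dT W p + g (dX W p)))) p := by
    intro p
    have e1 := (hd_t (p1.differentiable (by simp) p)).unique
      ((hd_t (hφd p)).mul ((hη (dX W p)).comp p.2 (hd_t (hwd p))))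
    have e2 := (hd_x (p2.differentiable (by simp) p)).unique
      ((hd_x (hφd p)).mul ((hq (dX W p)).comp p.1 (hd_x (hwd p))))
    have e3 := (hd_x (p3.differentiable (by simp) p)).unique
      ((hd_x (hφd p)).mul (((hb (dX W p)).comp p.1 (hd_x (hwd p))).mul
        ((hd_x (htd p)).add (((hg.diff (dX W p)).hasDerivAt).comp p.1 (hd_x (hwd p))))))
    rw [e1, e2, e3, sym p]
    simp only [Prod.mk.eta, Pi.mul_apply, Pi.add_apply, Function.comp]
    ring
  have c1 : Integrable fun p => η (dX W p) * dT φ p + q (dX W p) * dX φ p := by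
    refine Continuous.integrable_of_hasCompactSupport ?_ ?_
    · exact ((hη1.continuous.comp hw1.continuous).mul (dT_cont hφ)).add ((hq1.continuous.comp hw1.continuous).mul (dX_cont hφ))
    · exact (cs_dT hc).mul_left.add (cs_dX hc).mul_left
  have c2 : Integrable fun p => (dT W p + g (dX W p)) * (b (dX W p) * dX φ p + φ p * (b' (dX W p) * dX (dX W) p)) := by
    refine Continuous.integrable_of_hasCompactSupport ?_ ?_
    · have := dX_cont hw1
      have := dX_cont hφ
      have := hw1.continuous
      have := ht1.continuous
      have := hg.cont
      have := hb1.continuous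
      have := hφ.continuous
      fun_prop
    · exact ((cs_dX hc).mul_left.add hc.mul_right).mul_left
  have : ∫ p, ((η (dX W p) * dT φ p + q (dX W p) * dX φ p) -
      (dT W p + g (dX W p)) * (b (dX W p) * dX φ p + φ p * (b' (dX W p) * dX (dX W) p))) = 0 := by
    simp_rw [key]
    exact (integral_sub (j1.add j2) j3).trans (by rw [i3]; exact (congrArg (· - (0:ℝ)) (integral_add j1 j2)).trans (by rw [i1, i2]; simp))
  rw [integral_sub c1 c2] at this
  linarith

lemma subS_of_pde {a : ℝ} {g : ℝ → ℝ} {U u : Pl → ℝ} {K : ℝ≥0} (hg : UC a g) (hK : LipschitzWith K U)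
    (pde : ∀ᵐ p, p ∈ quad → dX U p = u p ∧ dT U p = -g (u p)) : SubS g U := by
  intro p x t r hr hx hx' ht
  have := lemE hK quad_open (v := (deriv g p, 1)) (p := (x - deriv g p * r, t - r)) (r := r)
    (c := p * deriv g p - g p) (by
      filter_upwards [pde] with q hq hqq
      obtain ⟨h1, h2⟩ := hq hqq
      have e : fderiv ℝ U q (deriv g p, 1) = deriv g p * dX U q + dT U q := by
        have : ((deriv g p, 1) : Pl) = deriv g p • ((1 : ℝ), (0 : ℝ)) + ((0 : ℝ), (1 : ℝ)) := by simp
        rw [this, map_add, map_smul]; rfl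
      rw [e, h1, h2]
      have := hg.tangent p (u q)
      nlinarith [mul_nonneg hg.pos.le (sq_nonneg (u q - p))]) hr (by
      intro s hs
      constructor
      · simp only [Prod.smul_mk, smul_eq_mul, Prod.mk_add_mk]
        rcases le_total 0 (deriv g p) with h0 | h0
        · nlinarith [hs.1]
        · nlinarith [hs.2]
      · simp only [Prod.smul_mk, smul_eq_mul, Prod.mk_add_mk]; linarith [hs.1])
  simp only [Prod.smul_mk, smul_eq_mul, Prod.mk_add_mk, mul_one, sub_add_cancel] at this
  rw [mul_comm r (deriv g p), sub_add_cancel] at this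
  linarith

lemma kruz_b {a : ℝ} {g b b' η q : ℝ → ℝ} {V u φ : Pl → ℝ} {K : ℝ≥0} (hg : UC a g) (hV : LipschitzWith K V)
    (pde : ∀ᵐ p, p ∈ quad → dX V p = u p ∧ dT V p = -g (u p))
    (semi : ∀ d, 0 < d → ∃ C, 0 ≤ C ∧ ∀ x x' t k, d ≤ x → d ≤ t → 0 < k → x + k < x' →
      V (x' + k, t) - V (x', t) - (V (x + k, t) - V (x, t)) ≤ C * (x' - x) * k)
    (hb : ∀ s, HasDerivAt b (b' s) s) (hb' : Continuous b') (hb0 : ∀ s, 0 ≤ b' s) (hη : ∀ s, HasDerivAt η (b s) s)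
    (hq : ∀ s, HasDerivAt q (b s * deriv g s) s)
    (hφ : ContDiff ℝ 1 φ) (hc : HasCompactSupport φ) (h0 : ∀ p, 0 ≤ φ p) (hs : tsupport φ ⊆ quad) :
    0 ≤ ∫ p, (η (u p) * dT φ p + q (u p) * dX φ p) := by
  obtain ⟨δ, hδ, hδO⟩ := IsCompact.exists_cthickening_subset_open hc quad_open hs
  have hsup : ∀ p ∈ tsupport φ, δ < p.1 ∧ δ < p.2 := by
    intro p hp
    have : (p.1 - δ, p.2 - δ) ∈ quad := hδO (Metric.mem_cthickening_of_dist_le _ p δ _ hp (by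
      rw [Prod.dist_eq]; simp [Real.dist_eq, abs_of_pos hδ]))
    exact ⟨by linarith [this.1], by linarith [this.2]⟩
  obtain ⟨C, hC0, hC⟩ := semi (δ / 2) (by linarith)
  have hb1 := c1_of hb hb'
  have hη1 := c1_of hη hb1.continuous
  have hq1 := c1_of hq (hb1.continuous.mul hg.smooth'.continuous)
  have bdK : ∀ f : ℝ → ℝ, Continuous f → ∃ E, 0 ≤ E ∧ ∀ s : ℝ, |s| ≤ K → |f s| ≤ E := by
    intro f hf
    obtain ⟨E, hE⟩ := (isCompact_Icc (a := -(K:ℝ)) (b := K)).exists_bound_of_continuousOn hf.continuousOn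
    exact ⟨max E 0, le_max_right _ _, fun s hs => (hE s (abs_le.1 hs)).trans (le_max_left _ _)⟩
  obtain ⟨Eη, nη, eη⟩ := bdK η hη1.continuous
  obtain ⟨Eq, nq, eq⟩ := bdK q hq1.continuous
  obtain ⟨Eb, nb, eb⟩ := bdK b hb1.continuous
  obtain ⟨Eb', nb', eb'⟩ := bdK b' hb'
  obtain ⟨Eg, ng, eg⟩ := bdK g hg.cont
  obtain ⟨L, hL⟩ := hφ.lipschitzWith_of_hasCompactSupport hc (by simp)
  obtain ⟨Cφ, hCφ⟩ := hc.exists_bound_of_continuous hφ.continuous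
  have nφ : 0 ≤ Cφ := (norm_nonneg _).trans (hCφ 0)
  have sm : ∀ n, ContDiff ℝ ∞ (mol n V) := fun n => mol_smooth n hV.continuous
  have c1 : ∀ n, ContDiff ℝ 1 (mol n V) := fun n => (sm n).of_le (by exact_mod_cast le_top)
  have cX : ∀ n, Continuous (dX (mol n V)) := fun n => dX_cont (c1 n)
  have cT : ∀ n, Continuous (dT (mol n V)) := fun n => dT_cont (c1 n)
  have bX : ∀ n p, |dX (mol n V) p| ≤ K := fun n p => dX_le (mol_lip n hV) p
  have bT : ∀ n p, |dT (mol n V) p| ≤ K := fun n p => dT_le (mol_lip n hV) p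
  have cφX := dX_cont hφ
  have cφT := dT_cont hφ
  have := hg.cont
  have := hb1.continuous
  have := hη1.continuous
  have := hq1.continuous
  have := hφ.continuous
  have l1 : Tendsto (fun n => ∫ p, (η (dX (mol n V) p) * dT φ p + q (dX (mol n V) p) * dX φ p)) atTop
      (𝓝 (∫ p, (η (u p) * dT φ p + q (u p) * dX φ p))) := by
    refine tendsto_integral_of_dominated_convergence ((tsupport φ).indicator fun _ => Eη * L + Eq * L)
      (fun n => Continuous.aestronglyMeasurable (by have := cX n; fun_prop)) (cpt_ind hc _) ?_ ?_
    · refine fun n => Eventually.of_forall fun p => ?_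
      by_cases hp : p ∈ tsupport φ
      · rw [indicator_of_mem hp]
        refine (norm_add_le _ _).trans (add_le_add ?_ ?_) <;> rw [norm_mul]
        · exact mul_le_mul (eη _ (bX n p)) (dT_le hL p) (abs_nonneg _) nη
        · exact mul_le_mul (eq _ (bX n p)) (dX_le hL p) (abs_nonneg _) nq
      · rw [dX_zero hp, dT_zero hp, indicator_of_notMem hp]; simp
    · filter_upwards [pde, mol_tendsto (1, 0) hV] with p hp hl
      by_cases hps : p ∈ tsupport φ
      · have hl : Tendsto (fun n => dX (mol n V) p) atTop (𝓝 (u p)) := by rw [← (hp (hs hps)).1]; exact hl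
        exact (((hη1.continuous.tendsto _).comp hl).mul_const _).add (((hq1.continuous.tendsto _).comp hl).mul_const _)
      · rw [dX_zero hps, dT_zero hps]; simp
  have l2 : Tendsto (fun n => ∫ p, (dT (mol n V) p + g (dX (mol n V) p)) *
      (b (dX (mol n V) p) * dX φ p + φ p * (b' (dX (mol n V) p) * C))) atTop (𝓝 (∫ _ : Pl, (0 : ℝ))) := by
    refine tendsto_integral_of_dominated_convergence
      ((tsupport φ).indicator fun _ => (K + Eg) * (Eb * L + Cφ * (Eb' * C)))
      (fun n => Continuous.aestronglyMeasurable (by have := cX n; have := cT n; fun_prop)) (cpt_ind hc _) ?_ ?_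
    · refine fun n => Eventually.of_forall fun p => ?_
      by_cases hp : p ∈ tsupport φ
      · rw [indicator_of_mem hp, norm_mul]
        refine mul_le_mul ((norm_add_le _ _).trans (add_le_add (bT n p) (eg _ (bX n p)))) ?_ (norm_nonneg _) (by positivity)
        refine (norm_add_le _ _).trans (add_le_add ?_ ?_) <;> rw [norm_mul]
        · exact mul_le_mul (eb _ (bX n p)) (dX_le hL p) (abs_nonneg _) nb
        · refine mul_le_mul (hCφ p) ?_ (norm_nonneg _) nφ
          rw [norm_mul, Real.norm_of_nonneg hC0]
          exact mul_le_mul_of_nonneg_right (eb' _ (bX n p)) hC0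
      · rw [dX_zero hp, image_eq_zero_of_notMem_tsupport hp, indicator_of_notMem hp]; simp
    · filter_upwards [pde, mol_tendsto (1, 0) hV, mol_tendsto (0, 1) hV] with p hp hl hl'
      by_cases hps : p ∈ tsupport φ
      · obtain ⟨k1, k2⟩ := hp (hs hps)
        have hl : Tendsto (fun n => dX (mol n V) p) atTop (𝓝 (u p)) := by rw [← k1]; exact hl
        have hl' : Tendsto (fun n => dT (mol n V) p) atTop (𝓝 (-g (u p))) := by rw [← k2]; exact hl'
        have := (hl'.add ((hg.cont.tendsto _).comp hl)).mul ((((hb1.continuous.tendsto _).comp hl).mul_const (dX φ p)).add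
          ((((hb'.tendsto _).comp hl).mul_const C).const_mul (φ p)))
        simpa using this
      · rw [dX_zero hps, image_eq_zero_of_notMem_tsupport hps]; simp
  rw [integral_zero] at l2
  obtain ⟨N, hN⟩ := exists_nat_one_div_lt (half_pos hδ)
  have hS := subS_of_pde hg hV pde
  refine le_of_tendsto_of_tendsto l2 l1 ?_
  filter_upwards [eventually_ge_atTop N] with n hn
  have hn' : 1 / ((n : ℝ) + 1) < δ / 2 := lt_of_le_of_lt (by
    apply one_div_le_one_div_of_le (by positivity); exact_mod_cast Nat.succ_le_succ hn) hN
  change _ ≤ ∫ p, (η (dX (mol n V) p) * dT φ p + q (dX (mol n V) p) * dX φ p)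
  rw [kruz_id hg (sm n) hφ hc hb hb' hη hq]
  have cXX : Continuous (dX (dX (mol n V))) := by
    have : ContDiff ℝ ∞ (dX (mol n V)) := ((sm n).fderiv_right (m := ∞) (by simp)).clm_apply contDiff_const
    exact dX_cont (this.of_le (by exact_mod_cast le_top))
  have := cX n
  have := cT n
  refine integral_mono ?_ ?_ fun p => ?_
  · exact Continuous.integrable_of_hasCompactSupport (by fun_prop) ((cs_dX hc).mul_left.add hc.mul_right).mul_left
  · exact Continuous.integrable_of_hasCompactSupport (by fun_prop) ((cs_dX hc).mul_left.add hc.mul_right).mul_left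
  · by_cases hp : p ∈ tsupport φ
    · obtain ⟨z1, z2⟩ := hsup p hp
      have r0 := mol_sub hV hS n (q := p) (by linarith) (by linarith)
      have x0 := mol_osl hV hC n (q := p) (by linarith) (by linarith)
      refine mul_le_mul_of_nonpos_left ?_ r0
      have := mul_le_mul_of_nonneg_left (mul_le_mul_of_nonneg_left x0 (hb0 (dX (mol n V) p))) (h0 p)
      linarith
    · simp [dX_zero hp, image_eq_zero_of_notMem_tsupport hp]

def bm (k : ℝ) (m : ℕ) (s : ℝ) : ℝ := 2 / Real.pi * Real.arctan ((m : ℝ) * (s - k))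
lemma bm_hd (k : ℝ) (m : ℕ) (s : ℝ) :
    HasDerivAt (bm k m) (2 / Real.pi * (1 / (1 + ((m : ℝ) * (s - k)) ^ 2) * ((m : ℝ) * 1))) s :=
  ((((hasDerivAt_id s).sub_const k).const_mul (m : ℝ)).arctan).const_mul _
lemma bm_cont (k : ℝ) (m : ℕ) : Continuous (bm k m) :=
  continuous_iff_continuousAt.2 fun s => (bm_hd k m s).continuousAt
lemma bm_le (k : ℝ) (m : ℕ) (s : ℝ) : |bm k m s| ≤ 1 := by
  have h1 := Real.arctan_lt_pi_div_two ((m : ℝ) * (s - k))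
  have h2 := Real.neg_pi_div_two_lt_arctan ((m : ℝ) * (s - k))
  have hp := Real.pi_pos
  rw [bm, abs_mul, abs_of_pos (by positivity)]
  have : |Real.arctan ((m : ℝ) * (s - k))| ≤ Real.pi / 2 := abs_le.2 ⟨by linarith, h1.le⟩
  calc _ ≤ 2 / Real.pi * (Real.pi / 2) := by gcongr
    _ = 1 := by field_simp
lemma bm_lim {k s : ℝ} (h : s ≠ k) : Tendsto (fun m => bm k m s) atTop (𝓝 (Real.sign (s - k))) := by
  have hp := Real.pi_pos
  have hn : Tendsto (fun m : ℕ => (m : ℝ)) atTop atTop := tendsto_natCast_atTop_atTop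
  rcases lt_or_gt_of_ne h with h | h
  · rw [Real.sign_of_neg (by linarith)]
    have := ((Real.tendsto_arctan_atBot.mono_right nhdsWithin_le_nhds).comp
      (hn.atTop_mul_const_of_neg (r := s - k) (by linarith))).const_mul (2 / Real.pi)
    have e : 2 / Real.pi * (Real.pi / 2) = 1 := by field_simp
    first | rw [mul_neg, e] at this | rw [e] at this
    exact this
  · rw [Real.sign_of_pos (by linarith)]
    have := ((Real.tendsto_arctan_atTop.mono_right nhdsWithin_le_nhds).comp
      (hn.atTop_mul_const (r := s - k) (by linarith))).const_mul (2 / Real.pi)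
    have e : 2 / Real.pi * (Real.pi / 2) = 1 := by field_simp
    first | rw [mul_neg, e] at this | rw [e] at this
    exact this
lemma bm_int_lim {h : ℝ → ℝ} (hh : Continuous h) (k s : ℝ) :
    Tendsto (fun m => ∫ τ in k..s, bm k m τ * h τ) atTop (𝓝 (Real.sign (s - k) * ∫ τ in k..s, h τ)) := by
  rw [← intervalIntegral.integral_const_mul]
  refine intervalIntegral.tendsto_integral_filter_of_dominated_convergence (fun τ => |h τ|) ?_ ?_ ?_ ?_
  · exact Eventually.of_forall fun m => ((bm_cont k m).mul hh).aestronglyMeasurable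
  · refine Eventually.of_forall fun m => Eventually.of_forall fun τ _ => ?_
    rw [norm_mul]
    exact mul_le_of_le_one_left (abs_nonneg _) (bm_le k m τ)
  · exact hh.abs.intervalIntegrable _ _
  · have : ∀ᵐ τ : ℝ, τ ≠ k := by simp [ae_iff, measure_singleton]
    filter_upwards [this] with τ hτ hm
    refine Tendsto.mul_const _ ?_
    convert bm_lim hτ using 2
    rcases lt_or_ge k s with h1 | h1
    · rw [uIoc_of_le h1.le] at hm
      rw [Real.sign_of_pos (by linarith), Real.sign_of_pos (by linarith [hm.1])]
    · rw [uIoc_of_ge h1] at hm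
      have : τ < k := lt_of_le_of_ne hm.2 hτ
      rw [Real.sign_of_neg (by linarith [hm.1]), Real.sign_of_neg (by linarith)]

lemma kruz {a : ℝ} {g : ℝ → ℝ} {V u : Pl → ℝ} {K : ℝ≥0} (hg : UC a g) (hV : LipschitzWith K V)
    (mu : Measurable u) {M : ℝ} (bu : ∀ p, |u p| ≤ M)
    (pde : ∀ᵐ p, p ∈ quad → dX V p = u p ∧ dT V p = -g (u p))
    (semi : ∀ d, 0 < d → ∃ C, 0 ≤ C ∧ ∀ x x' t k, d ≤ x → d ≤ t → 0 < k → x + k < x' →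
      V (x' + k, t) - V (x', t) - (V (x + k, t) - V (x, t)) ≤ C * (x' - x) * k) (k : ℝ) :
    EntOn quad (fun p => |u p - k|) (fun p => Real.sign (u p - k) * (g (u p) - g k)) := by
  intro φ hφ hc h0 hs
  have ig : ∀ h : ℝ → ℝ, Continuous h → ∀ m s, HasDerivAt (fun s => ∫ τ in k..s, bm k m τ * h τ) (bm k m s * h s) s := by
    intro h hh m s
    exact (Continuous.integral_hasStrictDerivAt ((bm_cont k m).mul hh) k s).hasDerivAt
  have g' := hg.smooth'.continuous
  have main : ∀ m : ℕ, 0 ≤ ∫ p, ((∫ τ in k..u p, bm k m τ * 1) * dT φ p + (∫ τ in k..u p, bm k m τ * deriv g τ) * dX φ p) := by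
    intro m
    refine kruz_b (b := bm k m) hg hV pde semi (bm_hd k m) ?_ ?_
      (η := fun s => ∫ τ in k..s, bm k m τ * 1) (q := fun s => ∫ τ in k..s, bm k m τ * deriv g τ)
      (fun s => by have := ig (fun _ => 1) continuous_const m s; rwa [mul_one] at this) (fun s => ig _ g' m s) hφ hc h0 hs
    · have : ∀ s : ℝ, 1 + ((m : ℝ) * (s - k)) ^ 2 ≠ 0 := fun s => by positivity
      fun_prop (disch := assumption)
    · intro s; have := Real.pi_pos; positivity
  have bdd : ∀ h : ℝ → ℝ, Continuous h → ∃ E, 0 ≤ E ∧ ∀ m s, |s| ≤ M → |∫ τ in k..s, bm k m τ * h τ| ≤ E := by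
    intro h hh
    obtain ⟨E, hE⟩ := (isCompact_Icc (a := -(max M |k|)) (b := max M |k|)).exists_bound_of_continuousOn hh.continuousOn
    refine ⟨max E 0 * (M + |k|), ?_, fun m s hs => ?_⟩
    · exact mul_nonneg (le_max_right _ _) (add_nonneg ((abs_nonneg _).trans (bu 0)) (abs_nonneg _))
    · have := intervalIntegral.norm_integral_le_of_norm_le_const (a := k) (b := s) (f := fun τ => bm k m τ * h τ) (C := max E 0) (by
        intro τ hτ
        rw [norm_mul]
        refine (mul_le_of_le_one_left (norm_nonneg _) (bm_le k m τ)).trans ((hE τ ?_).trans (le_max_left _ _))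
        have h1 : |τ| ≤ max M |k| := by
          have hτ := uIoc_subset_uIcc hτ
          rw [abs_le]
          have q1 := abs_le.1 (hs.trans (le_max_left M |k|))
          have q2 := abs_le.1 (le_max_right M |k|)
          rw [mem_uIcc] at hτ
          rcases hτ with hτ | hτ <;> constructor <;> linarith [hτ.1, hτ.2]
        exact abs_le.1 h1)
      refine this.trans (mul_le_mul_of_nonneg_left ((abs_sub _ _).trans ?_) (le_max_right _ _))
      linarith
  obtain ⟨E1, n1, e1⟩ := bdd (fun _ => 1) continuous_const
  obtain ⟨E2, n2, e2⟩ := bdd _ g'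
  obtain ⟨L, hL⟩ := hφ.lipschitzWith_of_hasCompactSupport hc (by simp)
  have mI : ∀ h : ℝ → ℝ, Continuous h → ∀ m, Measurable fun p => ∫ τ in k..u p, bm k m τ * h τ := by
    intro h hh m
    have : Continuous fun s => ∫ τ in k..s, bm k m τ * h τ :=
      continuous_iff_continuousAt.2 fun s => (ig h hh m s).continuousAt
    exact this.measurable.comp mu
  refine ge_of_tendsto' (x := atTop) (f := fun m : ℕ => ∫ p, ((∫ τ in k..u p, bm k m τ * 1) * dT φ p + (∫ τ in k..u p, bm k m τ * deriv g τ) * dX φ p)) ?_ main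
  refine tendsto_integral_of_dominated_convergence ((tsupport φ).indicator fun _ => E1 * L + E2 * L)
      (fun m => (test_meas (mI _ continuous_const m) (mI _ g' m) φ).aestronglyMeasurable) (cpt_ind hc _) ?_ ?_
  · refine fun n => Eventually.of_forall fun p => ?_
    by_cases hp : p ∈ tsupport φ
    · rw [indicator_of_mem hp]
      refine (norm_add_le _ _).trans (add_le_add ?_ ?_) <;> rw [norm_mul]
      · exact mul_le_mul (e1 _ _ (bu p)) (dT_le hL p) (abs_nonneg _) n1
      · exact mul_le_mul (e2 _ _ (bu p)) (dX_le hL p) (abs_nonneg _) n2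
    · rw [dX_zero hp, dT_zero hp, indicator_of_notMem hp]; simp
  · refine Eventually.of_forall fun p => ?_
    have t1 := bm_int_lim (h := fun _ => (1:ℝ)) continuous_const k (u p)
    have t2 := bm_int_lim g' k (u p)
    rw [intervalIntegral.integral_deriv_eq_sub (fun x _ => hg.diff x) (g'.intervalIntegrable _ _)] at t2
    have : Real.sign (u p - k) * ∫ _τ in k..u p, (1:ℝ) = |u p - k| := by
      rw [intervalIntegral.integral_const, smul_eq_mul, mul_one]
      exact sign_mul_self' _
    rw [this] at t1
    exact (t1.mul_const _).add (t2.mul_const _)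


namespace Geo
lemma hGn {M : ℝ} (G : ℝ → ℝ) (hG : ∀ x y, |G x - G y| ≤ M * |x - y|) : ∀ x y, |(fun y => G (-y)) x - (fun y => G (-y)) y| ≤ M * |x - y| := by
  intro x y
  have := hG (-x) (-y)
  rwa [show -x - -y = -(x - y) by ring, abs_neg] at this

variable {a M : ℝ} (D : Geo a M) (G : ℝ → ℝ) (hG : ∀ x y, |G x - G y| ≤ M * |x - y|)
abbrev famL : Fam (Bool × ℝ) := D.refl.fam (fun y => G (-y)) (hGn G hG)

lemma fam_congr {D D' : Geo a M} (h : D = D') {G G' : ℝ → ℝ} (h' : G = G') (hG) (hG') : D.fam G hG = D'.fam G' hG' := by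
  subst h; subst h'; rfl
lemma famL_refl : D.refl.famL (fun y => G (-y)) (hGn G hG) = D.fam G hG :=
  fam_congr D.refl_refl (by simp) _ _

def J (y t F : ℝ) : ℝ := -(F * t) + max y 0 * D.e1 F + max (-y) 0 * D.e2 F
lemma refl_J (y t F : ℝ) : D.refl.J (-y) t F = D.J y t F := by
  simp only [J, refl_e1, refl_e2, neg_neg]; ring
lemma ps_int (y x t p : ℝ) : (D.fam G hG).ps (false, y) x t p = p * x + D.J y t (D.g p) := by
  simp [Fam.ps, psi, fam, ii, J]; ring
lemma ps_dir (y x t p : ℝ) : (D.fam G hG).ps (true, y) x t p = p * x - D.g p * t - p * |y| := by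
  simp [Fam.ps, psi, fam, ii]; ring
lemma lo_int (y : ℝ) : (D.fam G hG).lo (false, y) = D.B := rfl
lemma lo_dir (y : ℝ) : (D.fam G hG).lo (true, y) = D.pl := rfl
lemma a_int (y : ℝ) : (D.fam G hG).a (false, y) = G y := rfl
lemma a_dir (y : ℝ) : (D.fam G hG).a (true, y) = G |y| := rfl
lemma hi_eq : (D.fam G hG).hi = D.hi := rfl
lemma pl_eq : (D.fam G hG).pl = D.pl := rfl
lemma c_int_iff {y x t v : ℝ} : (D.fam G hG).c (false, y) x t ≤ v ↔
    ∀ F ∈ Icc (D.g D.B) D.Φ, D.e0 F * x + D.J y t F ≤ v := by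
  constructor
  · intro h F hF
    have hs := D.e0_spec hF.1
    refine le_trans ?_ h
    have := (D.fam G hG).le_c (z := (false, y)) (x := x) (t := t) (p := D.e0 F) ⟨hs.1, D.e0_le hF.2⟩
    rwa [ps_int, hs.2] at this
  · intro h
    obtain ⟨p, hp⟩ := (D.fam G hG).am_ex (false, y) x t
    rw [(D.fam G hG).am_val hp, ps_int]
    have h1 : D.B ≤ p := hp.1.1
    have := h (D.g p) ⟨D.g_ge h1, D.g_le h1 hp.1.2⟩
    rwa [D.e0_eq h1] at this
lemma c_dir_iff {y x t v : ℝ} : (D.fam G hG).c (true, y) x t ≤ v ↔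
    ∀ p ∈ Icc D.pl D.hi, p * x - D.g p * t - p * |y| ≤ v := by
  constructor
  · intro h p hp
    refine le_trans ?_ h
    have := (D.fam G hG).le_c (z := (true, y)) (x := x) (t := t) (p := p) hp
    rwa [ps_dir] at this
  · intro h
    obtain ⟨p, hp⟩ := (D.fam G hG).am_ex (true, y) x t
    rw [(D.fam G hG).am_val hp, ps_dir]
    exact h p hp.1
lemma γ_refl : D.refl.g D.refl.B = D.g D.B := by
  simp only [refl, neg_neg]; exact D.eA
lemma Φ_refl : D.refl.Φ = D.Φ := rfl
lemma c_int_refl (y t : ℝ) : (D.famL G hG).c (false, -y) 0 t = (D.fam G hG).c (false, y) 0 t := by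
  refine eq_of_forall_ge_iff fun v => ?_
  rw [c_int_iff, c_int_iff, γ_refl, Φ_refl]
  simp [refl_J]
lemma int_le_dir (y t : ℝ) : (D.fam G hG).c (false, |y|) 0 t ≤ (D.fam G hG).c (true, y) 0 t := by
  rw [c_int_iff]
  intro F hF
  have hs := D.e1_spec hF.1
  have := ((D.c_dir_iff G hG (y := y) (x := 0) (t := t)).1 le_rfl) (-D.e1 F)
    ⟨by linarith [D.e1_le hF.2], hs.1.trans (D.lBb.trans D.lhi)⟩
  rw [hs.2] at this
  simp only [J]
  rw [max_eq_left (abs_nonneg y), max_eq_right (by linarith [abs_nonneg y] : -|y| ≤ 0)]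
  linarith
lemma int_ag (t : ℝ) : ∃ y, (D.fam G hG).ag 0 t (false, y) := by
  obtain ⟨⟨b, y⟩, h⟩ := (D.fam G hG).ag_ex 0 t
  rcases b with _ | _
  · exact ⟨y, h⟩
  · refine ⟨|y|, le_antisymm ((D.fam G hG).V_le _ _ _) ?_⟩
    rw [h, a_int, a_dir]
    have := D.int_le_dir G hG y t
    linarith
lemma V0_le (t : ℝ) : (D.famL G hG).V (0, t) ≤ (D.fam G hG).V (0, t) := by
  obtain ⟨y, h⟩ := D.int_ag G hG t
  have := (D.famL G hG).V_le 0 t (false, -y)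
  rw [h, ← c_int_refl]
  rw [a_int] at this ⊢
  simpa using this
lemma V0_eq (t : ℝ) : (D.famL G hG).V (0, t) = (D.fam G hG).V (0, t) := by
  refine le_antisymm (D.V0_le G hG t) ?_
  have := D.refl.V0_le _ (hGn G hG) t
  rwa [famL_refl] at this

lemma a_le_iff {v x t : ℝ} : v ≤ (D.fam G hG).V (x, t) ↔ ∀ z, v ≤ (D.fam G hG).a z + (D.fam G hG).c z x t := by
  constructor
  · intro h z; exact h.trans ((D.fam G hG).V_le x t z)
  · intro h
    obtain ⟨z, hz⟩ := (D.fam G hG).ag_ex x t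
    rw [hz]; exact h z

/-- lower bounds of kernels -/
lemma int_low (y x t : ℝ) (hx : 0 ≤ x) : (M + 1) * (x + |y|) - D.Φ * t ≤ (D.fam G hG).c (false, y) x t := by
  have := ((D.c_int_iff G hG (y := y) (x := x) (t := t)).1 le_rfl) D.Φ ⟨D.γle, le_rfl⟩
  refine le_trans ?_ this
  rw [D.e0_Φ, J, D.e1_Φ, D.e2_Φ]
  have := D.Mpl
  have := D.Mhi
  have := D.Mah
  rcases le_total 0 y with h | h
  · rw [abs_of_nonneg h, max_eq_left h, max_eq_right (by linarith)]; nlinarith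
  · rw [abs_of_nonpos h, max_eq_right h, max_eq_left (by linarith)]; nlinarith
lemma dir_low (y x t : ℝ) : (M + 1) * |x - (|y|)| - D.Φ * t ≤ (D.fam G hG).c (true, y) x t := by
  have h1 := ((D.c_dir_iff G hG (y := y) (x := x) (t := t)).1 le_rfl) D.hi ⟨D.pl_lt, le_rfl⟩
  have h2 := ((D.c_dir_iff G hG (y := y) (x := x) (t := t)).1 le_rfl) D.pl ⟨le_rfl, D.pl_lt⟩
  rw [D.ghi] at h1
  rw [D.gpl] at h2
  have := D.Mpl
  have := D.Mhi
  rcases le_total 0 (x - |y|) with h | h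
  · rw [abs_of_nonneg h]; refine le_trans ?_ h1; nlinarith
  · rw [abs_of_nonpos h]; refine le_trans ?_ h2; nlinarith
lemma V_init {x : ℝ} (hx : 0 ≤ x) : (D.fam G hG).V (x, 0) = G x := by
  have M0 := D.M0
  refine le_antisymm ?_ ?_
  · refine ((D.fam G hG).V_le x 0 (true, x)).trans ?_
    rw [a_dir, abs_of_nonneg hx]
    have : (D.fam G hG).c (true, x) x 0 ≤ 0 := by
      rw [c_dir_iff]; intro p _; rw [abs_of_nonneg hx]; linarith
    linarith
  · rw [a_le_iff]
    rintro ⟨_ | _, y⟩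
    · have h1 := D.int_low G hG y x 0 hx
      have h2 := (le_abs_self _).trans (hG x y)
      have h3 := abs_sub x y
      rw [abs_of_nonneg hx] at h3
      rw [a_int]
      nlinarith [abs_nonneg y]
    · have h1 := D.dir_low G hG y x 0
      have h2 := (le_abs_self _).trans (hG x |y|)
      rw [a_dir]
      nlinarith [abs_nonneg (x - |y|)]

lemma fam_half {U u : Pl → ℝ} (hU : ∀ p ∈ quad, U p = (D.fam G hG).V p) (hu : ∀ p ∈ quad, u p = (D.fam G hG).sl p.1 p.2)
    (lip : ∃ K, LipschitzWith K U) (mu : Measurable u) (bu : ∃ M, ∀ p, |u p| ≤ M) : HalfPot D.g U u := by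
  obtain ⟨K, hK⟩ := (D.fam G hG).V_lip
  obtain ⟨M', hM'⟩ := bu
  have pde : ∀ᵐ p, p ∈ quad → dX (D.fam G hG).V p = u p ∧ dT (D.fam G hG).V p = -D.g (u p) := by
    filter_upwards [(D.fam G hG).V_pde] with p hp hq
    rw [hu p hq]; exact hp hq
  refine ⟨lip, mu, ⟨M', hM'⟩, ?_, ?_⟩
  · filter_upwards [pde] with p hp hq
    have e : U =ᶠ[𝓝 p] (D.fam G hG).V := by
      filter_upwards [quad_open.mem_nhds hq] with q hq using hU q hq
    rw [dX, dT, e.fderiv_eq]; exact hp hq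
  · refine kruz D.hg hK mu hM' pde fun d hd => ⟨1 / (2 * ((D.fam G hG).kap * d)), ?_, ?_⟩
    · have := (D.fam G hG).kpos; positivity
    · intro x x' t k hx ht hk hxx
      exact (D.fam G hG).V_semi hd hx ht hk hxx

/-- glued potential -/
def W (p : Pl) : ℝ := (D.fam G hG).V (max p.1 0, p.2) + (D.famL G hG).V (max (-p.1) 0, p.2) - (D.fam G hG).V (0, p.2)
lemma W_right {x : ℝ} (hx : 0 ≤ x) (t : ℝ) : D.W G hG (x, t) = (D.fam G hG).V (x, t) := by
  simp only [W]
  rw [max_eq_left hx, max_eq_right (by linarith), V0_eq]; ring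
lemma W_left {x : ℝ} (hx : x ≤ 0) (t : ℝ) : D.W G hG (x, t) = (D.famL G hG).V (-x, t) := by
  simp only [W]
  rw [max_eq_right hx, max_eq_left (by linarith)]; ring
lemma W_lip : ∃ K, LipschitzWith K (D.W G hG) := by
  obtain ⟨K, hK⟩ := (D.fam G hG).V_lip
  obtain ⟨L, hL⟩ := (D.famL G hG).V_lip
  have l1 : LipschitzWith 1 fun p : Pl => (max p.1 0, p.2) := by
    simpa using (LipschitzWith.prod_fst.max_const 0).prodMk LipschitzWith.prod_snd
  have l2 : LipschitzWith 1 fun p : Pl => (max (-p.1) 0, p.2) := by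
    simpa using (LipschitzWith.prod_fst.neg.max_const 0).prodMk LipschitzWith.prod_snd
  have l3 : LipschitzWith 1 fun p : Pl => ((0 : ℝ), p.2) := by
    simpa using (LipschitzWith.const (0 : ℝ)).prodMk LipschitzWith.prod_snd
  exact ⟨_, ((hK.comp l1).add (hL.comp l2)).sub (hK.comp l3)⟩
lemma W_refl (p : Pl) : D.refl.W (fun y => G (-y)) (hGn G hG) p = D.W G hG (rf p) := by
  obtain ⟨x, t⟩ := p
  rw [rf_apply]
  simp only
  rcases le_total 0 x with h | h
  · rw [W_right _ _ _ h, W_left _ _ _ (by linarith), neg_neg]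
  · rw [W_left _ _ _ h, W_right _ _ _ (by linarith), famL_refl]
lemma W_init (x : ℝ) : D.W G hG (x, 0) = G x := by
  rcases le_total 0 x with h | h
  · rw [W_right _ _ _ h, V_init _ _ _ h]
  · rw [W_left _ _ _ h, V_init _ _ _ (by linarith), neg_neg]

/-- glued solution, overridden by `w` at nonpositive times -/
def uu (w : ℝ → ℝ) (p : Pl) : ℝ :=
  if 0 < p.2 then (if 0 ≤ p.1 then (D.fam G hG).sl p.1 p.2 else -(D.famL G hG).sl (-p.1) p.2) else w p.1
variable {w : ℝ → ℝ}
lemma uu_meas (hw : Measurable w) : Measurable (D.uu G hG w) := by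
  refine Measurable.ite (measurableSet_lt measurable_const measurable_snd) ?_ (hw.comp measurable_fst)
  refine Measurable.ite (measurableSet_le measurable_const measurable_fst) (D.fam G hG).sl_meas ?_
  exact ((D.famL G hG).sl_meas.comp (measurable_fst.neg.prodMk measurable_snd : Measurable fun p : Pl => (-p.1, p.2))).neg
lemma uu_bd {M' : ℝ} (hw : ∀ x, |w x| ≤ M') : ∃ M, ∀ p, |D.uu G hG w p| ≤ M := by
  refine ⟨max M' (max (D.fam G hG).R0 (D.famL G hG).R0), fun p => ?_⟩
  unfold uu
  split_ifs
  · exact ((D.fam G hG).sl_abs _ _).trans ((le_max_left _ _).trans (le_max_right _ _))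
  · rw [abs_neg]; exact ((D.famL G hG).sl_abs _ _).trans ((le_max_right _ _).trans (le_max_right _ _))
  · exact (hw _).trans (le_max_left _ _)
lemma uu_right {x t : ℝ} (hx : 0 ≤ x) (ht : 0 < t) : D.uu G hG w (x, t) = (D.fam G hG).sl x t := by
  simp [uu, hx, ht]
lemma uu_left {x t : ℝ} (hx : x < 0) (ht : 0 < t) : D.uu G hG w (x, t) = -(D.famL G hG).sl (-x) t := by
  simp [uu, not_le.2 hx, ht]
lemma W_half_r (hw : Measurable w) {M' : ℝ} (hw' : ∀ x, |w x| ≤ M') : HalfPot D.g (D.W G hG) (D.uu G hG w) :=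
  D.fam_half G hG (fun p hp => D.W_right G hG hp.1.le p.2) (fun p hp => D.uu_right G hG hp.1.le hp.2) (D.W_lip G hG)
    (D.uu_meas G hG hw) (D.uu_bd G hG hw')
lemma W_half_l (hw : Measurable w) {M' : ℝ} (hw' : ∀ x, |w x| ≤ M') :
    HalfPot (fun p => D.h (-p)) (fun p => D.W G hG (rf p)) (fun p => -D.uu G hG w (rf p)) := by
  refine D.refl.fam_half _ (hGn G hG) ?_ ?_ ?_ ?_ ?_
  · intro p hp
    rw [rf_apply, W_left _ _ _ (by linarith [hp.1]), neg_neg]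
  · intro p hp
    rw [rf_apply, uu_left _ _ _ (by linarith [hp.1]) hp.2, neg_neg, neg_neg]
  · obtain ⟨K, hK⟩ := D.W_lip G hG
    exact ⟨_, lip_rf hK⟩
  · exact ((D.uu_meas G hG hw).comp rf.continuous.measurable).neg
  · obtain ⟨M, h⟩ := D.uu_bd G hG hw'
    exact ⟨M, fun p => by rw [abs_neg]; exact h _⟩
lemma W_anti {s t : ℝ} (hst : s ≤ t) : D.W G hG (0, t) + D.g D.B * t ≤ D.W G hG (0, s) + D.g D.B * s := by
  rw [W_right _ _ _ le_rfl, W_right _ _ _ le_rfl]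
  obtain ⟨y, hy⟩ := D.int_ag G hG s
  have h1 := (D.fam G hG).V_le 0 t (false, y)
  have h2 : (D.fam G hG).c (false, y) 0 t ≤ (D.fam G hG).c (false, y) 0 s - D.g D.B * (t - s) := by
    rw [c_int_iff]
    intro F hF
    have := ((D.c_int_iff G hG (y := y) (x := 0) (t := s)).1 le_rfl) F hF
    simp only [J] at this ⊢
    nlinarith [hF.1]
  rw [hy]
  linarith
end Geo


namespace Fam
variable {Z : Type} [TopologicalSpace Z] (F : Fam Z)
lemma c_hd {z : Z} {x t p : ℝ} (hx : 0 ≤ x) (ht : 0 < t) (h : F.am z x t p) : HasDerivAt (fun s => F.c z x s) (-F.g p) t := by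
  choose q hq using fun s => F.am_ex z x s
  have hl : Tendsto q (𝓝 t) (𝓝 p) := by
    rw [tendsto_iff_ultrafilter]
    intro l hlt
    obtain ⟨p', hp'⟩ := ultra_ex l isCompact_Icc (f := q) (Eventually.of_forall fun s => F.mem_pl (hq s))
    have := F.am_lim (l := (l : Filter ℝ)) (z := fun _ => z) (x := fun _ => x) (t := fun s => s) tendsto_const_nhds tendsto_const_nhds
      (tendsto_id'.2 hlt) hp' (Eventually.of_forall hq)
    rwa [F.uniq z x t p' p hx ht this h] at hp'
  have hg : Tendsto (fun s => F.g (q s) - F.g p) (𝓝 t) (𝓝 0) := by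
    have := ((F.gc.tendsto p).comp hl).sub_const (F.g p)
    simpa using this
  rw [hasDerivAt_iff_isLittleO]
  have h1 : (fun s => (F.g (q s) - F.g p) * (s - t)) =o[𝓝 t] fun s => s - t := by
    have := ((Asymptotics.isLittleO_one_iff ℝ).2 hg).mul_isBigO (Asymptotics.isBigO_refl (fun s => s - t) (𝓝 t))
    simpa using this
  refine Asymptotics.IsBigO.trans_isLittleO (Asymptotics.IsBigO.of_bound 1 (Eventually.of_forall fun s => ?_)) h1
  have a1 := F.c_lower h x s
  have a2 := F.c_lower (hq s) x t
  simp only [sub_self, mul_zero, add_zero, smul_eq_mul, Real.norm_eq_abs, one_mul] at *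
  rw [abs_of_nonneg (by linarith)]
  linarith [neg_abs_le ((F.g (q s) - F.g p) * (s - t))]
lemma V_hd {x t p m : ℝ} (hx : 0 ≤ x) (ht : 0 < t) (h : F.P x t p) (hm : HasDerivAt (fun s => F.V (x, s)) m t) : F.g p = -m := by
  obtain ⟨z, hz, hp⟩ := h
  have h1 := ((F.c_hd hx ht hp).const_add (F.a z)).sub hm
  have : IsLocalMin ((fun s => F.a z + F.c z x s) - fun s => F.V (x, s)) t := by
    refine Eventually.of_forall fun s => ?_
    have := F.V_le x s z
    unfold ag at hz
    simp only [Pi.sub_apply]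
    linarith
  have := this.hasDerivAt_eq_zero h1
  linarith
end Fam

namespace Geo
variable {a M : ℝ} (D : Geo a M) (G : ℝ → ℝ) (hG : ∀ x y, |G x - G y| ≤ M * |x - y|)
lemma dir_of_int {y t p : ℝ} (hy : 0 < y) (ht : 0 < t) (hz : (D.fam G hG).ag 0 t (false, y)) (hp : (D.fam G hG).am (false, y) 0 t p)
    (hB : D.B < p) : (D.fam G hG).sl 0 t < D.B := by
  have hγ : D.g D.B < D.g p := by
    have := D.hg.inc D.hB le_rfl hB.le
    nlinarith [mul_pos D.hg.pos (pow_pos (sub_pos.2 hB) 2)]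
  have hΦ := D.g_le hB.le hp.1.2
  obtain ⟨s1, s2⟩ := D.e1_spec hγ.le
  have s3 := D.e1_le hΦ
  set q := -D.e1 (D.g p) with hq
  have hqB : q < D.Bb := by
    refine lt_of_le_of_ne s1 fun h => ?_
    rw [h, D.eBb] at s2; linarith
  have val : ∀ r, D.B ≤ r → r ≤ D.hi → -(D.g r * t) + y * D.e1 (D.g r) ≤ -(D.g p * t) + y * D.e1 (D.g p) := by
    intro r h1 h2
    have := hp.2 r ⟨h1, h2⟩
    change (D.fam G hG).ps _ _ _ _ ≤ (D.fam G hG).ps _ _ _ _ at this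
    rw [ps_int, ps_int, J, J, max_eq_left hy.le, max_eq_right (by linarith : -y ≤ 0)] at this
    linarith
  have val2 : ∀ r, D.pl ≤ r → r ≤ D.Bb → -(D.g r * t) - y * r ≤ -(D.g q * t) - y * q := by
    intro r h1 h2
    have i1 := D.hg.neg.inc D.hBb' (neg_le_neg h2) (neg_le_neg h1)
    simp only [neg_neg] at i1
    rw [D.gpl] at i1
    have i2 := D.hg.neg.inc D.hBb' le_rfl (neg_le_neg h2)
    simp only [neg_neg] at i2
    rw [D.eBb] at i2
    have k1 : D.g D.B ≤ D.g r := by nlinarith [mul_nonneg D.hg.pos.le (sq_nonneg (-r - -D.Bb))]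
    have k2 : D.g r ≤ D.Φ := by nlinarith [mul_nonneg D.hg.pos.le (sq_nonneg (-D.pl - -r))]
    have e := D.e0_spec k1
    have := val (D.e0 (D.g r)) e.1 (D.e0_le k2)
    rw [e.2, D.e1_eq h2] at this
    rw [s2, hq]; linarith
  have val3 : ∀ r ∈ Icc D.pl D.hi, r * 0 - D.g r * t - r * |y| ≤ -(D.g q * t) - y * q := by
    intro r hr
    rw [abs_of_pos hy]
    by_cases h2 : r ≤ D.Bb
    · have := val2 r hr.1 h2; linarith
    push Not at h2
    have v := val2 D.Bb D.lpl le_rfl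
    have t1 := D.hg.tangent D.Bb r
    have t2 := D.hg.tangent D.Bb q
    have n1 : 0 ≤ a / 2 * (r - D.Bb) ^ 2 := by have := D.hg.pos; positivity
    have n2 : 0 ≤ a / 2 * (q - D.Bb) ^ 2 := by have := D.hg.pos; positivity
    set d := deriv D.g D.Bb
    have c1 : d * (r - D.Bb) ≤ D.g r - D.g D.Bb := by linarith
    have c2 : d * (q - D.Bb) ≤ D.g q - D.g D.Bb := by linarith
    have k : -(d * t) - y ≤ 0 := by
      by_contra hk
      push Not at hk
      have : (-(d * t) - y) * (D.Bb - q) ≤ 0 := by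
        have := mul_le_mul_of_nonneg_right c2 ht.le
        nlinarith
      nlinarith [mul_pos hk (sub_pos.2 hqB)]
    have := mul_le_mul_of_nonneg_right c1 ht.le
    nlinarith [mul_nonneg (neg_nonneg.2 k) (sub_pos.2 h2).le]
  have hqm : q ∈ Icc D.pl D.hi := ⟨by linarith, s1.trans (D.lBb.trans D.lhi)⟩
  have cv : (D.fam G hG).c (true, y) 0 t = -(D.g q * t) - y * q := by
    refine le_antisymm ((D.c_dir_iff G hG).2 val3) ?_
    have := (D.c_dir_iff G hG (y := y) (x := 0) (t := t)).1 le_rfl q hqm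
    rw [abs_of_pos hy] at this
    linarith
  have ci : (D.fam G hG).c (false, y) 0 t = -(D.g q * t) - y * q := by
    rw [(D.fam G hG).am_val hp, ps_int, J, max_eq_left hy.le, max_eq_right (by linarith : -y ≤ 0), s2, hq]; ring
  have hP : (D.fam G hG).P 0 t q := by
    refine ⟨(true, y), ?_, ?_⟩
    · unfold Fam.ag at *
      rw [hz, a_int, a_dir, cv, ci, abs_of_pos hy]
    · rw [Fam.am_iff]
      refine ⟨hqm, ?_⟩
      rw [cv, ps_dir, abs_of_pos hy]; ring
  exact ((D.fam G hG).sl_le hP).trans_lt (hqB.trans_le D.lBb)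

lemma iface_t {t m : ℝ} (ht : 0 < t) (hm : HasDerivAt (fun s => (D.fam G hG).V (0, s)) m t) :
    Real.sign ((D.fam G hG).sl 0 t - D.B) * (D.g ((D.fam G hG).sl 0 t) - D.g D.B) ≤
    -(Real.sign ((D.famL G hG).sl 0 t - D.refl.B) * (D.refl.g ((D.famL G hG).sl 0 t) - D.refl.g D.refl.B)) := by
  have hm' : HasDerivAt (fun s => (D.famL G hG).V (0, s)) m t := by simpa only [V0_eq] using hm
  have r : ∀ p, (D.fam G hG).P 0 t p → D.g p = -m := fun p hp => (D.fam G hG).V_hd le_rfl ht hp hm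
  have l : ∀ p, (D.famL G hG).P 0 t p → D.refl.g p = -m := fun p hp => (D.famL G hG).V_hd le_rfl ht hp hm'
  rw [r _ ((D.fam G hG).sl_P 0 t), l _ ((D.famL G hG).sl_P 0 t), γ_refl]
  obtain ⟨y, hy⟩ := D.int_ag G hG t
  obtain ⟨p, hp⟩ := (D.fam G hG).am_ex (false, y) 0 t
  have hpm := r p ⟨_, hy, hp⟩
  have hγ : D.g D.B ≤ -m := hpm ▸ D.g_ge hp.1.1
  rcases hγ.eq_or_lt with h | h
  · simp [h]
  have key : (D.fam G hG).sl 0 t < D.B ∨ (D.famL G hG).sl 0 t < D.refl.B := by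
    have hBp : D.B < p := lt_of_le_of_ne hp.1.1 fun e => by
      have e : D.B = p := e
      rw [← e] at hpm; linarith
    rcases lt_trichotomy y 0 with y0 | y0 | y0
    · right
      have hy' : (D.famL G hG).ag 0 t (false, -y) := by
        unfold Fam.ag at *
        rw [V0_eq, c_int_refl, hy]; simp [a_int]
      obtain ⟨p', hp'⟩ := (D.famL G hG).am_ex (false, -y) 0 t
      have hpm' := l p' ⟨_, hy', hp'⟩
      refine D.refl.dir_of_int _ _ (by linarith : 0 < -y) ht hy' hp' (lt_of_le_of_ne hp'.1.1 fun e => ?_)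
      have e : D.refl.B = p' := e
      rw [← e, γ_refl] at hpm'; linarith
    · have := hp.2 D.B ⟨le_rfl, D.lhi⟩
      change (D.fam G hG).ps _ _ _ _ ≤ (D.fam G hG).ps _ _ _ _ at this
      rw [ps_int, ps_int, hpm, y0] at this
      simp [J] at this
      nlinarith
    · left; exact D.dir_of_int G hG y0 ht hy hp hBp
  have hs : ∀ x : ℝ, Real.sign x ≤ 1 := fun x => by rcases Real.sign_apply_eq x with h | h | h <;> rw [h] <;> norm_num
  rcases key with k | k
  · rw [Real.sign_of_neg (by linarith : (D.fam G hG).sl 0 t - D.B < 0)]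
    nlinarith [hs ((D.famL G hG).sl 0 t - D.refl.B)]
  · rw [Real.sign_of_neg (by linarith : (D.famL G hG).sl 0 t - D.refl.B < 0)]
    nlinarith [hs ((D.fam G hG).sl 0 t - D.B)]
end Geo


lemma drr_bound {g : ℝ → ℝ} {C : ℝ} (hC : ∀ y, |g y| ≤ C) (n : ℕ) :
    |∫ z, g z * drr n z| ≤ C * ∫ s, |dst s| := by
  have C0 : 0 ≤ C := (abs_nonneg _).trans (hC 0)
  have nn : ∫ z, |drr n z| = ∫ s, |dst s| := by
    have np : (0 : ℝ) < (n : ℝ) + 1 := by positivity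
    simp only [drr, abs_mul, abs_of_pos np]
    rw [integral_const_mul, Measure.integral_comp_mul_left (fun y => |dst (y - 1)|) ((n : ℝ) + 1),
      integral_sub_right_eq_self (fun s => |dst s|) 1, abs_of_pos (by positivity), smul_eq_mul]
    field_simp
  have di : Integrable (drr n) := by simpa using drr_integrable n 0
  rw [← Real.norm_eq_abs]
  refine (norm_integral_le_of_norm_le (g := fun z => C * |drr n z|) (di.abs.const_mul C)
    (Eventually.of_forall fun z => ?_)).trans (le_of_eq ?_)
  · rw [Real.norm_eq_abs, abs_mul]
    exact mul_le_mul_of_nonneg_right (hC z) (abs_nonneg _)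
  · rw [integral_const_mul, nn]

lemma half_bd {g1 g2 : Pl → ℝ} (m1 : Measurable g1) (m2 : Measurable g2) {C : ℝ} (b1 : ∀ p, |g1 p| ≤ C) (b2 : ∀ p, |g2 p| ≤ C)
    (hE : EntOn quad g1 g2) {tr : ℝ → ℝ} (htr : ∀ t, 0 < t → Tendsto (fun x => g2 (x, t)) (𝓝[>] 0) (𝓝 (tr t)))
    {φ : Pl → ℝ} (hφ : ContDiff ℝ 1 φ) (hc : HasCompactSupport φ) (h0 : ∀ p, 0 ≤ φ p) (hs : tsupport φ ⊆ {p | 0 < p.2}) :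
    0 ≤ (∫ p : Pl, (if 0 < p.1 then 1 else 0) * (g1 p * dT φ p + g2 p * dX φ p)) + ∫ t, tr t * φ (0, t) := by
  have C0 : 0 ≤ C := (abs_nonneg _).trans (b1 0)
  obtain ⟨K, hK⟩ := hφ.lipschitzWith_of_hasCompactSupport hc (by simp)
  obtain ⟨Cφ, hCφ⟩ := hφ.continuous.bounded_above_of_compact_support hc
  have Cφ0 : 0 ≤ Cφ := (norm_nonneg _).trans (hCφ 0)
  obtain ⟨R, hR⟩ := hc.isBounded.subset_closedBall (0 : Pl)
  have hz : ∀ x t : ℝ, t ∉ Icc (-R) R → φ (x, t) = 0 := by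
    intro x t ht
    by_contra h
    have := hR (subset_tsupport _ h)
    rw [Metric.mem_closedBall, dist_zero_right, Prod.norm_def] at this
    exact ht (abs_le.1 ((le_max_right _ _).trans this))
  have hz' : ∀ x t : ℝ, t ≤ 0 → φ (x, t) = 0 := by
    intro x t ht
    by_contra h
    exact absurd (hs (subset_tsupport _ h)) (not_lt.2 ht)
  have it := test_int m1 m2 b1 b2 hK hc
  have ri : ∀ n, Integrable fun p : Pl => rr n p.1 * (g1 p * dT φ p + g2 p * dX φ p) := fun n =>
    it.bdd_mul (c := 1) ((rr_cd n).continuous.comp continuous_fst).aestronglyMeasurable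
      (Eventually.of_forall fun p => by rw [Real.norm_eq_abs, abs_of_nonneg (rr_nn _ _)]; exact rr_le _ _)
  have di : ∀ n, Integrable fun p : Pl => g2 p * (φ p * drr n p.1) := fun n => by
    have : Integrable fun p : Pl => φ p * drr n p.1 :=
      (hφ.continuous.mul ((drr_cont n).comp continuous_fst)).integrable_of_hasCompactSupport hc.mul_right
    exact this.bdd_mul m2.aestronglyMeasurable (Eventually.of_forall b2)
  have key : ∀ n, 0 ≤ (∫ p : Pl, rr n p.1 * (g1 p * dT φ p + g2 p * dX φ p)) + ∫ t, ∫ x, (g2 (x, t) * φ (x, t)) * drr n x := by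
    intro n
    have hcd : ContDiff ℝ 1 fun p : Pl => φ p * rr n p.1 := hφ.mul ((rr_cd n).comp contDiff_fst)
    have hdf : ∀ p : Pl, HasFDerivAt (fun p : Pl => φ p * rr n p.1)
        (φ p • (drr n p.1 • ContinuousLinearMap.fst ℝ ℝ ℝ) + rr n p.1 • fderiv ℝ φ p) p := fun p =>
      ((hφ.differentiable (by simp) p).hasFDerivAt).mul ((rr_hd n p.1).comp_hasFDerivAt p hasFDerivAt_fst)
    have eX : ∀ p : Pl, dX (fun p : Pl => φ p * rr n p.1) p = φ p * drr n p.1 + rr n p.1 * dX φ p := fun p => by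
      simp [dX, (hdf p).fderiv]
    have eT : ∀ p : Pl, dT (fun p : Pl => φ p * rr n p.1) p = rr n p.1 * dT φ p := fun p => by
      simp [dT, (hdf p).fderiv]
    have := hE _ hcd hc.mul_right (fun p => mul_nonneg (h0 p) (rr_nn _ _)) ?_
    · simp only [eX, eT] at this
      have e : ∫ p : Pl, (g1 p * (rr n p.1 * dT φ p) + g2 p * (φ p * drr n p.1 + rr n p.1 * dX φ p)) =
          (∫ p : Pl, rr n p.1 * (g1 p * dT φ p + g2 p * dX φ p)) + ∫ p : Pl, g2 p * (φ p * drr n p.1) := by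
        rw [← integral_add (ri n) (di n)]
        refine integral_congr_ae (Eventually.of_forall fun p => ?_)
        simp only; ring
      have s2 := integral_prod_symm (μ := (volume : Measure ℝ)) (ν := (volume : Measure ℝ)) _ (di n)
      rw [e] at this
      rw [Measure.volume_eq_prod] at this ⊢
      rw [s2] at this
      simpa only [mul_assoc] using this
    · intro p hp
      have c1 : IsClosed {p : Pl | 1 / ((n : ℝ) + 1) ≤ p.1} := isClosed_le continuous_const continuous_fst
      have h1 : tsupport (fun p : Pl => φ p * rr n p.1) ⊆ {p : Pl | 1 / ((n : ℝ) + 1) ≤ p.1} := by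
        refine closure_minimal (fun q hq => ?_) c1
        by_contra hh
        have hh : q.1 < 1 / ((n : ℝ) + 1) := not_le.1 hh
        rw [lt_div_iff₀ (by positivity)] at hh
        refine hq ?_
        have : rr n q.1 = 0 := Real.smoothTransition.zero_of_nonpos (by linarith)
        simp [this]
      have h2 : p ∈ tsupport φ := closure_mono (Function.support_mul_subset_left _ _) hp
      exact ⟨lt_of_lt_of_le (by positivity) (h1 hp), hs h2⟩
  have L1 : Tendsto (fun n => ∫ p : Pl, rr n p.1 * (g1 p * dT φ p + g2 p * dX φ p)) atTop
      (𝓝 (∫ p : Pl, (if 0 < p.1 then 1 else 0) * (g1 p * dT φ p + g2 p * dX φ p))) := by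
    refine tendsto_integral_of_dominated_convergence (fun p => ‖g1 p * dT φ p + g2 p * dX φ p‖)
      (fun n => (ri n).aestronglyMeasurable) it.norm (fun n => Eventually.of_forall fun p => ?_)
      (Eventually.of_forall fun p => (rr_lim p.1).mul_const _)
    rw [norm_mul, Real.norm_eq_abs, abs_of_nonneg (rr_nn _ _)]
    exact mul_le_of_le_one_left (norm_nonneg _) (rr_le _ _)
  have bg : ∀ x t, |g2 (x, t) * φ (x, t)| ≤ (C * Cφ) * (Icc (-R) R).indicator (fun _ => (1 : ℝ)) t := by
    intro x t
    by_cases ht : t ∈ Icc (-R) R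
    · rw [indicator_of_mem ht, mul_one, abs_mul]
      exact mul_le_mul (b2 _) (hCφ _) (abs_nonneg _) C0
    · simp [hz x t ht, ht]
  have L2 : Tendsto (fun n => ∫ t, ∫ x, (g2 (x, t) * φ (x, t)) * drr n x) atTop (𝓝 (∫ t, tr t * φ (0, t))) := by
    have ibt : Integrable ((Icc (-R) R).indicator (fun _ => (1 : ℝ))) :=
      (integrable_indicator_iff measurableSet_Icc).2 (by simp)
    refine tendsto_integral_of_dominated_convergence
      (fun t => ((C * Cφ) * (Icc (-R) R).indicator (fun _ => (1 : ℝ)) t) * ∫ s, |dst s|)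
      (fun n => ?_) ((ibt.const_mul _).mul_const _) (fun n => Eventually.of_forall fun t => drr_bound (fun y => bg y t) n)
      (Eventually.of_forall fun t => ?_)
    · have : StronglyMeasurable (fun p : ℝ × ℝ => (g2 (p.2, p.1) * φ (p.2, p.1)) * drr n p.2) :=
        (((m2.mul hφ.continuous.measurable).comp measurable_swap).mul ((drr_cont n).measurable.comp measurable_snd)).stronglyMeasurable
      exact (this.integral_prod_right' (ν := (volume : Measure ℝ))).aestronglyMeasurable
    · by_cases ht : 0 < t
      · have lm : Tendsto (fun x => g2 (x, t) * φ (x, t)) (𝓝[>] 0) (𝓝 (tr t * φ (0, t))) := by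
          have : Continuous fun x : ℝ => φ (x, t) := hφ.continuous.comp (by fun_prop)
          exact (htr t ht).mul ((this.tendsto 0).mono_left nhdsWithin_le_nhds)
        have := drr_lim (g := fun _ y => g2 (y, t) * φ (y, t)) (x := 0)
          (fun n => (m2.mul hφ.continuous.measurable).comp (measurable_id.prodMk measurable_const))
          (fun n y => bg y t) (fun s hs' => lm.comp (sarg hs' 0))
        simpa using this
      · push Not at ht
        simp [hz' _ _ ht]
  exact ge_of_tendsto' (L1.add L2) key


lemma sf_cont {g : ℝ → ℝ} (hg : Continuous g) (k : ℝ) : Continuous fun p => Real.sign (p - k) * (g p - g k) := by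
  simp only [sgn_minmax]
  exact (hg.comp (by fun_prop)).sub (hg.comp (by fun_prop))
lemma sf_bd {g : ℝ → ℝ} (hg : Continuous g) (k R : ℝ) : ∃ C, ∀ p, |p| ≤ R → |Real.sign (p - k) * (g p - g k)| ≤ C := by
  obtain ⟨C, hC⟩ := (isCompact_Icc (a := -R) (b := R)).exists_bound_of_continuousOn (sf_cont hg k).continuousOn
  exact ⟨C, fun p hp => hC p (abs_le.1 hp)⟩

lemma HalfPot.kb {g : ℝ → ℝ} (hg : Continuous g) {U u : Pl → ℝ} (h : HalfPot g U u) (k : ℝ) :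
    Measurable (fun p => |u p - k|) ∧ Measurable (fun p => Real.sign (u p - k) * (g (u p) - g k)) ∧
    ∃ C, (∀ p, |(|u p - k|)| ≤ C) ∧ ∀ p, |Real.sign (u p - k) * (g (u p) - g k)| ≤ C := by
  obtain ⟨M, hM⟩ := h.bdd
  obtain ⟨C, hC⟩ := sf_bd hg k M
  refine ⟨(h.meas.sub_const k).abs, (sf_cont hg k).measurable.comp h.meas, max (M + |k|) C, fun p => ?_, fun p => ?_⟩
  · rw [abs_abs]
    exact (abs_sub _ _).trans ((add_le_add (hM p) le_rfl).trans (le_max_left _ _))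
  · exact (hC _ (hM p)).trans (le_max_right _ _)

lemma HalfPot.bd0 {g : ℝ → ℝ} (hg : Continuous g) {U u : Pl → ℝ} (h : HalfPot g U u) (k : ℝ) {s : ℝ → ℝ}
    (hs : ∀ t, 0 < t → Tendsto (fun x => u (x, t)) (𝓝[>] 0) (𝓝 (s t)))
    {φ : Pl → ℝ} (hφ : ContDiff ℝ 1 φ) (hc : HasCompactSupport φ) (h0 : ∀ p, 0 ≤ φ p) (hsu : tsupport φ ⊆ {p | 0 < p.2}) :
    0 ≤ (∫ p : Pl, (if 0 < p.1 then 1 else 0) * (|u p - k| * dT φ p + Real.sign (u p - k) * (g (u p) - g k) * dX φ p)) +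
      ∫ t, (Real.sign (s t - k) * (g (s t) - g k)) * φ (0, t) := by
  obtain ⟨m1, m2, C, b1, b2⟩ := h.kb hg k
  exact half_bd m1 m2 b1 b2 (h.kr k) (tr := fun t => Real.sign (s t - k) * (g (s t) - g k))
    (fun t ht => ((sf_cont hg k).tendsto (s t)).comp (hs t ht)) hφ hc h0 hsu

namespace Geo
variable {a M : ℝ} (D : Geo a M) (G : ℝ → ℝ) (hG : ∀ x y, |G x - G y| ≤ M * |x - y|) {w : ℝ → ℝ}
lemma tr_int (k : ℝ) {φ : Pl → ℝ} (hφ : Continuous φ) (hc : HasCompactSupport φ) :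
    Integrable fun t => (Real.sign ((D.fam G hG).sl 0 t - k) * (D.g ((D.fam G hG).sl 0 t) - D.g k)) * φ (0, t) := by
  obtain ⟨C, hC⟩ := sf_bd D.hg.cont k (D.fam G hG).R0
  have : Integrable fun t : ℝ => φ (0, t) := by
    refine (hφ.comp (by fun_prop : Continuous fun t : ℝ => ((0, t) : Pl))).integrable_of_hasCompactSupport ?_
    refine HasCompactSupport.intro (hc.image continuous_snd) fun t ht => ?_
    by_contra h
    exact ht ⟨(0, t), subset_tsupport _ h, rfl⟩
  exact this.bdd_mul (c := C) ((sf_cont D.hg.cont k).measurable.comp ((D.fam G hG).sl_meas.comp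
    (by fun_prop : Measurable fun t : ℝ => ((0, t) : Pl)))).aestronglyMeasurable
    (Eventually.of_forall fun t => hC _ ((D.fam G hG).sl_abs _ _))

lemma W_ie (hw : Measurable w) {M' : ℝ} (hw' : ∀ x, |w x| ≤ M') : EntOn {p | 0 < p.2} (fun p => |D.uu G hG w p - cAB D.A D.B p.1|)
    (fun p => Real.sign (D.uu G hG w p - cAB D.A D.B p.1) * (dflux D.h D.g p.1 (D.uu G hG w p) - dflux D.h D.g p.1 (cAB D.A D.B p.1))) := by
  intro φ hφ hc h0 hs
  have hr := D.W_half_r G hG hw hw'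
  have hl := D.W_half_l G hG hw hw'
  have r := hr.bd0 D.hg.cont D.B (s := fun t => (D.fam G hG).sl 0 t) (fun t ht => by
    refine ((D.fam G hG).sl_right le_rfl ht).congr' ?_
    filter_upwards [self_mem_nhdsWithin] with x hx
    exact (D.uu_right G hG (le_of_lt hx) ht).symm) hφ hc h0 hs
  have hφr : ContDiff ℝ 1 fun p => φ (rf p) := hφ.comp rf.contDiff
  have hcr : HasCompactSupport fun p => φ (rf p) := hc.comp_homeomorph rf.toHomeomorph
  have l := hl.bd0 D.refl.hg.cont D.refl.B (s := fun t => (D.famL G hG).sl 0 t) (fun t ht => by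
    refine ((D.famL G hG).sl_right le_rfl ht).congr' ?_
    filter_upwards [self_mem_nhdsWithin] with x hx
    rw [rf_apply, uu_left _ _ _ (neg_lt_zero.2 hx) ht, neg_neg, neg_neg]) hφr hcr (fun p => h0 _) (by
      have : tsupport (φ ∘ rf) = rf ⁻¹' tsupport φ := tsupport_comp_eq_preimage φ rf.toHomeomorph
      change tsupport (φ ∘ rf) ⊆ _
      rw [this]
      intro p hp
      have hp : rf p ∈ tsupport φ := hp
      have := hs hp
      simpa [rf_apply] using this)
  have tn : (∫ t, (Real.sign ((D.fam G hG).sl 0 t - D.B) * (D.g ((D.fam G hG).sl 0 t) - D.g D.B)) * φ (0, t)) +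
      ∫ t, (Real.sign ((D.famL G hG).sl 0 t - D.refl.B) * (D.refl.g ((D.famL G hG).sl 0 t) - D.refl.g D.refl.B)) * φ (rf (0, t)) ≤ 0 := by
    rw [← integral_add (D.tr_int G hG _ hφ.continuous hc) (D.refl.tr_int _ (hGn G hG) _ hφr.continuous hcr)]
    obtain ⟨K, hK⟩ := (D.fam G hG).V_lip
    have hd := (hK.comp (LipschitzWith.prodMk_left (0 : ℝ))).ae_differentiableAt_real
    refine integral_nonpos_of_ae ?_
    filter_upwards [hd] with t ht
    have e : rf (0, t) = (0, t) := by simp [rf_apply]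
    rw [e, ← add_mul]
    by_cases t0 : 0 < t
    · have := D.iface_t G hG t0 ht.hasDerivAt
      exact mul_nonpos_of_nonpos_of_nonneg (by linarith) (h0 _)
    · have : φ (0, t) = 0 := by
        by_contra h
        exact t0 (hs (subset_tsupport _ h))
      simp [this]
  have ri := D.W_half_r G hG hw hw'
  obtain ⟨K, hK⟩ := hφ.lipschitzWith_of_hasCompactSupport hc (by simp)
  obtain ⟨Kr, hKr⟩ := hφr.lipschitzWith_of_hasCompactSupport hcr (by simp)
  have mi : Measurable fun p : Pl => (if 0 < p.1 then (1 : ℝ) else 0) :=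
    Measurable.ite (measurableSet_lt measurable_const measurable_fst) measurable_const measurable_const
  have bi : ∀ p : Pl, ‖(if 0 < p.1 then (1 : ℝ) else 0)‖ ≤ 1 := fun p => by split_ifs <;> simp
  have ir : Integrable fun p : Pl => (if 0 < p.1 then (1 : ℝ) else 0) * (|D.uu G hG w p - D.B| * dT φ p +
      Real.sign (D.uu G hG w p - D.B) * (D.g (D.uu G hG w p) - D.g D.B) * dX φ p) := by
    obtain ⟨m1, m2, C, b1, b2⟩ := hr.kb D.hg.cont D.B
    exact (test_int m1 m2 b1 b2 hK hc).bdd_mul (c := 1) mi.aestronglyMeasurable (Eventually.of_forall bi)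
  have il : Integrable fun p : Pl => (if 0 < p.1 then (1 : ℝ) else 0) * (|-D.uu G hG w (rf p) - D.refl.B| * dT (fun p => φ (rf p)) p +
      Real.sign (-D.uu G hG w (rf p) - D.refl.B) * (D.refl.g (-D.uu G hG w (rf p)) - D.refl.g D.refl.B) * dX (fun p => φ (rf p)) p) := by
    obtain ⟨m1, m2, C, b1, b2⟩ := hl.kb D.refl.hg.cont D.refl.B
    exact (test_int m1 m2 b1 b2 hKr hcr).bdd_mul (c := 1) mi.aestronglyMeasurable (Eventually.of_forall bi)
  have il' := (rf_mp.integrable_comp_emb rf.toHomeomorph.measurableEmbedding).2 il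
  rw [← int_rf] at l
  have e4 : ∀ x y r s : ℝ, 0 ≤ x + r → 0 ≤ y + s → r + s ≤ 0 → 0 ≤ x + y := fun x y r s h1 h2 h3 => by linarith
  refine (e4 _ _ _ _ r l tn).trans (le_of_eq ((integral_add ir il').symm.trans (integral_congr_ae ?_)))
  · filter_upwards [ae_x_ne] with p hp
    simp only [Function.comp_apply, dX_rf, dT_rf, rf_rf]
    rcases lt_or_gt_of_ne hp with h | h
    · have h1 : 0 < (rf p).1 := by simpa [rf_apply] using h
      have e1 : |-D.uu G hG w p - D.refl.B| = |D.uu G hG w p - D.A| := by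
        rw [← abs_neg]; congr 1; simp [refl]; ring
      have e2 : Real.sign (-D.uu G hG w p - D.refl.B) = -Real.sign (D.uu G hG w p - D.A) := by
        rw [← Real.sign_neg]; congr 1; simp [refl]; ring
      have e3 : D.refl.g (-D.uu G hG w p) - D.refl.g D.refl.B = D.h (D.uu G hG w p) - D.h D.A := by simp [refl]
      simp only [cAB, dflux, h, h.le, h1, if_true, not_lt.2 h.le, if_false, e1, e2, e3]
      ring
    · have h1 : ¬ 0 < (rf p).1 := by simpa [rf_apply] using h.le
      simp only [cAB, dflux, h, not_le.2 h, h1, if_true, not_lt.2 h.le, if_false]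
      ring

lemma W_pot (hw : Measurable w) {M' : ℝ} (hw' : ∀ x, |w x| ≤ M') : Pot D.h D.g D.A D.B (D.W G hG) (D.uu G hG w) :=
  ⟨D.W_half_r G hG hw hw', D.W_half_l G hG hw hw', D.W_ie G hG hw hw', fun _ _ _ h => D.W_anti G hG h⟩
end Geo


namespace Fam
variable {Z : Type} [TopologicalSpace Z] (F : Fam Z)
lemma P_d {x t p d : ℝ} (hx : 0 < x) (ht : 0 < t) (h : F.P x t p) (hd : HasDerivAt (fun y => F.V (y, t)) d x) : p = d := by
  have h1 : HasDerivAt (fun y => F.V (x, t) + p * (y - x) + (y - x) ^ 2 / (4 * (F.kap * min x t))) p x := by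
    have e1 : HasDerivAt (fun y : ℝ => y - x) 1 x := (hasDerivAt_id x).sub_const x
    have := ((e1.const_mul p).const_add (F.V (x, t))).fun_add ((e1.pow 2).div_const (4 * (F.kap * min x t)))
    simpa using this
  have h2 := h1.sub hd
  have : IsLocalMin ((fun y => F.V (x, t) + p * (y - x) + (y - x) ^ 2 / (4 * (F.kap * min x t))) - fun y => F.V (y, t)) x := by
    refine Eventually.of_forall fun y => ?_
    have := F.P_sc hx ht h y t
    simp only [sub_self, mul_zero, abs_zero, add_zero, sub_zero, sq_abs] at this
    simp
    linarith
  have := this.hasDerivAt_eq_zero h2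
  linarith
lemma sl_tc {t : ℝ} (ht : 0 < t) : ∀ᵐ x, 0 < x → Tendsto (fun s => F.sl x s) (𝓝 t) (𝓝 (F.sl x t)) := by
  obtain ⟨K, hK⟩ := F.V_lip
  filter_upwards [(hK.comp (LipschitzWith.prodMk_right t)).ae_differentiableAt_real] with x hd hx
  rw [tendsto_iff_ultrafilter]
  intro l hl
  obtain ⟨p', hp'⟩ := ultra_ex l isCompact_Icc (f := fun s => F.sl x s) (Eventually.of_forall fun s => F.P_mem (F.sl_P x s))
  have := F.P_closed l (x := fun _ => x) (t := fun s => s) tendsto_const_nhds (tendsto_id'.2 hl) hp' (Eventually.of_forall fun s => F.sl_P x s)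
  rw [F.P_d hx ht this hd.hasDerivAt] at hp'
  rwa [F.P_d hx ht (F.sl_P x t) hd.hasDerivAt]
end Fam

lemma sl_arith {S c x t Y cd V Gx Gy Gd gc d e ε n C1 N k : ℝ} (st : c * x - gc * t - c * Y ≤ cd - S) (hz : V = Gy + cd)
    (hu : V ≤ Gd + t * e) (he : e = c * d - gc) (n1 : Gd - Gx - -(d * t) * c ≤ ε * (n * t))
    (n2 : -(ε * k) ≤ Gy - Gx - (Y - x) * c) (n3 : ε * k ≤ ε * (C1 * t)) (hN : N = n + C1) : S ≤ ε * (N * t) := by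
  subst he; subst hN
  linarith

namespace Geo
variable {a M : ℝ} (D : Geo a M) (G : ℝ → ℝ) (hG : ∀ x y, |G x - G y| ≤ M * |x - y|) {w : ℝ → ℝ}
set_option maxHeartbeats 800000 in
lemma sl_t0 {x c : ℝ} (hx : 0 < x) (hd : HasDerivAt G c x) : Tendsto (fun t => (D.fam G hG).sl x t) (𝓝[>] 0) (𝓝 c) := by
  have M0 := D.M0
  have ap := D.hg.pos
  have hcM : |c| ≤ M := by
    have hl : LipschitzWith M.toNNReal G := LipschitzWith.of_dist_le_mul fun y z => by
      rw [Real.coe_toNNReal _ M0]; exact hG y z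
    have := norm_deriv_le_of_lipschitz hl (x₀ := x)
    rwa [hd.deriv, Real.coe_toNNReal _ M0] at this
  have hc : c ∈ Icc D.pl D.hi := ⟨by linarith [D.Mpl, (abs_le.1 hcM).1], by linarith [D.Mhi, (abs_le.1 hcM).2]⟩
  set d := deriv D.g c with hdd
  set e := c * d - D.g c with he
  set C2 := M * |d| + |e| with hC2
  have C20 : 0 ≤ C2 := by positivity
  set C1 := C2 + |D.Φ| with hC1
  have C10 : 0 ≤ C1 := by positivity
  set N := |d| + C1 with hN
  have N0 : 0 ≤ N := by positivity
  have up : ∀ t, 0 < t → |d| * t < x → (D.fam G hG).V (x, t) ≤ G (x - d * t) + t * e := by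
    intro t ht hdt
    have hy : 0 ≤ x - d * t := by nlinarith [le_abs_self d]
    refine ((D.fam G hG).V_le x t (true, x - d * t)).trans ?_
    rw [a_dir, abs_of_nonneg hy]
    refine add_le_add le_rfl ((D.c_dir_iff G hG).2 fun p _ => ?_)
    rw [abs_of_nonneg hy]
    have := D.hg.tangent c p
    have n1 : 0 ≤ a / 2 * (p - c) ^ 2 := by positivity
    have k : D.g c + d * (p - c) ≤ D.g p := by linarith
    nlinarith [mul_le_mul_of_nonneg_right k ht.le]
  have up2 : ∀ t, 0 < t → |d| * t < x → (D.fam G hG).V (x, t) ≤ G x + C2 * t := by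
    intro t ht hdt
    have h1 := up t ht hdt
    have h2 := hG (x - d * t) x
    rw [show x - d * t - x = -(d * t) by ring, abs_neg, abs_mul, abs_of_pos ht] at h2
    have h3 := le_abs_self (G (x - d * t) - G x)
    nlinarith [mul_le_mul_of_nonneg_right (le_abs_self e) ht.le]
  rw [Metric.tendsto_nhds]
  intro η hη
  have εp : 0 < a * η ^ 2 / (8 * (N + 1)) := by positivity
  obtain ⟨δ, δp, hδ⟩ := Metric.eventually_nhds_iff.1 ((hasDerivAt_iff_isLittleO.1 hd).def εp)
  have ev : ∀ᶠ t in 𝓝[>] (0 : ℝ), t < min δ x / (N + |D.Φ| + 1) :=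
    mem_nhdsWithin_of_mem_nhds (gt_mem_nhds (by positivity))
  filter_upwards [ev, self_mem_nhdsWithin] with t h1 h2
  have ht : 0 < t := h2
  rw [lt_div_iff₀ (by positivity)] at h1
  have hΦ := le_abs_self D.Φ
  have hΦ0 := abs_nonneg D.Φ
  have tx : t * (N + |D.Φ| + 1) < x := h1.trans_le (min_le_right _ _)
  have tδ : t * (N + |D.Φ| + 1) < δ := h1.trans_le (min_le_left _ _)
  have tΦ : 0 ≤ |D.Φ| * t := by positivity
  have hdt : |d| * t < x := by nlinarith [mul_nonneg C10 ht.le]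
  obtain ⟨⟨b, y⟩, hz, hp⟩ := (D.fam G hG).sl_P x t
  set p := (D.fam G hG).sl x t
  have hv := up2 t ht hdt
  unfold Fam.ag at hz
  rcases b with _ | _
  · exfalso
    rw [a_int] at hz
    have i1 := D.int_low G hG y x t hx.le
    have i2 := hG x y
    have i3 := le_abs_self (G x - G y)
    have i4 : |x - y| ≤ x + |y| := by
      have := abs_sub x y; rwa [abs_of_pos hx] at this
    have i5 := abs_nonneg y
    have i6 := mul_le_mul_of_nonneg_left i4 M0
    have i7 : D.Φ * t ≤ |D.Φ| * t := mul_le_mul_of_nonneg_right hΦ ht.le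
    have i8 : C2 * t ≤ N * t := mul_le_mul_of_nonneg_right (by linarith [abs_nonneg d]) ht.le
    linarith
  · rw [a_dir] at hz
    have i1 := D.dir_low G hG y x t
    have i2 := hG x |y|
    have i3 := le_abs_self (G x - G |y|)
    have i7 : D.Φ * t ≤ |D.Φ| * t := mul_le_mul_of_nonneg_right hΦ ht.le
    have yb : |x - (|y|)| ≤ C1 * t := by linarith
    have st := D.dir_strong (y := y) (x := x) (t := t) (p := p) (q := c) ht.le hp hc
    change (D.fam G hG).ps (true, y) x t c ≤ (D.fam G hG).ps (true, y) x t p - _ at st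
    rw [← (D.fam G hG).am_val hp, ps_dir] at st
    have hu := up t ht hdt
    have n1 := hδ (y := x - d * t) (by
      rw [Real.dist_eq, show x - d * t - x = -(d * t) by ring, abs_neg, abs_mul, abs_of_pos ht]
      nlinarith [mul_nonneg C10 ht.le])
    have n2 := hδ (y := |y|) (by
      rw [Real.dist_eq, abs_sub_comm]
      nlinarith [mul_nonneg (abs_nonneg d) ht.le])
    rw [Real.norm_eq_abs, Real.norm_eq_abs, smul_eq_mul] at n1 n2
    set ε := a * η ^ 2 / (8 * (N + 1)) with hε
    rw [show x - d * t - x = -(d * t) by ring, abs_neg (d * t), abs_mul d, abs_of_pos ht] at n1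
    rw [abs_sub_comm (|y|) x] at n2
    have n1' := (abs_le.1 n1).2
    have n2' := (abs_le.1 n2).1
    have n3 := mul_le_mul_of_nonneg_left yb εp.le
    have m1 : a / 4 * t * (c - p) ^ 2 ≤ ε * (N * t) :=
      sl_arith (cd := (D.fam G hG).c (true, y) x t) (Y := |y|) (gc := D.g c) (by first | exact st | linarith [st]) hz hu he n1' n2' n3 hN
    have m2 : a / 4 * (c - p) ^ 2 ≤ ε * N := by
      have : t * (a / 4 * (c - p) ^ 2) ≤ t * (ε * N) := by linarith
      exact le_of_mul_le_mul_left this ht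
    have m3 : ε * (N + 1) = a * η ^ 2 / 8 := by rw [hε]; field_simp
    have m4 : (c - p) ^ 2 < η ^ 2 := by
      have : a * (c - p) ^ 2 < a * η ^ 2 := by nlinarith [mul_pos ap (pow_pos hη 2)]
      exact lt_of_mul_lt_mul_left this ap.le
    rw [Real.dist_eq, abs_sub_comm]
    exact abs_lt_of_sq_lt_sq m4 hη.le

lemma uu_pt (hw : ∀ᵐ x, HasDerivAt G (w x) x) {t : ℝ} (ht : 0 ≤ t) :
    ∀ᵐ x, Tendsto (fun s => D.uu G hG w (x, s)) (𝓝[Ici 0] t) (𝓝 (D.uu G hG w (x, t))) := by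
  have ne : ∀ᵐ x : ℝ, x ≠ 0 := by simp [ae_iff]
  rcases ht.eq_or_lt with h | h
  · subst h
    filter_upwards [hw, ne] with x hx hn
    refine continuousWithinAt_Ioi_iff_Ici.1 ?_
    have e : D.uu G hG w (x, 0) = w x := by simp [uu]
    show Tendsto (fun s => D.uu G hG w (x, s)) (𝓝[>] 0) (𝓝 (D.uu G hG w (x, 0)))
    rw [e]
    rcases lt_or_gt_of_ne hn with h0 | h0
    · have hr : HasDerivAt (fun y => G (-y)) (-w x) (-x) := by
        have h1 : HasDerivAt G (w x) (- -x) := by rwa [neg_neg]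
        have := h1.comp (-x) (hasDerivAt_neg (-x))
        rw [mul_neg_one] at this
        exact this
      have := (D.refl.sl_t0 _ (hGn G hG) (by linarith : 0 < -x) hr).neg
      rw [neg_neg] at this
      refine this.congr' ?_
      filter_upwards [self_mem_nhdsWithin] with t ht
      exact (D.uu_left G hG h0 ht).symm
    · refine (D.sl_t0 G hG h0 hx).congr' ?_
      filter_upwards [self_mem_nhdsWithin] with t ht
      exact (D.uu_right G hG h0.le ht).symm
  · have h1 := (D.fam G hG).sl_tc h
    have h2 := (Measure.measurePreserving_neg (volume : Measure ℝ)).quasiMeasurePreserving.ae ((D.famL G hG).sl_tc h)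
    filter_upwards [h1, h2, ne] with x h1 h2 hn
    refine Tendsto.mono_left ?_ nhdsWithin_le_nhds
    rcases lt_or_gt_of_ne hn with h0 | h0
    · rw [uu_left _ _ _ h0 h]
      refine (h2 (by linarith : 0 < -x)).neg.congr' ?_
      filter_upwards [lt_mem_nhds h] with t ht
      exact (D.uu_left G hG h0 ht).symm
    · rw [uu_right _ _ _ h0.le h]
      refine (h1 h0).congr' ?_
      filter_upwards [lt_mem_nhds h] with t ht
      exact (D.uu_right G hG h0.le ht).symm

lemma uu_tc (hwm : Measurable w) {M' : ℝ} (hw' : ∀ x, |w x| ≤ M') (hw : ∀ᵐ x, HasDerivAt G (w x) x) (r : ℝ) {t : ℝ} (ht : 0 ≤ t) :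
    Tendsto (fun s => ∫ x in Icc (-r) r, |D.uu G hG w (x, s) - D.uu G hG w (x, t)|) (𝓝[Ici 0] t) (𝓝 0) := by
  obtain ⟨C, hC⟩ := D.uu_bd G hG hw'
  have hm := D.uu_meas G hG hwm
  have mt : ∀ t, Measurable fun x => D.uu G hG w (x, t) := fun t => hm.comp (by fun_prop : Measurable fun x : ℝ => ((x, t) : Pl))
  have : Tendsto (fun s => ∫ x in Icc (-r) r, |D.uu G hG w (x, s) - D.uu G hG w (x, t)|) (𝓝[Ici 0] t)
      (𝓝 (∫ x in Icc (-r) r, (0 : ℝ))) := by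
    refine tendsto_integral_filter_of_dominated_convergence (fun _ => C + C)
      (Eventually.of_forall fun s => ((mt s).sub (mt t)).abs.aestronglyMeasurable)
      (Eventually.of_forall fun s => Eventually.of_forall fun x => ?_) (integrable_const _) ?_
    · rw [Real.norm_eq_abs, abs_abs]
      exact (abs_sub _ _).trans (add_le_add (hC _) (hC _))
    · filter_upwards [ae_restrict_of_ae (D.uu_pt G hG hw ht)] with x hx
      have := (hx.sub_const (D.uu G hG w (x, t))).abs
      simpa using this
  simpa using this
end Geo


lemma ent_closed {O : Set Pl} {g1 g2 : Pl → ℝ} (m1 : Measurable g1) (m2 : Measurable g2)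
    {C : ℝ} (b1 : ∀ p, |g1 p| ≤ C) (b2 : ∀ p, |g2 p| ≤ C) (hE : EntOn O g1 g2) {φ : Pl → ℝ} (hφ : ContDiff ℝ 1 φ)
    (hc : HasCompactSupport φ) (h0 : ∀ p, 0 ≤ φ p) (q : Pl) (hO : ∀ p ∈ tsupport φ, ∀ ε : ℝ, 0 < ε → p + ε • q ∈ O) :
    0 ≤ ∫ p, (g1 p * dT φ p + g2 p * dX φ p) := by
  obtain ⟨L, hL⟩ := hφ.lipschitzWith_of_hasCompactSupport hc (by simp)
  set ε : ℕ → ℝ := fun n => 1 / ((n : ℝ) + 1) with hε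
  have εp : ∀ n, 0 < ε n := fun n => by positivity
  have ε1 : ∀ n, ε n ≤ 1 := fun n => by
    rw [hε]; simp only; rw [div_le_one (by positivity)]; linarith [(Nat.cast_nonneg n : (0 : ℝ) ≤ n)]
  have εl : Tendsto ε atTop (𝓝 0) := tendsto_one_div_add_atTop_nhds_zero_nat
  set φn : ℕ → Pl → ℝ := fun n p => φ (p - ε n • q) with hφn
  have ts : ∀ n p, p ∈ tsupport (φn n) → p - ε n • q ∈ tsupport φ := by
    intro n p hp
    have := tsupport_comp_subset_preimage φ (f := fun p : Pl => p - ε n • q) (by fun_prop) hp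
    exact this
  have fd : ∀ n p, fderiv ℝ (φn n) p = fderiv ℝ φ (p - ε n • q) := fun n p => by
    rw [hφn]; exact fderiv_comp_sub _
  set S : Set Pl := (fun z : Pl × ℝ => z.1 + z.2 • q) '' (tsupport φ ×ˢ Icc 0 1) with hS
  have Sc : IsCompact S := (IsCompact.prod hc isCompact_Icc).image (by fun_prop)
  have sub : ∀ n, tsupport (φn n) ⊆ S := by
    intro n p hp
    exact ⟨(p - ε n • q, ε n), ⟨ts n p hp, (εp n).le, ε1 n⟩, by simp⟩
  have ql : ∀ p : Pl, Tendsto (fun n => p - ε n • q) atTop (𝓝 p) := by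
    intro p
    have := (tendsto_const_nhds (x := p)).sub (εl.smul_const q)
    simpa using this
  have lim := test_lim m1 m2 b1 b2 (φ := φn) (ψ := φ) (K := L)
    (fun n => LipschitzWith.of_dist_le_mul fun x y => by
      have := hL.dist_le_mul (x - ε n • q) (y - ε n • q)
      rwa [dist_sub_right] at this) Sc sub
    (Eventually.of_forall fun p => by
      have := ((dX_cont hφ).tendsto p).comp (ql p)
      refine this.congr fun n => ?_
      simp only [Function.comp, dX, fd])
    (Eventually.of_forall fun p => by
      have := ((dT_cont hφ).tendsto p).comp (ql p)
      refine this.congr fun n => ?_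
      simp only [Function.comp, dT, fd])
  refine ge_of_tendsto' lim fun n => hE _ (by rw [hφn]; fun_prop) (Sc.of_isClosed_subset (isClosed_tsupport _) (sub n)) (fun p => h0 _) fun p hp => ?_
  have := hO _ (ts n p hp) (ε n) (εp n)
  simpa using this

lemma ts_t {φ : Pl → ℝ} (h : ∀ p : Pl, p.2 ≤ 0 → φ p = 0) : ∀ p ∈ tsupport φ, 0 ≤ p.2 := by
  have : tsupport φ ⊆ {p : Pl | 0 ≤ p.2} := closure_minimal (fun p hp => by
    by_contra hn
    exact hp (h p (not_le.1 hn).le)) (isClosed_le continuous_const continuous_snd)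
  exact fun p hp => this hp
lemma ts_x {φ : Pl → ℝ} (h : ∀ p : Pl, p.1 ≤ 0 → φ p = 0) : ∀ p ∈ tsupport φ, 0 ≤ p.1 := by
  have : tsupport φ ⊆ {p : Pl | 0 ≤ p.1} := closure_minimal (fun p hp => by
    by_contra hn
    exact hp (h p (not_le.1 hn).le)) (isClosed_le continuous_const continuous_fst)
  exact fun p hp => this hp
lemma ts_x' {φ : Pl → ℝ} (h : ∀ p : Pl, 0 ≤ p.1 → φ p = 0) : ∀ p ∈ tsupport φ, p.1 ≤ 0 := by
  have : tsupport φ ⊆ {p : Pl | p.1 ≤ 0} := closure_minimal (fun p hp => by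
    by_contra hn
    exact hp (h p (not_le.1 hn).le)) (isClosed_le continuous_fst continuous_const)
  exact fun p hp => this hp
lemma ae_t_ne : ∀ᵐ p : Pl, p.2 ≠ 0 := by
  have : ∀ᵐ x : ℝ, x ≠ 0 := by simp [ae_iff]
  exact (Measure.quasiMeasurePreserving_snd (μ := (volume : Measure ℝ)) (ν := (volume : Measure ℝ))).ae this

lemma mkSol {a A B : ℝ} {fl fr u0 : ℝ → ℝ} {U u : Pl → ℝ} (hl : UC a fl) (hr : UC a fr) (hP : Pot fl fr A B U u)
    (h1 : ∀ x t, 0 < t → ∃ l, Tendsto (fun y => u (y, t)) (𝓝[<] x) (𝓝 l))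
    (h2 : ∀ x t, 0 < t → ∃ l, Tendsto (fun y => u (y, t)) (𝓝[>] x) (𝓝 l))
    (tc : ∀ r t : ℝ, 0 ≤ t → Tendsto (fun s => ∫ x in Icc (-r) r, |u (x, s) - u (x, t)|) (𝓝[Ici 0] t) (𝓝 0))
    (hi : ∀ᵐ x, u (x, 0) = u0 x) : ∃ sol : ABSol fl fr A B u0, ∀ x t, sol.u x t = u (x, t) := by
  classical
  have k1 : ∀ x t, ∃ l, 0 < t → Tendsto (fun y => u (y, t)) (𝓝[<] x) (𝓝 l) := fun x t => by
    by_cases h : 0 < t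
    · obtain ⟨l, hl⟩ := h1 x t h; exact ⟨l, fun _ => hl⟩
    · exact ⟨0, fun h' => absurd h' h⟩
  have k2 : ∀ x t, ∃ l, 0 < t → Tendsto (fun y => u (y, t)) (𝓝[>] x) (𝓝 l) := fun x t => by
    by_cases h : 0 < t
    · obtain ⟨l, hl⟩ := h2 x t h; exact ⟨l, fun _ => hl⟩
    · exact ⟨0, fun h' => absurd h' h⟩
  choose um hum using k1
  choose up hup using k2
  obtain ⟨M, hM⟩ := hP.right.bdd
  obtain ⟨K, hK⟩ := hP.right.lip
  have mu := hP.right.meas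
  refine ⟨{ u := fun x t => u (x, t), meas := mu, bdd := ⟨M, fun x t => hM _⟩, um := um, up := up, um_spec := hum,
            up_spec := hup, weak := ?_, kruzkov_l := ?_, kruzkov_r := ?_, interfaceEntropy := ?_, timeCont := tc, init := hi }, fun _ _ => rfl⟩
  · intro φ hφ hc h0
    have hts := ts_t (φ := fun p : Pl => φ p.1 p.2) fun p hp => h0 p.1 p.2 hp
    have e := ent_iff (g1 := fun p : Pl => u (p.1, p.2)) (g2 := fun p : Pl => dflux fl fr p.1 (u (p.1, p.2))) hφ
    refine e.trans ?_
    rw [← weak_lip hK hφ hc]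
    refine integral_congr_ae ?_
    filter_upwards [hP.pde, ae_t_ne] with p hp hn
    rcases lt_or_gt_of_ne hn with h | h
    · have : p ∉ tsupport (fun p : Pl => φ p.1 p.2) := fun h' => not_lt.2 (hts p h') h
      simp only [dX_zero this, dT_zero this, mul_zero]
    · rw [(hp h).1, (hp h).2, neg_neg]
  · intro k φ hφ hc hn h0
    have t1 := ts_t (φ := fun p : Pl => φ p.1 p.2) fun p hp => h0 p.1 p.2 (Or.inr hp)
    have t2 := ts_x' (φ := fun p : Pl => φ p.1 p.2) fun p hp => h0 p.1 p.2 (Or.inl hp)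
    have e := ent_iff (g1 := fun p : Pl => |u (p.1, p.2) - k|)
      (g2 := fun p : Pl => Real.sign (u (p.1, p.2) - k) * (fl (u (p.1, p.2)) - fl k)) hφ
    refine le_of_le_of_eq ?_ e.symm
    have g : EntOn (rf ⁻¹' quad) (fun p : Pl => |u p - k|) (fun p : Pl => Real.sign (u p - k) * (fl (u p) - fl k)) := by
      have := ent_rf (hP.left.kr (-k))
      simp only [rf_rf, neg_neg] at this
      convert this using 2 with p p
      · rw [← abs_neg]; congr 1; ring
      · rw [show -u p - -k = -(u p - k) by ring, Real.sign_neg]; ring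
    obtain ⟨C, hC⟩ := sf_bd hl.cont k M
    refine ent_closed (C := max (M + |k|) C) (mu.sub_const k).abs ((sf_cont hl.cont k).measurable.comp mu)
      (fun p => by
        rw [abs_abs]
        exact (abs_sub _ _).trans ((add_le_add (hM p) le_rfl).trans (le_max_left _ _)))
      (fun p => (hC _ (hM p)).trans (le_max_right _ _)) g hφ hc (fun p => hn _ _) (-1, 1) fun p hp ε hε => ?_
    have := t1 p hp
    have := t2 p hp
    refine ⟨?_, ?_⟩
    · simp [rf_apply]; linarith
    · simp [rf_apply]; linarith
  · intro k φ hφ hc hn h0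
    have t1 := ts_t (φ := fun p : Pl => φ p.1 p.2) fun p hp => h0 p.1 p.2 (Or.inr hp)
    have t2 := ts_x (φ := fun p : Pl => φ p.1 p.2) fun p hp => h0 p.1 p.2 (Or.inl hp)
    have e := ent_iff (g1 := fun p : Pl => |u (p.1, p.2) - k|)
      (g2 := fun p : Pl => Real.sign (u (p.1, p.2) - k) * (fr (u (p.1, p.2)) - fr k)) hφ
    refine le_of_le_of_eq ?_ e.symm
    obtain ⟨m1, m2, C, c1, c2⟩ := HalfPot.kb hr.cont hP.right k
    refine ent_closed m1 m2 c1 c2 (hP.right.kr k) hφ hc (fun p => hn _ _) (1, 1) fun p hp ε hε => ?_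
    have := t1 p hp
    have := t2 p hp
    refine ⟨?_, ?_⟩
    · simp; linarith
    · simp; linarith
  · intro φ hφ hc hn h0
    have t1 := ts_t (φ := fun p : Pl => φ p.1 p.2) fun p hp => h0 p.1 p.2 hp
    have e := ent_iff (g1 := fun p : Pl => |u (p.1, p.2) - cAB A B p.1|)
      (g2 := fun p : Pl => Real.sign (u (p.1, p.2) - cAB A B p.1) * (dflux fl fr p.1 (u (p.1, p.2)) - dflux fl fr p.1 (cAB A B p.1))) hφ
    refine le_of_le_of_eq ?_ e.symm
    have mc : Measurable fun p : Pl => cAB A B p.1 := (cAB_meas A B).comp measurable_fst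
    have md := dflux_meas hl.cont.measurable hr.cont.measurable
    have md1 : Measurable fun p : Pl => dflux fl fr p.1 (u p) := md.comp (measurable_fst.prodMk mu)
    have md2 : Measurable fun p : Pl => dflux fl fr p.1 (cAB A B p.1) := md.comp (measurable_fst.prodMk mc)
    have cb : ∀ x, |cAB A B x| ≤ |A| + |B| := fun x => by
      unfold cAB; split_ifs
      · linarith [abs_nonneg B]
      · linarith [abs_nonneg A]
    obtain ⟨C, C0, hC⟩ := dflux_bd hl hr (max M (|A| + |B|))
    refine ent_closed (C := M + (|A| + |B|) + (C + C)) (mu.sub mc).abs ((sign_meas.comp (mu.sub mc)).mul (md1.sub md2)) (fun p => ?_) (fun p => ?_) hP.ie hφ hc (fun p => hn _ _) (0, 1) fun p hp ε hε => ?_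
    · rw [abs_abs]
      show |u p - cAB A B p.1| ≤ _
      linarith [abs_sub (u p) (cAB A B p.1), hM p, cb p.1]
    · have := hC p.1 (u p) ((hM p).trans (le_max_left _ _))
      have := hC p.1 _ ((cb p.1).trans (le_max_right _ _))
      have := abs_sub (dflux fl fr p.1 (u p)) (dflux fl fr p.1 (cAB A B p.1))
      have := (abs_nonneg _).trans (hM p)
      have := (abs_nonneg _).trans (cb p.1)
      have hs := sign_abs_le (u p - cAB A B p.1)
      have hm := mul_le_mul_of_nonneg_right hs (abs_nonneg (dflux fl fr p.1 (u p) - dflux fl fr p.1 (cAB A B p.1)))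
      show |Real.sign (u p - cAB A B p.1) * (dflux fl fr p.1 (u p) - dflux fl fr p.1 (cAB A B p.1))| ≤ _
      rw [abs_mul]
      linarith
    · have := t1 p hp
      simp; linarith


lemma UC.dmono {a : ℝ} {f : ℝ → ℝ} (h : UC a f) (p q : ℝ) : a * (q - p) ^ 2 ≤ (deriv f q - deriv f p) * (q - p) := by
  have h1 := h.tangent p q
  have h2 := h.tangent q p
  nlinarith
lemma UC.dle {a : ℝ} {f : ℝ → ℝ} (h : UC a f) {p q : ℝ} (hpq : p ≤ q) : deriv f p ≤ deriv f q := by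
  rcases hpq.eq_or_lt with rfl | hl
  · rfl
  · have h1 := h.dmono p q
    have h2 : 0 < q - p := by linarith
    by_contra hn
    push Not at hn
    nlinarith [h.pos, mul_pos h2 h2, mul_pos h.pos (mul_pos h2 h2), mul_pos h2 (sub_pos.2 hn)]
lemma UC.led {a : ℝ} {f : ℝ → ℝ} (h : UC a f) {p q : ℝ} (hpq : deriv f p ≤ deriv f q) : p ≤ q := by
  by_contra hn
  push Not at hn
  have h1 := h.dmono p q
  have h2 : 0 < p - q := by linarith
  nlinarith [h.pos, mul_pos h.pos (mul_pos h2 h2), mul_nonneg h2.le (sub_nonneg.2 hpq)]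
lemma UC.root {a b : ℝ} {f : ℝ → ℝ} (h : UC a f) (hb : 0 ≤ deriv f b) {R Φ : ℝ} (h1 : f b ≤ Φ) (h2 : f R ≤ Φ) :
    ∃ q, b ≤ q ∧ R ≤ q ∧ f q = Φ := by
  obtain ⟨q1, q2⟩ := pp_spec h hb Φ
  rw [max_eq_left h1] at q2
  refine ⟨_, q1, ?_, q2⟩
  rcases le_total R b with h' | h'
  · exact h'.trans q1
  · exact h.le_of hb h' q1 (by rw [q2]; exact h2)

lemma Geo.ex {a A B Bb Aa θl θr : ℝ} {fl fr : ℝ → ℝ} (hl : UC a fl) (hr : UC a fr) (hθl : deriv fl θl = 0) (hθr : deriv fr θr = 0)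
    (hAB : fl A = fr B) (hA' : deriv fl A ≤ 0) (hB' : 0 ≤ deriv fr B)
    (hBb : Bb ≤ θr) (hBbf : fr Bb = fr B) (hAa : θl ≤ Aa) (hAaf : fl Aa = fl A) {M : ℝ} (hM : 0 ≤ M) :
    ∃ D : Geo a M, fl = D.h ∧ fr = D.g ∧ A = D.A ∧ B = D.B ∧ Bb = D.Bb ∧ Aa = D.Aa := by
  have k1 : deriv fr Bb ≤ 0 := (hr.dle hBb).trans hθr.le
  have k2 : 0 ≤ deriv fl Aa := hθl.ge.trans (hl.dle hAa)
  have k3 : Bb ≤ B := hBb.trans (hr.led (by rw [hθr]; exact hB'))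
  have k4 : A ≤ Aa := (hl.led (by rw [hθl]; exact hA')).trans hAa
  set Φ := max (fr B) (max (max (fr (M + 1)) (fr (-(M + 1)))) (max (fl (M + 1)) (fl (-(M + 1))))) with hΦ
  have l0 : fr B ≤ Φ := le_max_left _ _
  have l1 : fr (M + 1) ≤ Φ := by simp [hΦ]
  have l2 : fr (-(M + 1)) ≤ Φ := by simp only [hΦ, le_max_iff, le_refl, true_or, or_true]
  have l3 : fl (M + 1) ≤ Φ := by simp [hΦ]
  have l4 : fl (-(M + 1)) ≤ Φ := by simp only [hΦ, le_max_iff, le_refl, true_or, or_true]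
  obtain ⟨hi, a1, a2, a3⟩ := hr.root hB' l0 l1
  obtain ⟨ah, b1, b2, b3⟩ := hl.root k2 (by rw [hAaf, hAB]; exact l0) l3
  obtain ⟨pl, c1, c2, c3⟩ := hr.neg.root (b := -Bb) (by rw [deriv_cn]; linarith) (by rw [neg_neg, hBbf]; exact l0) l2
  obtain ⟨al, d1, d2, d3⟩ := hl.neg.root (b := -A) (by rw [deriv_cn]; linarith) (by rw [neg_neg, hAB]; exact l0) l4
  exact ⟨{ g := fr, h := fl, B := B, Bb := Bb, A := A, Aa := Aa, hg := hr, hh := hl, hB := hB', hBb := k1, hA := hA', hAa := k2,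
           eBb := hBbf, eA := hAB, eAa := hAaf.trans hAB, lBb := k3, lA := k4, Φ := Φ, pl := -pl, hi := hi, al := -al, ah := ah,
           gpl := c3, ghi := a3, hal := d3, hah := b3, lpl := by linarith, lhi := a1, lal := by linarith, lah := b1, M0 := hM,
           Mpl := by linarith, Mhi := a2, Mal := by linarith, Mah := b2 }, rfl, rfl, rfl, rfl, rfl, rfl⟩

namespace Geo
variable {a M : ℝ} (D : Geo a M) (G : ℝ → ℝ) (hG : ∀ x y, |G x - G y| ≤ M * |x - y|) {w : ℝ → ℝ}

def E (y x t F : ℝ) : ℝ := -(F * t) + max x 0 * D.e0 F + max (-x) 0 * D.refl.e0 F + max y 0 * D.e1 F + max (-y) 0 * D.e2 F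
def Kp (t y x k : ℝ) : Prop :=
  (∀ v, k ≤ v ↔ ∀ F ∈ Icc (D.g D.B) D.Φ, D.E y x t F ≤ v) ∨
  (0 ≤ x ∧ 0 ≤ y ∧ ∀ v, k ≤ v ↔ ∀ p ∈ Icc D.pl D.hi, p * x - D.g p * t - p * y ≤ v) ∨
  (x ≤ 0 ∧ y ≤ 0 ∧ ∀ v, k ≤ v ↔ ∀ p ∈ Icc D.al D.ah, p * x - D.h p * t - p * y ≤ v)
lemma rev_E (y x t F : ℝ) : D.rev.E (-x) (-y) t F = D.E y x t F := by
  have h1 : D.rev.refl.e0 = D.e1 := rfl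
  have h2 : D.rev.e1 = D.refl.e0 := rfl
  unfold E
  rw [h1, h2, rev_e0, rev_e2, neg_neg, neg_neg]; ring
lemma Kp_rev {t y x k : ℝ} (h : D.Kp t y x k) : D.rev.Kp t (-x) (-y) k := by
  have e : D.rev.g D.rev.B = D.g D.B := D.eAa
  rcases h with h | ⟨h1, h2, h⟩ | ⟨h1, h2, h⟩
  · left
    intro v
    rw [h v, e]
    simp only [rev_E]
    rfl
  · right; right
    refine ⟨by linarith, by linarith, fun v => (h v).trans ?_⟩
    refine forall₂_congr fun p _ => ?_
    rw [show p * -y - D.rev.h p * t - p * -x = p * x - D.g p * t - p * y by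
      show p * -y - D.g p * t - p * -x = _
      ring]
  · right; left
    refine ⟨by linarith, by linarith, fun v => (h v).trans ?_⟩
    refine forall₂_congr fun p _ => ?_
    rw [show p * -y - D.rev.g p * t - p * -x = p * x - D.h p * t - p * y by
      show p * -y - D.h p * t - p * -x = _
      ring]
lemma Kp_rev' {t y x k : ℝ} (h : D.rev.Kp t (-x) (-y) k) : D.Kp t y x k := by
  have := D.rev.Kp_rev h
  rw [neg_neg, neg_neg] at this
  exact this
lemma Kp_refl {t y x k : ℝ} (h : D.refl.Kp t y x k) : D.Kp t (-y) (-x) k := by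
  rcases h with h | ⟨h1, h2, h⟩ | ⟨h1, h2, h⟩
  · left
    intro v
    rw [h v, γ_refl, Φ_refl]
    refine forall₂_congr fun F _ => ?_
    unfold E
    rw [refl_e1, refl_e2, refl_refl, neg_neg, neg_neg]
    ring_nf
  · right; right
    refine ⟨by linarith, by linarith, fun v => (h v).trans ?_⟩
    constructor
    · intro h p hp
      have := h (-p) ⟨neg_le_neg hp.2, neg_le_neg hp.1⟩
      have e : D.refl.g (-p) = D.h p := by show D.h (- -p) = _; rw [neg_neg]
      rw [e] at this; linarith
    · intro h p hp
      have hp1 : -D.ah ≤ p := hp.1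
      have hp2 : p ≤ -D.al := hp.2
      have := h (-p) ⟨by linarith, by linarith⟩
      show p * x - D.h (-p) * t - p * y ≤ v
      linarith
  · right; left
    refine ⟨by linarith, by linarith, fun v => (h v).trans ?_⟩
    constructor
    · intro h p hp
      have := h (-p) ⟨neg_le_neg hp.2, neg_le_neg hp.1⟩
      have e : D.refl.h (-p) = D.g p := by show D.g (- -p) = _; rw [neg_neg]
      rw [e] at this; linarith
    · intro h p hp
      have hp1 : -D.hi ≤ p := hp.1
      have hp2 : p ≤ -D.pl := hp.2
      have := h (-p) ⟨by linarith, by linarith⟩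
      show p * x - D.g (-p) * t - p * y ≤ v
      linarith

lemma c_Kp_int {y x t : ℝ} (hx : 0 ≤ x) : D.Kp t y x ((D.fam G hG).c (false, y) x t) := by
  left; intro v
  rw [c_int_iff]
  refine forall₂_congr fun F _ => ?_
  unfold E J
  rw [max_eq_left hx, max_eq_right (by linarith : -x ≤ 0)]
  ring_nf
lemma c_Kp_dir {y x t : ℝ} (hx : 0 ≤ x) : D.Kp t |y| x ((D.fam G hG).c (true, y) x t) :=
  Or.inr (Or.inl ⟨hx, abs_nonneg _, fun v => D.c_dir_iff G hG⟩)

lemma V_F1 {y x t k : ℝ} (hx : 0 ≤ x) (h : D.Kp t y x k) : D.W G hG (x, t) ≤ G y + k := by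
  have int : (∀ v, k ≤ v ↔ ∀ F ∈ Icc (D.g D.B) D.Φ, D.E y x t F ≤ v) → D.W G hG (x, t) ≤ G y + k := by
    intro h
    rw [W_right _ _ _ hx]
    have e := (D.fam G hG).V_le x t (false, y)
    rw [a_int] at e
    refine e.trans (add_le_add le_rfl (D.c_int_iff G hG |>.2 fun F hF => ?_))
    have := (h k).1 le_rfl F hF
    unfold E at this
    rw [max_eq_left hx, max_eq_right (by linarith : -x ≤ 0)] at this
    unfold J
    linarith
  rcases h with h | ⟨h1, h2, h⟩ | ⟨h1, h2, h⟩
  · exact int h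
  · rw [W_right _ _ _ hx]
    have e := (D.fam G hG).V_le x t (true, y)
    rw [a_dir, abs_of_nonneg h2] at e
    refine e.trans (add_le_add le_rfl ((D.c_dir_iff G hG).2 fun p hp => ?_))
    rw [abs_of_nonneg h2]
    exact (h k).1 le_rfl p hp
  · have x0 : x = 0 := le_antisymm h1 hx
    subst x0
    rw [W_left _ _ _ le_rfl]
    have e := (D.famL G hG).V_le (-0) t (true, y)
    rw [a_dir, abs_of_nonpos h2, neg_neg] at e
    refine e.trans (add_le_add le_rfl ((D.refl.c_dir_iff _ (hGn G hG)).2 fun p hp => ?_))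
    have hp1 : -D.ah ≤ p := hp.1
    have hp2 : p ≤ -D.al := hp.2
    have := (h k).1 le_rfl (-p) ⟨by linarith, by linarith⟩
    rw [abs_of_nonpos h2]
    show p * -0 - D.h (-p) * t - p * -y ≤ k
    linarith
lemma F1 {y x t k : ℝ} (h : D.Kp t y x k) : D.W G hG (x, t) ≤ G y + k := by
  rcases le_total 0 x with hx | hx
  · exact D.V_F1 G hG hx h
  · have h' : D.refl.Kp t (-y) (-x) k := D.refl.Kp_refl (by rw [refl_refl]; exact h)
    have := D.refl.V_F1 _ (hGn G hG) (by linarith : 0 ≤ -x) h'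
    rw [W_refl, rf_apply] at this
    simp only [neg_neg] at this
    exact this
lemma V_F2 {x t : ℝ} (hx : 0 ≤ x) : ∃ y k, D.Kp t y x k ∧ D.W G hG (x, t) = G y + k := by
  obtain ⟨⟨b, y⟩, h⟩ := (D.fam G hG).ag_ex x t
  rcases b with _ | _
  · exact ⟨y, _, D.c_Kp_int G hG hx, by rw [W_right _ _ _ hx]; exact h⟩
  · exact ⟨|y|, _, D.c_Kp_dir G hG hx, by rw [W_right _ _ _ hx]; exact h⟩
lemma F2 (x t : ℝ) : ∃ y k, D.Kp t y x k ∧ D.W G hG (x, t) = G y + k := by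
  rcases le_total 0 x with hx | hx
  · exact D.V_F2 G hG hx
  · obtain ⟨y, k, h1, h2⟩ := D.refl.V_F2 _ (hGn G hG) (by linarith : 0 ≤ -x) (t := t)
    refine ⟨-y, k, ?_, ?_⟩
    · have := D.Kp_refl h1
      rwa [neg_neg] at this
    · rw [W_refl, rf_apply] at h2
      simp only [neg_neg] at h2
      exact h2

lemma cone {U0 Us : ℝ → ℝ} {κ lam T : ℝ} (hl : 0 ≤ lam) (h0 : ∀ x y, |U0 x - U0 y| ≤ M * |x - y|) {R : ℝ → ℝ} (hR : ∀ x y, |R x - R y| ≤ M * |x - y|)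
    (eR : ∀ x, R x = -D.W U0 h0 (-x, T) + κ) (eU : ∀ y, Us y = -D.rev.W R hR (-y, T) + κ)
    (eG : ∀ y, G y = Us y + lam * (U0 y - Us y)) (x : ℝ) : D.W G hG (x, T) = D.W U0 h0 (x, T) := by
  have R1 : ∀ y x k, D.Kp T y x k → D.W U0 h0 (x, T) - k ≤ Us y := by
    intro y x k h
    have := D.rev.F1 R hR (D.Kp_rev h)
    rw [eR, neg_neg] at this
    rw [eU]; linarith
  have R2 : ∀ y, Us y ≤ U0 y := by
    intro y
    obtain ⟨x', k, h1, h2⟩ := D.rev.F2 R hR (-y) T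
    have h3 : D.Kp T y (-x') k := D.Kp_rev' (by rw [neg_neg]; exact h1)
    have := D.F1 U0 h0 h3
    rw [eR] at h2
    rw [eU]; linarith
  have G1 : ∀ y, Us y ≤ G y := fun y => by
    rw [eG]; nlinarith [mul_nonneg hl (sub_nonneg.2 (R2 y))]
  refine le_antisymm ?_ ?_
  · obtain ⟨y, k, h1, h2⟩ := D.F2 U0 h0 x T
    have h3 := R1 y x k h1
    have h4 : Us y = U0 y := le_antisymm (R2 y) (by linarith)
    have h5 := D.F1 G hG h1
    rw [eG, h4, sub_self, mul_zero, add_zero] at h5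
    rw [h2]; exact h5
  · obtain ⟨y, k, h1, h2⟩ := D.F2 G hG x T
    have := R1 y x k h1
    linarith [G1 y]
end Geo


namespace Geo
variable {a M : ℝ} (D : Geo a M) (G : ℝ → ℝ) (hG : ∀ x y, |G x - G y| ≤ M * |x - y|) {w : ℝ → ℝ}
lemma tr_l (x : ℝ) {t : ℝ} (ht : 0 < t) : ∃ l, Tendsto (fun y => D.uu G hG w (y, t)) (𝓝[<] x) (𝓝 l) := by
  rcases lt_or_ge 0 x with hx | hx
  · obtain ⟨L, hL⟩ := (D.fam G hG).sl_left hx ht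
    refine ⟨L, hL.congr' ?_⟩
    filter_upwards [mem_nhdsWithin_of_mem_nhds (lt_mem_nhds hx)] with y hy
    exact (D.uu_right G hG (le_of_lt hy) ht).symm
  · have := (((D.famL G hG).sl_right (by linarith : 0 ≤ -x) ht).comp (tendsto_neg_nhdsLT (a := x))).neg
    refine ⟨_, this.congr' ?_⟩
    filter_upwards [self_mem_nhdsWithin] with y hy
    exact (D.uu_left G hG (lt_of_lt_of_le hy hx) ht).symm
lemma tr_r (x : ℝ) {t : ℝ} (ht : 0 < t) : ∃ l, Tendsto (fun y => D.uu G hG w (y, t)) (𝓝[>] x) (𝓝 l) := by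
  rcases lt_or_ge x 0 with hx | hx
  · obtain ⟨L, hL⟩ := (D.famL G hG).sl_left (by linarith : 0 < -x) ht
    refine ⟨_, (hL.comp (tendsto_neg_nhdsGT (a := x))).neg.congr' ?_⟩
    filter_upwards [mem_nhdsWithin_of_mem_nhds (gt_mem_nhds hx)] with y hy
    exact (D.uu_left G hG hy ht).symm
  · refine ⟨_, ((D.fam G hG).sl_right hx ht).congr' ?_⟩
    filter_upwards [self_mem_nhdsWithin] with y hy
    exact (D.uu_right G hG (hx.trans (le_of_lt hy)) ht).symm
lemma uu_d {x t d : ℝ} (hx : x ≠ 0) (ht : 0 < t) (hd : HasDerivAt (fun y => D.W G hG (y, t)) d x) : D.uu G hG w (x, t) = d := by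
  rcases lt_or_gt_of_ne hx with h | h
  · rw [uu_left _ _ _ h ht]
    have h1 : HasDerivAt (fun y => D.W G hG (y, t)) d (- -x) := by rwa [neg_neg]
    have h2 := h1.comp (-x) (hasDerivAt_neg (-x))
    rw [mul_neg_one] at h2
    have h3 : HasDerivAt (fun y => (D.famL G hG).V (y, t)) (-d) (-x) := by
      refine h2.congr_of_eventuallyEq ?_
      filter_upwards [lt_mem_nhds (by linarith : 0 < -x)] with y hy
      show _ = D.W G hG (-y, t)
      rw [W_left _ _ _ (by linarith), neg_neg]
    rw [(D.famL G hG).P_d (by linarith) ht ((D.famL G hG).sl_P _ _) h3, neg_neg]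
  · rw [uu_right _ _ _ h.le ht]
    refine (D.fam G hG).P_d h ht ((D.fam G hG).sl_P _ _) (hd.congr_of_eventuallyEq ?_)
    filter_upwards [lt_mem_nhds h] with y hy
    rw [W_right _ _ _ (le_of_lt hy)]
lemma sol_ex (hwm : Measurable w) {M' : ℝ} (hw' : ∀ x, |w x| ≤ M') (hw : ∀ᵐ x, HasDerivAt G (w x) x) {u0 : ℝ → ℝ} (h0 : ∀ᵐ x, w x = u0 x) :
    ∃ sol : ABSol D.h D.g D.A D.B u0, ∀ x t, sol.u x t = D.uu G hG w (x, t) := by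
  refine mkSol D.hh D.hg (D.W_pot G hG hwm hw') (fun x t ht => D.tr_l G hG x ht) (fun x t ht => D.tr_r G hG x ht)
    (fun r t ht => D.uu_tc G hG hwm hw' hw r ht) ?_
  filter_upwards [h0] with x hx
  rw [← hx]; simp [uu]
lemma W_uniq {u0 : ℝ → ℝ} (sol : ABSol D.h D.g D.A D.B u0) (h : ∀ x, G x = Us sol (x, 0)) (x : ℝ) {t : ℝ} (ht : 0 ≤ t) :
    D.W G hG (x, t) = Us sol (x, t) := by
  have p1 := D.W_pot G hG (w := fun _ => 0) measurable_const (M' := 0) (by simp)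
  have p2 := sol_pot D.hh D.hg D.eA D.hA D.hB sol
  refine le_antisymm (Pot.comp D.hh D.hg D.eA p2 p1 (fun x => ?_) ht) (Pot.comp D.hh D.hg D.eA p1 p2 (fun x => ?_) ht)
  · rw [W_init, h]
  · rw [W_init, h]
end Geo

lemma bdd_lip' {g : ℝ → ℝ} (hg : Measurable g) {C : ℝ} (hC : ∀ x, |g x| ≤ C) (x y : ℝ) :
    |(∫ z in (0:ℝ)..x, g z) - ∫ z in (0:ℝ)..y, g z| ≤ C * |x - y| := by
  have C0 : 0 ≤ C := (abs_nonneg _).trans (hC 0)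
  have := (bdd_lip hg hC).dist_le_mul x y
  rwa [Real.dist_eq, Real.dist_eq, Real.coe_toNNReal _ C0] at this
lemma bdd_d {g : ℝ → ℝ} (hg : Measurable g) {C : ℝ} (hC : ∀ x, |g x| ≤ C) : ∀ᵐ x, HasDerivAt (fun x => ∫ z in (0:ℝ)..x, g z) (g x) x := by
  filter_upwards [LocallyIntegrable.ae_hasDerivAt_integral (bdd_li hg hC)] with x hx
  exact hx 0
lemma int_ae {f g : ℝ → ℝ} (h : ∀ᵐ x, f x = g x) (x : ℝ) : ∫ z in (0:ℝ)..x, f z = ∫ z in (0:ℝ)..x, g z :=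
  intervalIntegral.integral_congr_ae (h.mono fun _ h _ => h)
lemma int_neg (g : ℝ → ℝ) (x : ℝ) : ∫ z in (0:ℝ)..x, g (-z) = -∫ z in (0:ℝ)..(-x), g z := by
  rw [intervalIntegral.integral_comp_neg, neg_zero, intervalIntegral.integral_symm]

theorem main_cone {T a θl θr A B : ℝ} {fl fr : ℝ → ℝ} (hT : 0 < T) (hl : UC a fl) (hr : UC a fr)
    (hθl : deriv fl θl = 0) (hθr : deriv fr θr = 0)
    (hAB : fl A = fr B) (hA' : deriv fl A ≤ 0) (hB' : 0 ≤ deriv fr B)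
    {Bb Aa : ℝ} {om : ℝ → ℝ}
    (hBb : Bb ≤ θr) (hBbf : fr Bb = fr B)
    (hAa : θl ≤ Aa) (hAaf : fl Aa = fl A)
    (v : ABSol fr fl Bb Aa (fun x => om (-x))) {u0 : ℝ → ℝ} (hu : u0 ∈ InitialSet T fl fr A B om) {lam : ℝ} (hlam : 0 ≤ lam) :
      (fun x => v.u (-x) T + lam * (u0 x - v.u (-x) T)) ∈ InitialSet T fl fr A B om := by
  obtain ⟨⟨um, M1, hM1⟩, sol, hsol⟩ := hu
  obtain ⟨M2, hM2⟩ := sol.bdd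
  obtain ⟨M3, hM3⟩ := v.bdd
  have M20 : 0 ≤ M2 := (abs_nonneg _).trans (hM2 0 0)
  have M30 : 0 ≤ M3 := (abs_nonneg _).trans (hM3 0 0)
  set N1 := |M1| with hN1
  have N10 : 0 ≤ N1 := abs_nonneg _
  set cl : ℝ → ℝ := fun x => max (-N1) (min N1 (u0 x)) with hcl
  have clm : Measurable cl := measurable_const.max (measurable_const.min um)
  have clb : ∀ x, |cl x| ≤ N1 := fun x => abs_le.2 ⟨le_max_left _ _, max_le (by linarith) (min_le_left _ _)⟩
  have cle : ∀ᵐ x, u0 x = cl x := by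
    filter_upwards [hM1] with x hx
    have := abs_le.1 (hx.trans (le_abs_self M1))
    rw [hcl]; simp only
    rw [min_eq_right this.2, max_eq_right this.1]
  have som : Measurable fun x => sol.u x T := sol.meas.comp (measurable_id.prodMk measurable_const)
  have vm : Measurable fun x => v.u x T := v.meas.comp (measurable_id.prodMk measurable_const)
  have vnm : Measurable fun x => v.u (-x) T := vm.comp measurable_neg
  set w : ℝ → ℝ := fun x => v.u (-x) T + lam * (cl x - v.u (-x) T) with hw
  have wm : Measurable w := vnm.add ((clm.sub vnm).const_mul lam)
  set M' := M3 + lam * (N1 + M3) with hM'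
  have M'0 : 0 ≤ M' := by positivity
  have wb : ∀ x, |w x| ≤ M' := by
    intro x
    refine (abs_add_le _ _).trans (add_le_add (hM3 _ _) ?_)
    rw [abs_mul, abs_of_nonneg hlam]
    exact mul_le_mul_of_nonneg_left ((abs_sub _ _).trans (add_le_add (clb x) (hM3 _ _))) hlam
  have we : ∀ᵐ x, w x = v.u (-x) T + lam * (u0 x - v.u (-x) T) := by
    filter_upwards [cle] with x hx
    rw [hw, hx]
  obtain ⟨D, rfl, rfl, rfl, rfl, rfl, rfl⟩ := Geo.ex hl hr hθl hθr hAB hA' hB' hBb hBbf hAa hAaf (M := N1 + M2 + M') (by positivity)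
  set U0 : ℝ → ℝ := fun x => ∫ z in (0:ℝ)..x, cl z with hU0
  have up : ∀ {C : ℝ} {x y z : ℝ}, C ≤ N1 + M2 + M' → z ≤ C * |x - y| → z ≤ (N1 + M2 + M') * |x - y| :=
    fun h1 h2 => h2.trans (mul_le_mul_of_nonneg_right h1 (abs_nonneg _))
  have h0 : ∀ x y, |U0 x - U0 y| ≤ (N1 + M2 + M') * |x - y| := fun x y => up (by linarith) (bdd_lip' clm clb x y)
  set R : ℝ → ℝ := fun x => ∫ z in (0:ℝ)..x, sol.u (-z) T with hRd
  have hR : ∀ x y, |R x - R y| ≤ (N1 + M2 + M') * |x - y| := fun x y =>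
    up (by linarith) (bdd_lip' (som.comp measurable_neg) (fun x => hM2 (-x) T) x y)
  obtain ⟨κ, hκ⟩ := Us_T sol hT.le
  obtain ⟨κ', hκ'⟩ := Us_T v hT.le
  have e1 : ∀ x t, 0 ≤ t → D.W U0 h0 (x, t) = Us sol (x, t) := fun x t ht => D.W_uniq U0 h0 sol (fun x => by
    rw [Us_zero, int_ae cle]) x ht
  have e2 : ∀ x t, 0 ≤ t → D.rev.W R hR (x, t) = Us v (x, t) := fun x t ht => D.rev.W_uniq R hR v (fun x => by
    refine Eq.trans ?_ (Us_zero v x).symm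
    refine int_ae ?_ x
    exact (Measure.measurePreserving_neg (volume : Measure ℝ)).quasiMeasurePreserving.ae hsol) x ht
  set I : ℝ → ℝ := fun x => ∫ z in (0:ℝ)..x, w z with hI
  set G : ℝ → ℝ := fun x => I x + (1 - lam) * (κ - κ') with hGd
  have hG : ∀ x y, |G x - G y| ≤ (N1 + M2 + M') * |x - y| := fun x y => by
    have := bdd_lip' wm wb x y
    refine up (by linarith : M' ≤ _) ?_
    rw [hGd]; simp only
    rwa [add_sub_add_right_eq_sub]
  have key := D.cone G hG (U0 := U0) (Us := fun y => -D.rev.W R hR (-y, T) + κ) (κ := κ) (T := T) hlam h0 hR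
    (fun x => by
      rw [e1 _ _ hT.le, hκ, hRd]
      simp only
      rw [int_neg (fun z => sol.u z T)]; ring) (fun y => rfl)
    (fun y => by
      rw [e2 _ _ hT.le, hκ', hGd, hI, hU0]
      simp only
      have q := int_neg (fun z => v.u z T) y
      have q1 := bdd_ii vnm (fun x => hM3 (-x) T) 0 y
      have q2 := bdd_ii clm clb 0 y
      rw [hw, intervalIntegral.integral_add q1 ((q2.sub q1).const_mul lam), intervalIntegral.integral_const_mul,
        intervalIntegral.integral_sub q2 q1, q]
      ring)
  have Gd : ∀ᵐ x, HasDerivAt G (w x) x := by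
    filter_upwards [bdd_d wm wb] with x hx
    exact hx.add_const _
  obtain ⟨s, hs⟩ := D.sol_ex G hG wm wb Gd we
  refine ⟨⟨vnm.add ((um.sub vnm).const_mul lam), M', ?_⟩, s, ?_⟩
  · filter_upwards [we] with x hx
    rw [← hx]; exact wb x
  · have ne : ∀ᵐ x : ℝ, x ≠ 0 := by simp [ae_iff]
    filter_upwards [ne, hsol, bdd_d som (fun x => hM2 x T)] with x hx h1 h2
    rw [hs, ← h1]
    refine D.uu_d G hG hx hT ?_
    have : (fun y => D.W G hG (y, T)) = fun y => (∫ z in (0:ℝ)..y, sol.u z T) + κ := by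
      ext y
      rw [key, e1 _ _ hT.le, hκ]
    rw [this]
    exact h2.add_const _

end

/-- `I_T^{[AB]}(ω^T)` is an affine cone with vertex the
backward-forward datum `u_0^*` (part of Theorem 3.3 (ii) of the paper). -/
theorem initial_set_is_affine_cone
    {T a θl θr A B : ℝ} {fl fr : ℝ → ℝ}
    (hT : 0 < T)
    (hflC : ContDiff ℝ 2 fl) (hfrC : ContDiff ℝ 2 fr)
    (ha : 0 < a)
    (hfl2 : ∀ w : ℝ, a ≤ deriv (deriv fl) w)
    (hfr2 : ∀ w : ℝ, a ≤ deriv (deriv fr) w)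
    (hf0 : fl 0 = fr 0) (hf1 : fl 1 = fr 1)
    (hθl : deriv fl θl = 0) (hθr : deriv fr θr = 0)
    (hθl0 : 0 ≤ θl) (hθr1 : θr ≤ 1)
    (hAB : fl A = fr B) (hA' : deriv fl A ≤ 0) (hB' : 0 ≤ deriv fr B)
    {Bb Aa : ℝ} {ω : ℝ → ℝ}
    (hBb : Bb ≤ θr) (hBbf : fr Bb = fr B)
    (hAa : θl ≤ Aa) (hAaf : fl Aa = fl A)
    (hω : Attainable T fl fr A B ω)
    (v : ABSol fr fl Bb Aa (fun x => ω (-x)))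
    (ustar : ABSol fl fr A B (fun x => v.u (-x) T))
    :
    ∀ u0 ∈ InitialSet T fl fr A B ω, ∀ lam : ℝ, 0 ≤ lam →
      (fun x => v.u (-x) T + lam * (u0 x - v.u (-x) T)) ∈
        InitialSet T fl fr A B ω := by
  intro u0 hu lam hlam
  exact main_cone hT ⟨ha, hflC, hfl2⟩ ⟨ha, hfrC, hfr2⟩ hθl hθr hAB hA' hB' hBb hBbf hAa hAaf v hu hlam
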